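/- There is an absolute constant c > 0 with the following property. Let h be a positive even integer and ϑ ≥ 0.7284, and assume Hypothesis D(ϑ, h). Then for all sufficiently large N, #{p ≤ N : p and p + h are both prime} ≥ c · 𝔖_0(h) · N/(log N)^2. -/

import Mathlib

open Filter

/-- The Liouville function `λ(n) = (-1)^Ω(n)`. -/
noncomputable def lio (n : ℕ) : ℝ := (-1) ^ n.primeFactorsList.length

/-- `θ(n) = log n` if `n` is prime, `0` otherwise. -/
noncomputable def theta (n : ℕ) : ℝ := if n.Prime then Real.log n else 0

/-- `max_a |∑_{n ≤ N, n ≡ a (q)} f(n)|`. -/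
noncomputable def maxAbs (f : ℕ → ℝ) (q N : ℕ) : ℝ :=
  ⨆ a : ℕ, |∑ n ∈ Finset.Icc 1 N, if n % q = a % q then f n else 0|

/-- `f` has (zero-mean) distribution level `ϑ`. -/
def HasLevel (f : ℕ → ℝ) (ϑ : ℝ) : Prop :=
  ∀ ε > (0 : ℝ), ∀ A > (0 : ℝ), ∃ C > (0 : ℝ), ∀ N : ℕ, 2 ≤ N →
    ∑ q ∈ Finset.Icc 1 ⌊(N : ℝ) ^ (ϑ - ε)⌋₊, maxAbs f q N ≤ C * N / Real.log N ^ A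

/-- `max_{(a,q)=1} |∑_{p ≤ N, p ≡ a (q)} log p - N/φ(q)|`. -/
noncomputable def primeMaxAbs (q N : ℕ) : ℝ :=
  ⨆ a : ℕ, if Nat.Coprime a q then
    |(∑ p ∈ Finset.Icc 1 N, if p.Prime ∧ p % q = a % q then Real.log p else 0)
      - N / q.totient|
  else 0

/-- The primes have distribution level `ϑ` (Bombieri–Vinogradov/Elliott–Halberstam type). -/
def PrimesLevel (ϑ : ℝ) : Prop :=
  ∀ ε > (0 : ℝ), ∀ A > (0 : ℝ), ∃ C > (0 : ℝ), ∀ N : ℕ, 2 ≤ N →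
    ∑ q ∈ Finset.Icc 1 ⌊(N : ℝ) ^ (ϑ - ε)⌋₊, primeMaxAbs q N ≤ C * N / Real.log N ^ A

/-- Hypothesis D(ϑ, h): the primes and the four auxiliary Liouville-type sequences
all have distribution level `ϑ`. -/
def HypD (ϑ : ℝ) (h : ℕ) : Prop :=
  PrimesLevel ϑ ∧
  HasLevel lio ϑ ∧
  HasLevel (fun n => lio n * lio (n + h)) ϑ ∧
  HasLevel (fun n => theta n * lio (n + h)) ϑ ∧
  HasLevel (fun n => if h < n then theta n * lio (n - h) else 0) ϑ

/-- The Goldston–Pintz–Yıldırım weight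
`Λ_R(n; H, l) = (1/(k+l)!) ∑_{d ≤ R, d ∣ P_H(n)} μ(d) (log (R/d))^{k+l}`. -/
noncomputable def LambdaR (R : ℝ) (n : ℕ) (H : Finset ℕ) (l : ℕ) : ℝ :=
  (1 / (H.card + l).factorial) *
    ∑ d ∈ Finset.Icc 1 ⌊R⌋₊,
      if d ∣ ∏ hi ∈ H, (n + hi) then
        (ArithmeticFunction.moebius d : ℝ) * Real.log (R / d) ^ (H.card + l)
      else 0

/-- `ν_m(H)`: the number of residue classes `n` mod `m` with `m ∣ P_H(n)`. -/
def nu (H : Finset ℕ) (m : ℕ) : ℕ :=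
  ((Finset.range m).filter fun n => m ∣ ∏ hi ∈ H, (n + hi)).card

/-- The singular series `𝔖(H) = ∏_p (1 - ν_p(H)/p)(1 - 1/p)^{-k}`. -/
noncomputable def singSeries (H : Finset ℕ) : ℝ :=
  ∏' p : Nat.Primes, (1 - (nu H p : ℝ) / (p : ℕ)) * (1 - 1 / ((p : ℕ) : ℝ)) ^ (-(H.card : ℤ))

/-- `𝔖₀(h) = ∏_{p ∣ h} (1-1/p)⁻¹ ∏_{p ∤ h} (1 - 1/(p-1)²)`. -/
noncomputable def singSeries0 (h : ℕ) : ℝ :=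
  ∏' p : Nat.Primes, if (p : ℕ) ∣ h then (1 - 1 / ((p : ℕ) : ℝ))⁻¹
    else 1 - 1 / (((p : ℕ) : ℝ) - 1) ^ 2

/-- The strongly multiplicative extension `d ↦ ∏_{p ∣ d} a(p)` of a function on the primes. -/
noncomputable def primeProd (a : ℕ → ℝ) (d : ℕ) : ℝ := ∏ p ∈ d.primeFactors, a p

/-- The squarefree integers in `[1, M]` that are coprime to `W`. -/
noncomputable def sqfreeCoprime (W M : ℕ) : Finset ℕ :=
  (Finset.Icc 1 M).filter fun d => Squarefree d ∧ d.Coprime W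

lemma mem_sqfreeCoprime {W M d : ℕ} :
    d ∈ sqfreeCoprime W M ↔ (1 ≤ d ∧ d ≤ M) ∧ Squarefree d ∧ d.Coprime W := by
  simp [sqfreeCoprime]

lemma mem_sqfreeCoprime_of_dvd {W M d e : ℕ} (hd : d ∈ sqfreeCoprime W M) (h : e ∣ d) :
    e ∈ sqfreeCoprime W M := by
  rw [mem_sqfreeCoprime] at hd ⊢
  obtain ⟨⟨h1, h2⟩, h3, h4⟩ := hd
  exact ⟨⟨Nat.pos_of_dvd_of_pos h h1, (Nat.le_of_dvd h1 h).trans h2⟩,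
    h3.squarefree_of_dvd h, h4.coprime_dvd_left h⟩

lemma primeProd_one (a : ℕ → ℝ) : primeProd a 1 = 1 := by simp [primeProd]

lemma primeProd_mul_of_coprime (a : ℕ → ℝ) {m n : ℕ} (h : m.Coprime n) :
    primeProd a (m * n) = primeProd a m * primeProd a n := by
  unfold primeProd
  rw [h.primeFactors_mul, Finset.prod_union h.disjoint_primeFactors]

lemma primeProd_mul (a b : ℕ → ℝ) (d : ℕ) :
    primeProd a d * primeProd b d = primeProd (fun p => a p * b p) d := by
  simp [primeProd, Finset.prod_mul_distrib]

lemma primeProd_congr {a b : ℕ → ℝ} {d : ℕ} (h : ∀ p ∈ d.primeFactors, a p = b p) :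
    primeProd a d = primeProd b d :=
  Finset.prod_congr rfl h

lemma primeProd_nonneg {a : ℕ → ℝ} {d : ℕ} (h : ∀ p ∈ d.primeFactors, 0 ≤ a p) :
    0 ≤ primeProd a d :=
  Finset.prod_nonneg h

lemma primeProd_mono {a b : ℕ → ℝ} {d : ℕ} (h0 : ∀ p ∈ d.primeFactors, 0 ≤ a p)
    (h : ∀ p ∈ d.primeFactors, a p ≤ b p) : primeProd a d ≤ primeProd b d :=
  Finset.prod_le_prod h0 h

lemma abs_primeProd (a : ℕ → ℝ) (d : ℕ) : |primeProd a d| = primeProd (fun p => |a p|) d :=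
  Finset.abs_prod _ _

lemma primeProd_zero {d : ℕ} (hd : d ≠ 0) : primeProd (fun _ => 0) d = if d = 1 then 1 else 0 := by
  split_ifs with h
  · simp [h, primeProd]
  · unfold primeProd
    obtain ⟨p, hp⟩ := Nat.nonempty_primeFactors.2 (show 1 < d by omega)
    exact Finset.prod_eq_zero hp rfl

lemma primeProd_lcm_mul_gcd (a : ℕ → ℝ) {m n : ℕ} (hm : m ≠ 0) (hn : n ≠ 0) :
    primeProd a (m.lcm n) * primeProd a (m.gcd n) = primeProd a m * primeProd a n := by
  unfold primeProd
  rw [Nat.primeFactors_gcd hm hn]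
  have : (m.lcm n).primeFactors = m.primeFactors ∪ n.primeFactors := by
    ext p
    simp only [Nat.mem_primeFactors, Finset.mem_union, ne_eq, hm, hn, Nat.lcm_ne_zero hm hn,
      not_false_eq_true, and_true]
    constructor
    · rintro ⟨hp, h⟩
      rcases hp.dvd_lcm.1 h with h | h
      · exact Or.inl ⟨hp, h⟩
      · exact Or.inr ⟨hp, h⟩
    · rintro (⟨hp, h⟩ | ⟨hp, h⟩)
      · exact ⟨hp, h.trans (Nat.dvd_lcm_left _ _)⟩
      · exact ⟨hp, h.trans (Nat.dvd_lcm_right _ _)⟩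
  rw [this, Finset.prod_union_inter]

lemma sum_divisors_primeProd (a : ℕ → ℝ) {d : ℕ} (hd : Squarefree d) :
    ∑ e ∈ d.divisors, primeProd a e = primeProd (fun p => 1 + a p) d := by
  unfold primeProd
  rw [Finset.prod_one_add, ← Nat.divisors_filter_squarefree_of_squarefree hd,
    Nat.sum_divisors_filter_squarefree hd.ne_zero,
    show (UniqueFactorizationMonoid.normalizedFactors d).toFinset = d.primeFactors by
      rw [Nat.factors_eq]; rfl]
  refine Finset.sum_congr rfl fun s hs => ?_
  have hs' : ∀ p ∈ s, p.Prime := fun p hp =>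
    Nat.prime_of_mem_primeFactors (Finset.mem_powerset.1 hs hp)
  rw [show (s.val.prod) = ∏ p ∈ s, p from Finset.prod_val s, Nat.primeFactors_prod hs']

lemma sum_divisors_between_primeProd (a : ℕ → ℝ) {r s : ℕ} (hs : Squarefree s) (hr : r ∣ s) :
    ∑ d ∈ s.divisors with r ∣ d, primeProd a d =
      primeProd a r * primeProd (fun p => 1 + a p) (s / r) := by
  obtain ⟨t, rfl⟩ := hr
  have hr0 : 0 < r := Nat.pos_of_ne_zero (left_ne_zero_of_mul hs.ne_zero)
  have ht0 : t ≠ 0 := right_ne_zero_of_mul hs.ne_zero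
  have hcop : r.Coprime t := (Nat.squarefree_mul_iff.1 hs).1
  rw [Nat.mul_div_cancel_left _ hr0, ← sum_divisors_primeProd a (Nat.squarefree_mul_iff.1 hs).2.2,
    Finset.mul_sum]
  symm
  refine Finset.sum_bij (fun e _ => r * e) ?_ ?_ ?_ ?_
  · intro e he
    simp only [Finset.mem_filter, Nat.mem_divisors] at he ⊢
    exact ⟨⟨Nat.mul_dvd_mul_left r he.1, hs.ne_zero⟩, dvd_mul_right _ _⟩
  · intro e _ e' _ h
    exact Nat.eq_of_mul_eq_mul_left hr0 h
  · intro d hd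
    simp only [Finset.mem_filter, Nat.mem_divisors] at hd
    obtain ⟨⟨h1, _⟩, e, rfl⟩ := hd
    exact ⟨e, by simp [Nat.dvd_of_mul_dvd_mul_left hr0 h1, ht0], rfl⟩
  · intro e he
    rw [primeProd_mul_of_coprime]
    exact hcop.coprime_dvd_right (Nat.dvd_of_mem_divisors he)

lemma not_dvd_of_mem_primeFactors {W M d p : ℕ} (hd : d ∈ sqfreeCoprime W M)
    (hp : p ∈ d.primeFactors) : p.Prime ∧ ¬ p ∣ W := by
  have h := (mem_sqfreeCoprime.1 hd).2.2
  have hp' := Nat.prime_of_mem_primeFactors hp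
  exact ⟨hp', fun hW => Nat.not_coprime_of_dvd_of_dvd hp'.one_lt (Nat.dvd_of_mem_primeFactors hp)
    hW h⟩

/-- Diagonalisation of the Selberg quadratic form. -/
lemma selberg_diagonal (g lam : ℕ → ℝ) (W M : ℕ) (hg : ∀ p : ℕ, p.Prime → ¬ p ∣ W → g p ≠ 0) :
    ∑ d ∈ sqfreeCoprime W M, ∑ e ∈ sqfreeCoprime W M, lam d * lam e * primeProd g (d.lcm e) =
      ∑ r ∈ sqfreeCoprime W M, primeProd (fun p => (g p)⁻¹ - 1) r *
        (∑ d ∈ sqfreeCoprime W M with r ∣ d, primeProd g d * lam d) ^ 2 := by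
  have key : ∀ d ∈ sqfreeCoprime W M, ∀ e ∈ sqfreeCoprime W M,
      primeProd g (d.lcm e) = ∑ r ∈ sqfreeCoprime W M, primeProd (fun p => (g p)⁻¹ - 1) r *
        ((if r ∣ d then primeProd g d else 0) * (if r ∣ e then primeProd g e else 0)) := by
    intro d hd e he
    have hd' := mem_sqfreeCoprime.1 hd
    have he' := mem_sqfreeCoprime.1 he
    have hd0 : d ≠ 0 := by omega
    have he0 : e ≠ 0 := by omega
    have hgcd : d.gcd e ∈ sqfreeCoprime W M := mem_sqfreeCoprime_of_dvd hd (Nat.gcd_dvd_left d e)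
    have h1 : primeProd (fun p => (g p)⁻¹) (d.gcd e) =
        ∑ r ∈ sqfreeCoprime W M with r ∣ d ∧ r ∣ e, primeProd (fun p => (g p)⁻¹ - 1) r := by
      have : (sqfreeCoprime W M).filter (fun r => r ∣ d ∧ r ∣ e) = (d.gcd e).divisors := by
        ext r
        simp only [Finset.mem_filter, Nat.mem_divisors, Nat.dvd_gcd_iff]
        constructor
        · rintro ⟨_, h⟩
          exact ⟨h, Nat.gcd_ne_zero_left hd0⟩
        · rintro ⟨h, _⟩
          exact ⟨mem_sqfreeCoprime_of_dvd hd h.1, h⟩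
      rw [this, sum_divisors_primeProd _ (mem_sqfreeCoprime.1 hgcd).2.1]
      exact primeProd_congr fun p _ => by ring
    have h2 : primeProd g (d.gcd e) * primeProd (fun p => (g p)⁻¹) (d.gcd e) = 1 := by
      rw [primeProd_mul]
      refine Finset.prod_eq_one fun p hp => ?_
      obtain ⟨hp1, hp2⟩ := not_dvd_of_mem_primeFactors hgcd hp
      exact mul_inv_cancel₀ (hg p hp1 hp2)
    have h3 := primeProd_lcm_mul_gcd g hd0 he0
    calc primeProd g (d.lcm e) = primeProd g (d.lcm e) *
          (primeProd g (d.gcd e) * primeProd (fun p => (g p)⁻¹) (d.gcd e)) := by rw [h2, mul_one]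
      _ = primeProd g d * primeProd g e * primeProd (fun p => (g p)⁻¹) (d.gcd e) := by
          rw [← mul_assoc, h3]
      _ = _ := by
          rw [h1, Finset.mul_sum, Finset.sum_filter]
          refine Finset.sum_congr rfl fun r _ => ?_
          by_cases h4 : r ∣ d <;> by_cases h5 : r ∣ e <;> simp [h4, h5]; ring
  have h6 : ∀ d ∈ sqfreeCoprime W M, ∀ e ∈ sqfreeCoprime W M,
      lam d * lam e * primeProd g (d.lcm e) =
        ∑ r ∈ sqfreeCoprime W M, primeProd (fun p => (g p)⁻¹ - 1) r *
        ((if r ∣ d then primeProd g d * lam d else 0) *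
          (if r ∣ e then primeProd g e * lam e else 0)) := by
    intro d hd e he
    rw [key d hd e he, Finset.mul_sum]
    refine Finset.sum_congr rfl fun r _ => ?_
    split_ifs <;> ring
  rw [Finset.sum_congr rfl fun d hd => Finset.sum_congr rfl fun e he => h6 d hd e he]
  rw [Finset.sum_congr rfl fun d _ => Finset.sum_comm, Finset.sum_comm]
  refine Finset.sum_congr rfl fun r _ => ?_
  rw [sq, Finset.sum_filter, Finset.sum_mul_sum, Finset.mul_sum]
  exact Finset.sum_congr rfl fun d _ => by rw [Finset.mul_sum]

/-- Sieve weights attached to a sequence `y`, for the local densities `2 / p`. -/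
noncomputable def sieveWeight (W M : ℕ) (y : ℕ → ℝ) (d : ℕ) : ℝ :=
  primeProd (fun p => -((p : ℝ) / 2)) d *
    ∑ s ∈ sqfreeCoprime W M with d ∣ s, primeProd (fun p => 2 / ((p : ℝ) - 2)) s * y s

lemma sum_primeProd_mul_sieveWeight (g : ℕ → ℝ) (W M : ℕ) (y : ℕ → ℝ) (r : ℕ) :
    ∑ d ∈ sqfreeCoprime W M with r ∣ d, primeProd g d * sieveWeight W M y d =
      ∑ s ∈ sqfreeCoprime W M with r ∣ s, primeProd (fun p => 2 / ((p : ℝ) - 2)) s * y s *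
        (primeProd (fun p => -(g p * (p / 2))) r *
          primeProd (fun p => 1 - g p * (p / 2)) (s / r)) := by
  have h1 : ∀ d, primeProd g d * sieveWeight W M y d = ∑ s ∈ sqfreeCoprime W M,
      if d ∣ s then primeProd (fun p => -(g p * (p / 2))) d *
        (primeProd (fun p => 2 / ((p : ℝ) - 2)) s * y s) else 0 := by
    intro d
    rw [sieveWeight, ← mul_assoc, primeProd_mul, ← Finset.sum_filter, Finset.mul_sum]
    refine Finset.sum_congr rfl fun s _ => ?_
    congr 1
    exact primeProd_congr fun p _ => by ring
  rw [Finset.sum_congr rfl fun d _ => h1 d, Finset.sum_comm]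
  rw [Finset.sum_filter]
  refine Finset.sum_congr rfl fun s hs => ?_
  have hs' := mem_sqfreeCoprime.1 hs
  rw [← Finset.sum_filter, Finset.filter_filter, ← Finset.sum_mul]
  split_ifs with hrs
  · have : (sqfreeCoprime W M).filter (fun d => r ∣ d ∧ d ∣ s) =
        s.divisors.filter (fun d => r ∣ d) := by
      ext d
      simp only [Finset.mem_filter, Nat.mem_divisors]
      constructor
      · rintro ⟨_, h, h'⟩
        exact ⟨⟨h', by omega⟩, h⟩
      · rintro ⟨⟨h', _⟩, h⟩
        exact ⟨mem_sqfreeCoprime_of_dvd hs h', h, h'⟩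
    rw [this, sum_divisors_between_primeProd _ hs'.2.1 hrs, mul_comm]
    congr 2
  · rw [Finset.filter_false_of_mem, Finset.sum_empty, zero_mul]
    rintro d _ ⟨h, h'⟩
    exact hrs (h.trans h')

lemma two_lt_of_mem_primeFactors {W M d p : ℕ} (hW : 2 ∣ W) (hd : d ∈ sqfreeCoprime W M)
    (hp : p ∈ d.primeFactors) : (2 : ℝ) < p := by
  obtain ⟨h1, h2⟩ := not_dvd_of_mem_primeFactors hd hp
  have : p ≠ 2 := fun h => h2 (h ▸ hW)
  have := h1.two_le
  exact_mod_cast (by omega : 2 < p)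

lemma mainTerm_two_div (W M : ℕ) (y : ℕ → ℝ) (hW : 2 ∣ W) :
    ∑ d ∈ sqfreeCoprime W M, ∑ e ∈ sqfreeCoprime W M, sieveWeight W M y d * sieveWeight W M y e *
      primeProd (fun p => 2 / (p : ℝ)) (d.lcm e) =
    ∑ s ∈ sqfreeCoprime W M, primeProd (fun p => 2 / ((p : ℝ) - 2)) s * y s ^ 2 := by
  rw [selberg_diagonal _ _ _ _ (fun p hp _ => by have := hp.pos; positivity)]
  refine Finset.sum_congr rfl fun r hr => ?_
  have hr' := mem_sqfreeCoprime.1 hr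
  rw [sum_primeProd_mul_sieveWeight]
  have h1 : ∀ s ∈ (sqfreeCoprime W M).filter (fun s => r ∣ s),
      primeProd (fun p => 2 / ((p : ℝ) - 2)) s * y s *
        (primeProd (fun p => -(2 / (p : ℝ) * (p / 2))) r *
          primeProd (fun p => 1 - 2 / (p : ℝ) * (p / 2)) (s / r)) =
      if s = r then primeProd (fun p => 2 / ((p : ℝ) - 2)) r * y r * primeProd (fun _ => -1) r
        else 0 := by
    intro s hs
    rw [Finset.mem_filter] at hs
    have hs' := mem_sqfreeCoprime.1 hs.1
    have h2 : primeProd (fun p => 1 - 2 / (p : ℝ) * (p / 2)) (s / r) =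
        primeProd (fun _ => 0) (s / r) := primeProd_congr fun p hp => by
      have := (Nat.prime_of_mem_primeFactors hp).pos
      field_simp
      norm_num
    have h3 : primeProd (fun p => -(2 / (p : ℝ) * (p / 2))) r = primeProd (fun _ => -1) r :=
      primeProd_congr fun p hp => by
        have := (Nat.prime_of_mem_primeFactors hp).pos
        field_simp
    have h4 : s / r = 1 ↔ s = r := by
      rw [Nat.div_eq_iff_eq_mul_left (by omega) hs.2, one_mul]
    rw [h2, h3, primeProd_zero (Nat.div_pos (Nat.le_of_dvd (by omega) hs.2) (by omega)).ne']
    simp only [h4]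
    split_ifs with h5
    · rw [h5]; ring
    · ring
  rw [Finset.sum_congr rfl h1, Finset.sum_ite_eq' _ r]
  rw [if_pos (by simp [hr])]
  rw [mul_pow, mul_pow, sq (primeProd _ r), sq (primeProd (fun _ => -1) r), primeProd_mul,
    primeProd_mul]
  have : ∀ a b c y : ℝ, a * (b * y * c) = a * b * c * y := by intros; ring
  rw [this, primeProd_mul, primeProd_mul]
  congr 1
  refine primeProd_congr fun p hp => ?_
  have := two_lt_of_mem_primeFactors hW hr hp
  have h6 : (p : ℝ) - 2 ≠ 0 := by linarith
  have h7 : (p : ℝ) ≠ 0 := by linarith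
  field_simp

lemma mainTerm_totient_ge (W M : ℕ) (y : ℕ → ℝ) (hW : 2 ∣ W) :
    ∑ r ∈ sqfreeCoprime W M, primeProd (fun p => 1 / ((p : ℝ) - 1)) r *
      (primeProd (fun p => (p : ℝ) / (p - 1)) r * ∑ s ∈ sqfreeCoprime W M with r ∣ s,
        primeProd (fun p => 1 / ((p : ℝ) - 1)) (s / r) * y s) ^ 2 ≤
    ∑ d ∈ sqfreeCoprime W M, ∑ e ∈ sqfreeCoprime W M, sieveWeight W M y d * sieveWeight W M y e *
      primeProd (fun p => 1 / ((p : ℝ) - 1)) (d.lcm e) := by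
  rw [selberg_diagonal _ _ _ _ (fun p hp _ => by
    have : (1 : ℝ) < p := by exact_mod_cast hp.one_lt
    exact one_div_ne_zero (by linarith))]
  refine Finset.sum_le_sum fun r hr => ?_
  have hr' := mem_sqfreeCoprime.1 hr
  rw [sum_primeProd_mul_sieveWeight]
  have h1 : ∑ s ∈ sqfreeCoprime W M with r ∣ s, primeProd (fun p => 2 / ((p : ℝ) - 2)) s * y s *
        (primeProd (fun p => -(1 / ((p : ℝ) - 1) * (p / 2))) r *
          primeProd (fun p => 1 - 1 / ((p : ℝ) - 1) * (p / 2)) (s / r)) =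
      primeProd (fun p => -((p : ℝ) / (p - 1)) * (1 / (p - 2))) r *
        ∑ s ∈ sqfreeCoprime W M with r ∣ s,
          primeProd (fun p => 1 / ((p : ℝ) - 1)) (s / r) * y s := by
    rw [Finset.mul_sum]
    refine Finset.sum_congr rfl fun s hs => ?_
    rw [Finset.mem_filter] at hs
    obtain ⟨hs, t, rfl⟩ := hs
    have hs' := mem_sqfreeCoprime.1 hs
    have hcop := (Nat.squarefree_mul_iff.1 hs'.2.1).1
    have ht : t ∈ sqfreeCoprime W M := mem_sqfreeCoprime_of_dvd hs (dvd_mul_left _ _)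
    rw [Nat.mul_div_cancel_left _ (by omega), primeProd_mul_of_coprime _ hcop]
    have h2 : primeProd (fun p => 2 / ((p : ℝ) - 2)) r *
        primeProd (fun p => -(1 / ((p : ℝ) - 1) * (p / 2))) r =
        primeProd (fun p => -((p : ℝ) / (p - 1)) * (1 / (p - 2))) r := by
      rw [primeProd_mul]
      refine primeProd_congr fun p hp => ?_
      have := two_lt_of_mem_primeFactors hW hr hp
      have h6 : (p : ℝ) - 2 ≠ 0 := by linarith
      have h7 : (p : ℝ) - 1 ≠ 0 := by linarith
      field_simp
    have h3 : primeProd (fun p => 2 / ((p : ℝ) - 2)) t *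
        primeProd (fun p => 1 - 1 / ((p : ℝ) - 1) * (p / 2)) t =
        primeProd (fun p => 1 / ((p : ℝ) - 1)) t := by
      rw [primeProd_mul]
      refine primeProd_congr fun p hp => ?_
      have := two_lt_of_mem_primeFactors hW ht hp
      have h6 : (p : ℝ) - 2 ≠ 0 := by linarith
      have h7 : (p : ℝ) - 1 ≠ 0 := by linarith
      field_simp
      ring
    rw [← h2, ← h3]
    ring
  rw [h1, mul_pow, mul_pow, ← mul_assoc, ← mul_assoc]
  refine mul_le_mul_of_nonneg_right ?_ (sq_nonneg _)
  rw [sq, sq, primeProd_mul, primeProd_mul, primeProd_mul, primeProd_mul]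
  refine primeProd_mono (fun p hp => ?_) (fun p hp => ?_)
  all_goals
    have := two_lt_of_mem_primeFactors hW hr hp
    have h6 : 0 < (p : ℝ) - 2 := by linarith
    have h7 : 0 < (p : ℝ) - 1 := by linarith
  · positivity
  · have h8 : ((1 / ((p : ℝ) - 1))⁻¹ - 1) * (-((p : ℝ) / (p - 1)) * (1 / (p - 2)) *
        (-((p : ℝ) / (p - 1)) * (1 / (p - 2)))) =
        1 / (p - 2) * ((p : ℝ) / (p - 1) * ((p : ℝ) / (p - 1))) := by
      field_simp
      ring
    rw [h8]
    gcongr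
    linarith

lemma sum_inv_factored_le (T S : Finset ℕ) (hT : ∀ p ∈ T, p.Prime)
    (hS : ∀ m ∈ S, m ≠ 0 ∧ m.primeFactors ⊆ T) :
    ∑ m ∈ S, 1 / (m : ℝ) ≤ ∏ p ∈ T, (p : ℝ) / (p - 1) := by
  let f : ℕ →* ℝ := ((invMonoidWithZeroHom : ℝ →*₀ ℝ) : ℝ →* ℝ).comp (Nat.castRingHom ℝ : ℕ →* ℝ)
  have hf : ∀ n, f n = (n : ℝ)⁻¹ := fun n => rfl
  have h := (EulerProduct.summable_and_hasSum_factoredNumbers_prod_filter_prime_geometric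
    (f := f) (fun {p} hp => by
      rw [hf, Real.norm_eq_abs, abs_of_nonneg (by positivity)]
      exact inv_lt_one_of_one_lt₀ (by exact_mod_cast hp.one_lt)) T).2
  have hmem : ∀ m ∈ S, m ∈ Nat.factoredNumbers T := fun m hm =>
    Nat.mem_factoredNumbers.2 ⟨(hS m hm).1, fun p hp =>
      (hS m hm).2 (Nat.mem_primeFactors_iff_mem_primeFactorsList.2 hp)⟩
  have h2 := sum_le_hasSum (S.attach.map ⟨fun m => (⟨m.1, hmem m.1 m.2⟩ : Nat.factoredNumbers T),
    fun a b hab => Subtype.ext (Subtype.mk.inj hab)⟩)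
    (fun m _ => by rw [hf]; positivity) h
  rw [Finset.sum_map, Finset.filter_true_of_mem hT] at h2
  simp only [hf] at h2
  change ∑ m ∈ S.attach, (fun m : ℕ => (m : ℝ)⁻¹) m.1 ≤ _ at h2
  rw [Finset.sum_attach S (fun m => ((m : ℝ))⁻¹)] at h2
  calc ∑ m ∈ S, 1 / (m : ℝ) = ∑ m ∈ S, (m : ℝ)⁻¹ := by simp
    _ ≤ _ := h2
    _ = _ := Finset.prod_congr rfl fun p hp => by
      have : (1 : ℝ) < p := by exact_mod_cast (hT p hp).one_lt
      have h3 : (p : ℝ) - 1 ≠ 0 := by linarith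
      field_simp

lemma sum_coprime_div_le (W M r : ℕ) (hr : r ≠ 0) (f : ℕ → ℝ) (hf0 : ∀ n, 0 ≤ f n)
    (hf : ∀ m n, 1 ≤ m → m ≤ n → f n ≤ f m) :
    ∑ n ∈ Finset.Icc 1 M with n.Coprime W, f n / n ≤
      primeProd (fun p => (p : ℝ) / (p - 1)) r *
        ∑ a ∈ sqfreeCoprime W M with a.Coprime r, primeProd (fun p => 1 / ((p : ℝ) - 1)) a * f a := by
  let ρ : ℕ → ℕ := fun n => ∏ p ∈ n.primeFactors \ r.primeFactors, p
  have hpr : ∀ n : ℕ, ∀ p ∈ n.primeFactors \ r.primeFactors, p.Prime := fun n p hp =>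
    Nat.prime_of_mem_primeFactors (Finset.mem_sdiff.1 hp).1
  have hρpf : ∀ n, (ρ n).primeFactors = n.primeFactors \ r.primeFactors := fun n =>
    Nat.primeFactors_prod (hpr n)
  have hρpos : ∀ n, 0 < ρ n := fun n => Finset.prod_pos fun p hp => (hpr n p hp).pos
  have hρdvd : ∀ n, ρ n ∣ n := fun n =>
    (Finset.prod_dvd_prod_of_subset _ _ _ Finset.sdiff_subset).trans (Nat.prod_primeFactors_dvd n)
  have hρsq : ∀ n, Squarefree (ρ n) := fun n =>
    Finset.squarefree_prod_of_pairwise_isCoprime (fun p hp q hq hpq =>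
      Nat.coprime_iff_isRelPrime.1 ((Nat.coprime_primes (hpr n p hp) (hpr n q hq)).2 hpq))
      fun p hp => (hpr n p hp).prime.squarefree
  rw [← Finset.sum_fiberwise_of_maps_to (t := (sqfreeCoprime W M).filter (fun a => a.Coprime r))
    (g := ρ), Finset.mul_sum]
  · refine Finset.sum_le_sum fun a ha => ?_
    rw [Finset.mem_filter, mem_sqfreeCoprime] at ha
    have ha0 : (0 : ℝ) < a := by exact_mod_cast ha.1.1.1
    have h1 : ∀ n ∈ ((Finset.Icc 1 M).filter (fun n => n.Coprime W)).filter (fun n => ρ n = a),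
        f n / n ≤ f a / a * (1 / ((n / a : ℕ) : ℝ)) := by
      intro n hn
      simp only [Finset.mem_filter, Finset.mem_Icc] at hn
      have hdvd : a ∣ n := hn.2 ▸ hρdvd n
      rw [Nat.cast_div hdvd ha0.ne', div_mul_div_comm, mul_one, mul_div_cancel₀ _ ha0.ne']
      have := hf a n ha.1.1.1 (Nat.le_of_dvd (by omega) hdvd)
      gcongr
    refine (Finset.sum_le_sum h1).trans ?_
    rw [← Finset.mul_sum]
    have h2 : ∑ n ∈ ((Finset.Icc 1 M).filter (fun n => n.Coprime W)).filter (fun n => ρ n = a),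
        1 / ((n / a : ℕ) : ℝ) ≤ ∏ p ∈ a.primeFactors ∪ r.primeFactors, (p : ℝ) / (p - 1) := by
      rw [← Finset.sum_image (f := fun m : ℕ => 1 / (m : ℝ)) (g := fun n => n / a)]
      · refine sum_inv_factored_le _ _ (fun p hp => ?_) (fun m hm => ?_)
        · rcases Finset.mem_union.1 hp with h | h <;> exact Nat.prime_of_mem_primeFactors h
        · obtain ⟨n, hn, rfl⟩ := Finset.mem_image.1 hm
          simp only [Finset.mem_filter, Finset.mem_Icc] at hn
          have hdvd : a ∣ n := hn.2 ▸ hρdvd n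
          refine ⟨(Nat.div_pos (Nat.le_of_dvd (by omega) hdvd) ha.1.1.1).ne', fun p hp => ?_⟩
          have hpn : p ∈ n.primeFactors :=
            Nat.primeFactors_mono (Nat.div_dvd_of_dvd hdvd) (by omega) hp
          rw [← hn.2, hρpf]
          simp only [Finset.mem_union, Finset.mem_sdiff]
          tauto
      · intro n hn n' hn' h
        simp only [Finset.coe_filter, Finset.mem_filter, Set.mem_ofPred_eq] at hn hn'
        have hdvd : a ∣ n := hn.2 ▸ hρdvd n
        have hdvd' : a ∣ n' := hn'.2 ▸ hρdvd n'
        exact (Nat.div_left_inj hdvd hdvd').1 h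
    refine (mul_le_mul_of_nonneg_left h2 (div_nonneg (hf0 a) ha0.le)).trans (le_of_eq ?_)
    rw [Finset.prod_union ha.2.disjoint_primeFactors]
    have h3 : (∏ p ∈ a.primeFactors, (p : ℝ) / (p - 1)) =
        a * primeProd (fun p => 1 / ((p : ℝ) - 1)) a := by
      have h4 : (a : ℝ) = ∏ p ∈ a.primeFactors, (p : ℝ) := by
        conv_lhs => rw [← Nat.prod_primeFactors_of_squarefree ha.1.2.1]
        push_cast
        rfl
      conv_rhs => rw [h4, primeProd, ← Finset.prod_mul_distrib]
      exact Finset.prod_congr rfl fun p _ => by ring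
    rw [h3, primeProd, primeProd]
    field_simp
  · intro n hn
    simp only [Finset.mem_filter, Finset.mem_Icc, mem_sqfreeCoprime] at hn ⊢
    refine ⟨⟨⟨hρpos n, (Nat.le_of_dvd (by omega) (hρdvd n)).trans hn.1.2⟩, hρsq n,
      hn.2.coprime_dvd_left (hρdvd n)⟩, ?_⟩
    rw [← Nat.disjoint_primeFactors (hρpos n).ne' hr, hρpf]
    exact Finset.sdiff_disjoint

lemma sum_divisors_sqfreeCoprime_le (W M : ℕ) (G : ℕ → ℕ → ℝ) (hG : ∀ m k, 0 ≤ G m k ∨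
    ¬ (m ∈ sqfreeCoprime W M ∧ k ∈ sqfreeCoprime W M)) :
    ∑ s ∈ sqfreeCoprime W M, ∑ m ∈ s.divisors, G m (s / m) ≤
      ∑ m ∈ sqfreeCoprime W M, ∑ k ∈ sqfreeCoprime W M, G m k := by
  have h1 : ∀ s ∈ sqfreeCoprime W M, ∑ m ∈ s.divisors, G m (s / m) =
      ∑ m ∈ sqfreeCoprime W M, ∑ k ∈ sqfreeCoprime W M, if m * k = s then G m k else 0 := by
    intro s hs
    have hs0 := (mem_sqfreeCoprime.1 hs).1.1
    have h2 : s.divisors = (sqfreeCoprime W M).filter (fun m => m ∣ s) := by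
      ext m
      simp only [Nat.mem_divisors, Finset.mem_filter]
      exact ⟨fun h => ⟨mem_sqfreeCoprime_of_dvd hs h.1, h.1⟩, fun h => ⟨h.2, by omega⟩⟩
    rw [h2, Finset.sum_filter]
    refine Finset.sum_congr rfl fun m hm => ?_
    have hm0 := (mem_sqfreeCoprime.1 hm).1.1
    split_ifs with h
    · obtain ⟨k, rfl⟩ := h
      rw [Nat.mul_div_cancel_left _ hm0, Finset.sum_eq_single k]
      · simp
      · intro k' _ hk'
        rw [if_neg]
        exact fun h => hk' (Nat.eq_of_mul_eq_mul_left hm0 h)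
      · intro h
        exact absurd (mem_sqfreeCoprime_of_dvd hs (dvd_mul_left _ _)) h
    · symm
      refine Finset.sum_eq_zero fun k _ => if_neg ?_
      rintro rfl
      exact h (dvd_mul_right _ _)
  rw [Finset.sum_congr rfl h1, Finset.sum_comm]
  refine Finset.sum_le_sum fun m hm => ?_
  rw [Finset.sum_comm]
  refine Finset.sum_le_sum fun k hk => ?_
  have hG' : 0 ≤ G m k := (hG m k).resolve_right (not_not.2 ⟨hm, hk⟩)
  rw [Finset.sum_ite_eq]
  split_ifs
  · exact le_rfl
  · exact hG'

lemma primeProd_two_eq (d : ℕ) (hd : Squarefree d) :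
    primeProd (fun _ => 2) d = (d.divisors.card : ℝ) := by
  have := sum_divisors_primeProd (fun _ => 1) hd
  simp only [primeProd, Finset.prod_const_one, Finset.sum_const, nsmul_eq_mul, mul_one] at this
  rw [this, primeProd]
  norm_num

lemma primeProd_id (d : ℕ) (hd : Squarefree d) : primeProd (fun p => (p : ℝ)) d = d := by
  conv_rhs => rw [← Nat.prod_primeFactors_of_squarefree hd]
  push_cast
  rfl

lemma primeProd_two_div (d : ℕ) (hd : Squarefree d) :
    primeProd (fun p => 2 / (p : ℝ)) d = (d.divisors.card : ℝ) / d := by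
  rw [← primeProd_two_eq d hd, ← primeProd_id d hd]
  simp [primeProd, Finset.prod_div_distrib]

lemma sum_primeProd_le_prod (W M : ℕ) (a : ℕ → ℝ)
    (ha : ∀ p : ℕ, p.Prime → ¬ p ∣ W → 0 ≤ a p) :
    ∑ m ∈ sqfreeCoprime W M, primeProd a m ≤
      ∏ p ∈ Finset.Icc 1 M with p.Prime ∧ ¬ p ∣ W, (1 + a p) := by
  rw [Finset.prod_one_add]
  unfold primeProd
  rw [← Finset.sum_image (f := fun t : Finset ℕ => ∏ p ∈ t, a p) (g := Nat.primeFactors)]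
  · refine Finset.sum_le_sum_of_subset_of_nonneg ?_ ?_
    · intro t ht
      obtain ⟨m, hm, rfl⟩ := Finset.mem_image.1 ht
      rw [Finset.mem_powerset]
      intro p hp
      obtain ⟨h1, h2⟩ := not_dvd_of_mem_primeFactors hm hp
      have h3 := (mem_sqfreeCoprime.1 hm).1
      simp only [Finset.mem_filter, Finset.mem_Icc]
      exact ⟨⟨h1.one_lt.le, (Nat.le_of_dvd h3.1 (Nat.dvd_of_mem_primeFactors hp)).trans h3.2⟩,
        h1, h2⟩
    · intro t ht _
      refine Finset.prod_nonneg fun p hp => ?_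
      have := Finset.mem_filter.1 (Finset.mem_powerset.1 ht hp)
      exact ha p this.2.1 this.2.2
  · intro m hm n hn h
    rw [← Nat.prod_primeFactors_of_squarefree (mem_sqfreeCoprime.1 hm).2.1,
      ← Nat.prod_primeFactors_of_squarefree (mem_sqfreeCoprime.1 hn).2.1]
    rw [show m.primeFactors = n.primeFactors from h]

lemma sum_inv_mul_le (D M : ℕ) (hD : 2 ≤ D) :
    ∑ n ∈ Finset.Ioc D M, 2 / ((n : ℝ) - 2) * (2 / n) ≤ 4 / ((D : ℝ) - 1) := by
  rcases le_or_gt D M with hM | hM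
  · have h : ∑ n ∈ Finset.Ioc D M, 2 / ((n : ℝ) - 2) * (2 / n) ≤
        4 / ((D : ℝ) - 1) - 4 / ((M : ℝ) - 1) := by
      induction M, hM using Nat.le_induction with
      | base => simp
      | succ k hk ih =>
        rw [Finset.sum_Ioc_succ_top (by omega)]
        have hk' : (2 : ℝ) ≤ k := by exact_mod_cast (by omega : 2 ≤ k)
        have : 2 / (((k + 1 : ℕ) : ℝ) - 2) * (2 / ((k + 1 : ℕ) : ℝ)) ≤
            4 / ((k : ℝ) - 1) - 4 / (((k + 1 : ℕ) : ℝ) - 1) := by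
          push_cast
          rw [div_sub_div _ _ (by linarith) (by linarith), div_mul_div_comm]
          rw [div_le_div_iff₀ (by nlinarith) (by nlinarith)]
          nlinarith
        linarith
    have hM' : (2 : ℝ) ≤ M := by exact_mod_cast (by omega : 2 ≤ M)
    have : 0 ≤ 4 / ((M : ℝ) - 1) := div_nonneg (by norm_num) (by linarith)
    linarith
  · rw [Finset.Ioc_eq_empty (by omega), Finset.sum_empty]
    have : (2 : ℝ) ≤ D := by exact_mod_cast hD
    exact div_nonneg (by norm_num) (by linarith)

lemma sum_primeProd_two_div_sub_two_le (W M D : ℕ) (hD : 2 ≤ D)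
    (hW : ∀ p : ℕ, p.Prime → p ≤ D → p ∣ W) (f : ℕ → ℝ) (hf0 : ∀ n, 0 ≤ f n)
    (hf : ∀ m n, 1 ≤ m → m ≤ n → f n ≤ f m) :
    ∑ s ∈ sqfreeCoprime W M, primeProd (fun p => 2 / ((p : ℝ) - 2)) s * f s ≤
      Real.exp (4 / ((D : ℝ) - 1)) * ∑ u ∈ Finset.Icc 1 M with u.Coprime W,
        ∑ v ∈ Finset.Icc 1 M with v.Coprime W, f (u * v) / (u * v) := by
  have h2W : 2 ∣ W := hW 2 Nat.prime_two hD
  set e : ℕ → ℝ := fun p => 2 / ((p : ℝ) - 2) * (2 / p) with he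
  have he0 : ∀ m ∈ sqfreeCoprime W M, 0 ≤ primeProd e m := fun m hm =>
    primeProd_nonneg fun p hp => by
      have := two_lt_of_mem_primeFactors h2W hm hp
      have h6 : 0 < (p : ℝ) - 2 := by linarith
      positivity
  have hk0 : ∀ m, 0 ≤ primeProd (fun p => 2 / (p : ℝ)) m := fun m =>
    primeProd_nonneg fun p _ => by positivity
  have h1 : ∀ s ∈ sqfreeCoprime W M, primeProd (fun p => 2 / ((p : ℝ) - 2)) s * f s ≤
      ∑ m ∈ s.divisors, primeProd e m * (primeProd (fun p => 2 / (p : ℝ)) (s / m) * f (s / m)) := by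
    intro s hs
    have hs' := mem_sqfreeCoprime.1 hs
    have h2 : primeProd (fun p => 2 / ((p : ℝ) - 2)) s =
        ∑ m ∈ s.divisors, primeProd e m * primeProd (fun p => 2 / (p : ℝ)) (s / m) := by
      have h3 : ∀ m ∈ s.divisors, primeProd e m * primeProd (fun p => 2 / (p : ℝ)) (s / m) =
          primeProd (fun p => 2 / (p : ℝ)) s * primeProd (fun p => 2 / ((p : ℝ) - 2)) m := by
        intro m hm
        obtain ⟨k, rfl⟩ := Nat.dvd_of_mem_divisors hm
        have hm0 : 0 < m := Nat.pos_of_mem_divisors hm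
        have hcop := (Nat.squarefree_mul_iff.1 hs'.2.1).1
        rw [Nat.mul_div_cancel_left _ hm0, primeProd_mul_of_coprime _ hcop, he, ← primeProd_mul]
        ring
      rw [Finset.sum_congr rfl h3, ← Finset.mul_sum, sum_divisors_primeProd _ hs'.2.1,
        primeProd_mul]
      refine primeProd_congr fun p hp => ?_
      have := two_lt_of_mem_primeFactors h2W hs hp
      have h6 : (p : ℝ) - 2 ≠ 0 := by linarith
      have h7 : (p : ℝ) ≠ 0 := by linarith
      field_simp
      ring
    rw [h2, Finset.sum_mul]
    refine Finset.sum_le_sum fun m hm => ?_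
    have hm0 : 0 < m := Nat.pos_of_mem_divisors hm
    have hdvd := Nat.dvd_of_mem_divisors hm
    rw [mul_assoc]
    refine mul_le_mul_of_nonneg_left (mul_le_mul_of_nonneg_left ?_ (hk0 _))
      (he0 m (mem_sqfreeCoprime_of_dvd hs hdvd))
    exact hf _ _ (Nat.div_pos (Nat.le_of_dvd (by omega) hdvd) hm0) (Nat.div_le_self _ _)
  refine (Finset.sum_le_sum h1).trans ?_
  refine (sum_divisors_sqfreeCoprime_le W M
    (fun m k => primeProd e m * (primeProd (fun p => 2 / (p : ℝ)) k * f k)) ?_).trans ?_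
  · intro m k
    by_cases hm : m ∈ sqfreeCoprime W M
    · exact Or.inl (mul_nonneg (he0 m hm) (mul_nonneg (hk0 k) (hf0 k)))
    · exact Or.inr fun h => hm h.1
  rw [← Finset.sum_mul_sum]
  have h4 : ∑ m ∈ sqfreeCoprime W M, primeProd e m ≤ Real.exp (4 / ((D : ℝ) - 1)) := by
    have hpos : ∀ p : ℕ, p.Prime → ¬ p ∣ W → 0 ≤ e p := fun p hp hpW => by
      have : D < p := by
        by_contra! h
        exact hpW (hW p hp h)
      have : (2 : ℝ) < p := by exact_mod_cast (by omega : 2 < p)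
      have h6 : 0 < (p : ℝ) - 2 := by linarith
      simp only [he]
      positivity
    refine (sum_primeProd_le_prod W M e hpos).trans ?_
    have hexp : ∀ s : Finset ℕ, (∀ p ∈ s, 0 ≤ e p) →
        ∏ p ∈ s, (1 + e p) ≤ Real.exp (∑ p ∈ s, e p) := fun s hs => by
      rw [Real.exp_sum]
      refine Finset.prod_le_prod (fun p hp => by linarith [hs p hp]) fun p _ => ?_
      linarith [Real.add_one_le_exp (e p)]
    refine (hexp _ fun p hp => ?_).trans (Real.exp_le_exp.2 ?_)
    · have := Finset.mem_filter.1 hp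
      exact hpos p this.2.1 this.2.2
    refine le_trans (Finset.sum_le_sum_of_subset_of_nonneg ?_ ?_) (sum_inv_mul_le D M hD)
    · intro p hp
      simp only [Finset.mem_filter, Finset.mem_Icc, Finset.mem_Ioc] at hp ⊢
      refine ⟨?_, hp.1.2⟩
      by_contra! h
      exact hp.2.2 (hW p hp.2.1 h)
    · intro n hn _
      have := (Finset.mem_Ioc.1 hn).1
      have : (2 : ℝ) < n := by exact_mod_cast (by omega : 2 < n)
      have h6 : 0 < (n : ℝ) - 2 := by linarith
      positivity
  refine mul_le_mul h4 ?_ (Finset.sum_nonneg fun k _ => mul_nonneg (hk0 k) (hf0 k))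
    (Real.exp_pos _).le
  have h5 : ∀ k ∈ sqfreeCoprime W M, primeProd (fun p => 2 / (p : ℝ)) k * f k =
      ∑ m ∈ k.divisors, f (m * (k / m)) / (m * ((k / m : ℕ) : ℝ)) := by
    intro k hk
    rw [primeProd_two_div k (mem_sqfreeCoprime.1 hk).2.1]
    have : ∀ m ∈ k.divisors, f (m * (k / m)) / (m * ((k / m : ℕ) : ℝ)) = f k / k := by
      intro m hm
      rw [← Nat.cast_mul, Nat.mul_div_cancel' (Nat.dvd_of_mem_divisors hm)]
    rw [Finset.sum_congr rfl this, Finset.sum_const, nsmul_eq_mul]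
    ring
  rw [Finset.sum_congr rfl h5]
  refine (sum_divisors_sqfreeCoprime_le W M (fun m k => f (m * k) / (m * (k : ℝ))) ?_).trans ?_
  · exact fun m k => Or.inl (div_nonneg (hf0 _) (by positivity))
  have hsub : sqfreeCoprime W M ⊆ (Finset.Icc 1 M).filter (fun u => u.Coprime W) := by
    intro m hm
    have := mem_sqfreeCoprime.1 hm
    simp only [Finset.mem_filter, Finset.mem_Icc]
    exact ⟨this.1, this.2.2⟩
  have hnn : ∀ m k : ℕ, 0 ≤ f (m * k) / (m * (k : ℝ)) := fun m k =>
    div_nonneg (hf0 _) (by positivity)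
  refine (Finset.sum_le_sum fun m _ => Finset.sum_le_sum_of_subset_of_nonneg hsub
    fun k _ _ => hnn m k).trans ?_
  exact Finset.sum_le_sum_of_subset_of_nonneg hsub fun m _ _ => Finset.sum_nonneg fun k _ => hnn m k

lemma abs_sieveWeight_le (W M : ℕ) (h2W : 2 ∣ W) (y : ℕ → ℝ) (hy0 : ∀ n, 0 ≤ y n)
    (hy : ∀ m n, 1 ≤ m → m ≤ n → y n ≤ y m) (d : ℕ) (hd : d ∈ sqfreeCoprime W M) :
    |sieveWeight W M y d| ≤ (d.divisors.card : ℝ) ^ 2 * sieveWeight W M y 1 := by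
  have hd' := mem_sqfreeCoprime.1 hd
  set g : ℕ → ℝ := fun p => 2 / ((p : ℝ) - 2) with hg
  have hg0 : ∀ s ∈ sqfreeCoprime W M, 0 ≤ primeProd g s := fun s hs =>
    primeProd_nonneg fun p hp => by
      have := two_lt_of_mem_primeFactors h2W hs hp
      have h6 : 0 < (p : ℝ) - 2 := by linarith
      positivity
  have h1 : sieveWeight W M y 1 = ∑ s ∈ sqfreeCoprime W M, primeProd g s * y s := by
    simp [sieveWeight, primeProd_one, hg]
  have h2 : ∑ s ∈ sqfreeCoprime W M with d ∣ s, primeProd g s * y s ≤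
      primeProd g d * sieveWeight W M y 1 := by
    have h4 : ∀ s ∈ (sqfreeCoprime W M).filter (fun s => d ∣ s),
        primeProd g s * y s ≤ primeProd g d * (primeProd g (s / d) * y (s / d)) := by
      intro s hs
      obtain ⟨hs, t, rfl⟩ := Finset.mem_filter.1 hs
      have hs' := mem_sqfreeCoprime.1 hs
      have ht : t ∈ sqfreeCoprime W M := mem_sqfreeCoprime_of_dvd hs (dvd_mul_left _ _)
      rw [Nat.mul_div_cancel_left _ hd'.1.1, ← mul_assoc,
        primeProd_mul_of_coprime _ (Nat.squarefree_mul_iff.1 hs'.2.1).1]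
      refine mul_le_mul_of_nonneg_left (hy _ _ (mem_sqfreeCoprime.1 ht).1.1 ?_)
        (mul_nonneg (hg0 d hd) (hg0 t ht))
      exact Nat.le_mul_of_pos_left _ hd'.1.1
    refine (Finset.sum_le_sum h4).trans ?_
    rw [← Finset.mul_sum, h1]
    refine mul_le_mul_of_nonneg_left ?_ (hg0 d hd)
    rw [← Finset.sum_image (f := fun t => primeProd g t * y t) (g := fun s => s / d)]
    · refine Finset.sum_le_sum_of_subset_of_nonneg (fun t ht => ?_)
        fun t ht _ => mul_nonneg (hg0 t ht) (hy0 t)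
      obtain ⟨s, hs, rfl⟩ := Finset.mem_image.1 ht
      obtain ⟨hs, hds⟩ := Finset.mem_filter.1 hs
      exact mem_sqfreeCoprime_of_dvd hs (Nat.div_dvd_of_dvd hds)
    · intro s hs s' hs' h
      exact (Nat.div_left_inj (Finset.mem_filter.1 hs).2 (Finset.mem_filter.1 hs').2).1 h
  have h3 : |primeProd (fun p => -((p : ℝ) / 2)) d| = primeProd (fun p => (p : ℝ) / 2) d := by
    rw [abs_primeProd]
    exact primeProd_congr fun p _ => by rw [abs_neg, abs_of_nonneg (by positivity)]
  rw [sieveWeight, abs_mul, h3, abs_of_nonneg (Finset.sum_nonneg fun s hs =>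
    mul_nonneg (hg0 s (Finset.mem_filter.1 hs).1) (hy0 s))]
  refine (mul_le_mul_of_nonneg_left h2 (primeProd_nonneg fun p _ => by positivity)).trans ?_
  rw [← mul_assoc, primeProd_mul]
  refine mul_le_mul_of_nonneg_right ?_ (by
    rw [h1]; exact Finset.sum_nonneg fun s hs => mul_nonneg (hg0 s hs) (hy0 s))
  rw [← primeProd_two_eq d hd'.2.1, sq, primeProd_mul]
  refine primeProd_mono (fun p hp => ?_) (fun p hp => ?_)
  all_goals
    have h5 := two_lt_of_mem_primeFactors h2W hd hp
    have h6 : 0 < (p : ℝ) - 2 := by linarith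
    have h7 : (3 : ℝ) ≤ p := by
      have : 2 < p := by exact_mod_cast h5
      exact_mod_cast (by omega : 3 ≤ p)
  · simp only [hg]; positivity
  · simp only [hg]
    rw [div_mul_div_comm, div_le_iff₀ (by positivity)]
    linarith

/-- `T` is a tail integral `∫_s^1 f` of the antitone function `f ≥ 0`, in discrete form. -/
structure IsTail (f T : ℝ → ℝ) : Prop where
  antitone : Antitone f
  nonneg : ∀ s, 0 ≤ f s
  le : ∀ s s', s ≤ s' → f s' * (s' - s) ≤ T s - T s'
  ge : ∀ s s', s ≤ s' → T s - T s' ≤ f s * (s' - s)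
  zero : ∀ s, 1 ≤ s → T s = 0

lemma IsTail.tail_nonneg {f T : ℝ → ℝ} (h : IsTail f T) (s : ℝ) : 0 ≤ T s := by
  rcases le_total s 1 with hs | hs
  · have h1 := h.le s 1 hs
    rw [h.zero 1 le_rfl] at h1
    have := mul_nonneg (h.nonneg 1) (sub_nonneg.2 hs)
    linarith
  · exact (h.zero s hs).ge

/-- Truncation of a function at `1`. -/
noncomputable def clip (f : ℝ → ℝ) (s : ℝ) : ℝ := if s ≤ 1 then f s else 0

lemma IsTail.of_hasDerivAt {f T : ℝ → ℝ} (hd : ∀ s, HasDerivAt T (-f s) s) (h1 : T 1 = 0)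
    (hf : ∀ s s', s ≤ s' → s' ≤ 1 → f s' ≤ f s) (hf0 : 0 ≤ f 1) :
    IsTail (clip f) (clip T) := by
  have hnn : ∀ s, s ≤ 1 → 0 ≤ f s := fun s hs => hf0.trans (hf s 1 hs le_rfl)
  have mvt : ∀ s s', s ≤ s' → s' ≤ 1 → f s' * (s' - s) ≤ T s - T s' ∧
      T s - T s' ≤ f s * (s' - s) := by
    intro s s' hs hs'
    rcases hs.eq_or_lt with rfl | hlt
    · simp
    obtain ⟨ξ, hξ, h⟩ := exists_hasDerivAt_eq_slope T (fun s => -f s) hlt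
      (fun x _ => (hd x).continuousAt.continuousWithinAt) (fun x _ => hd x)
    have hpos : 0 < s' - s := sub_pos.2 hlt
    rw [eq_div_iff hpos.ne'] at h
    have h2 := hf s ξ hξ.1.le (hξ.2.le.trans hs')
    have h3 := hf ξ s' hξ.2.le hs'
    constructor <;> nlinarith
  refine ⟨fun s s' hs => ?_, fun s => ?_, fun s s' hs => ?_, fun s s' hs => ?_, fun s hs => ?_⟩
  · by_cases h : s' ≤ 1
    · simp only [clip, h, hs.trans h, if_true]
      exact hf s s' hs h
    · simp only [clip, h, if_false]
      split_ifs with h2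
      exacts [hnn s h2, le_rfl]
  · unfold clip
    split_ifs with h2
    exacts [hnn s h2, le_rfl]
  · by_cases h : s' ≤ 1
    · simp only [clip, h, hs.trans h, if_true]
      exact (mvt s s' hs h).1
    · simp only [clip, h, if_false]
      split_ifs with h2
      · have := (mvt s 1 h2 le_rfl).1
        have := mul_nonneg hf0 (sub_nonneg.2 h2)
        linarith
      · simp
  · by_cases h : s' ≤ 1
    · simp only [clip, h, hs.trans h, if_true]
      exact (mvt s s' hs h).2
    · simp only [clip, h, if_false]
      split_ifs with h2
      · have h3 := (mvt s 1 h2 le_rfl).2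
        have := mul_le_mul_of_nonneg_left (sub_le_sub_right (not_le.1 h).le s) (hnn s h2)
        linarith
      · simp
  · rcases hs.eq_or_lt with rfl | h
    · simp [clip, h1]
    · simp [clip, h]

lemma abs_card_coprime_sub_le (W m : ℕ) (hW : 0 < W) :
    |∑ n ∈ Finset.Icc 1 m, ((if n.Coprime W then (1 : ℝ) else 0) - W.totient / W)| ≤ W := by
  have hW' : (0 : ℝ) < W := by exact_mod_cast hW
  have hp : Function.Periodic (fun n : ℕ => n.Coprime W) W := fun n => by simp
  have hblock : ∀ a : ℕ, ∑ n ∈ Finset.Ico a (a + W),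
      ((if n.Coprime W then (1 : ℝ) else 0) - W.totient / W) = 0 := by
    intro a
    rw [Finset.sum_sub_distrib, Finset.sum_boole, Nat.filter_Ico_card_eq_of_periodic a W _ hp,
      Nat.count_eq_card_filter_range]
    simp only [Finset.sum_const, Nat.card_Ico, nsmul_eq_mul, Nat.totient, add_tsub_cancel_left]
    rw [mul_div_cancel₀ _ hW'.ne', sub_eq_zero]
    congr 3
    ext n
    simp only [Nat.coprime_comm]
  have hmain : ∀ m r : ℕ, r < W → |∑ n ∈ Finset.Ico 1 (1 + (m * W + r)),
      ((if n.Coprime W then (1 : ℝ) else 0) - W.totient / W)| ≤ W := by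
    intro m r hr
    induction m with
    | zero =>
      refine (Finset.abs_sum_le_sum_abs _ _).trans ?_
      have : ∀ n ∈ Finset.Ico 1 (1 + (0 * W + r)),
          |(if n.Coprime W then (1 : ℝ) else 0) - W.totient / W| ≤ 1 := by
        intro n _
        have h1 : (0 : ℝ) ≤ W.totient / W := by positivity
        have h2 : (W.totient : ℝ) / W ≤ 1 := by
          rw [div_le_one hW']
          exact_mod_cast Nat.totient_le W
        rw [abs_le]
        split_ifs <;> constructor <;> linarith
      refine (Finset.sum_le_sum this).trans ?_
      simp only [Finset.sum_const, Nat.card_Ico, nsmul_eq_mul, mul_one]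
      exact_mod_cast (by omega)
    | succ m ih =>
      have : 1 + ((m + 1) * W + r) = 1 + (m * W + r) + W := by ring
      rw [this, ← Finset.sum_Ico_consecutive _ (by omega : 1 ≤ 1 + (m * W + r)) (by omega), hblock,
        add_zero]
      exact ih
  have := hmain (m / W) (m % W) (Nat.mod_lt _ hW)
  rwa [mul_comm, Nat.div_add_mod, add_comm 1 m] at this

lemma abs_sum_mul_le_of_antitone (b F : ℕ → ℝ) (B : ℝ)
    (hb : ∀ m, |∑ n ∈ Finset.Icc 1 m, b n| ≤ B) (hF0 : ∀ n, 0 ≤ F n)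
    (hF : ∀ n, 1 ≤ n → F (n + 1) ≤ F n) (M : ℕ) (hM : 1 ≤ M) :
    |∑ n ∈ Finset.Icc 1 M, b n * F n| ≤ B * F 1 := by
  have hB : 0 ≤ B := (abs_nonneg _).trans (hb 0)
  have h : |∑ n ∈ Finset.Icc 1 M, b n * F n - (∑ n ∈ Finset.Icc 1 M, b n) * F M| ≤
      B * (F 1 - F M) := by
    induction M, hM using Nat.le_induction with
    | base => simp
    | succ k hk ih =>
      rw [Finset.sum_Icc_succ_top (by omega), Finset.sum_Icc_succ_top (by omega)]
      have h1 : ∑ n ∈ Finset.Icc 1 k, b n * F n + b (k + 1) * F (k + 1) -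
          (∑ n ∈ Finset.Icc 1 k, b n + b (k + 1)) * F (k + 1) =
          (∑ n ∈ Finset.Icc 1 k, b n * F n - (∑ n ∈ Finset.Icc 1 k, b n) * F k) +
          (∑ n ∈ Finset.Icc 1 k, b n) * (F k - F (k + 1)) := by ring
      rw [h1]
      refine (abs_add_le _ _).trans ?_
      rw [abs_mul (∑ n ∈ Finset.Icc 1 k, b n), abs_of_nonneg (sub_nonneg.2 (hF k hk))]
      have := mul_le_mul_of_nonneg_right (hb k) (sub_nonneg.2 (hF k hk))
      linarith
  have h2 := abs_sub_abs_le_abs_sub (∑ n ∈ Finset.Icc 1 M, b n * F n)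
    ((∑ n ∈ Finset.Icc 1 M, b n) * F M)
  rw [abs_mul, abs_of_nonneg (hF0 M)] at h2
  have := mul_le_mul_of_nonneg_right (hb M) (hF0 M)
  linarith

lemma IsTail.sum_div_bounds {f T : ℝ → ℝ} (h : IsTail f T) {L σ : ℝ} (hL : 0 < L) (M : ℕ)
    (hM : 1 ≤ M) (hσ : 1 ≤ σ + Real.log (M + 1) / L) :
    L * T σ ≤ ∑ n ∈ Finset.Icc 1 M, f (σ + Real.log n / L) / n ∧
      ∑ n ∈ Finset.Icc 1 M, f (σ + Real.log n / L) / n ≤ L * T σ + f σ := by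
  set s : ℕ → ℝ := fun n => σ + Real.log n / L with hs
  have hs1 : s 1 = σ := by simp [hs]
  have hstep : ∀ n : ℕ, 1 ≤ n → L * (s (n + 1) - s n) = Real.log (((n + 1 : ℕ) : ℝ) / n) := by
    intro n hn
    have hn' : (n : ℝ) ≠ 0 := by positivity
    rw [Real.log_div (by positivity) hn']
    simp only [hs]
    field_simp
    ring
  have hmono : ∀ n : ℕ, 1 ≤ n → s n ≤ s (n + 1) := by
    intro n hn
    have hn' : (0 : ℝ) < n := by exact_mod_cast hn
    have : 0 ≤ L * (s (n + 1) - s n) := by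
      rw [hstep n hn]
      refine Real.log_nonneg ?_
      rw [le_div_iff₀ hn']
      push_cast
      linarith
    have := nonneg_of_mul_nonneg_right this hL
    linarith
  have hup : ∀ n : ℕ, 1 ≤ n → Real.log (((n + 1 : ℕ) : ℝ) / n) ≤ 1 / n := by
    intro n hn
    have hn' : (0 : ℝ) < n := by exact_mod_cast hn
    refine (Real.log_le_sub_one_of_pos (by positivity)).trans (le_of_eq ?_)
    push_cast
    field_simp
    ring
  have hlow : ∀ n : ℕ, 1 ≤ n → 1 / ((n + 1 : ℕ) : ℝ) ≤ Real.log (((n + 1 : ℕ) : ℝ) / n) := by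
    intro n hn
    have hn' : (0 : ℝ) < n := by exact_mod_cast hn
    refine le_trans (le_of_eq ?_) (Real.one_sub_inv_le_log_of_pos (by positivity))
    rw [inv_div]
    push_cast
    field_simp
    ring
  constructor
  · have : ∀ m : ℕ, 1 ≤ m → L * (T σ - T (s (m + 1))) ≤
        ∑ n ∈ Finset.Icc 1 m, f (s n) / n := by
      intro m hm
      induction m, hm using Nat.le_induction with
      | base =>
        have h1 := h.ge _ _ (hmono 1 le_rfl)
        have h2 := hup 1 le_rfl
        rw [← hstep 1 le_rfl] at h2
        rw [hs1] at h1 h2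
        have := mul_le_mul_of_nonneg_left h1 hL.le
        have := mul_le_mul_of_nonneg_left h2 (h.nonneg σ)
        simp only [Finset.Icc_self, Finset.sum_singleton, hs1]
        push_cast at *
        linarith
      | succ k hk ih =>
        rw [Finset.sum_Icc_succ_top (by omega)]
        have h1 := h.ge _ _ (hmono (k + 1) (by omega))
        have h2 := hup (k + 1) (by omega)
        rw [← hstep (k + 1) (by omega)] at h2
        have := mul_le_mul_of_nonneg_left h1 hL.le
        have := mul_le_mul_of_nonneg_left h2 (h.nonneg (s (k + 1)))
        rw [div_eq_mul_one_div]
        linarith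
    have h3 := this M hM
    rw [h.zero (s (M + 1)) (by simpa [hs] using hσ), sub_zero] at h3
    exact h3
  · have : ∀ m : ℕ, 1 ≤ m → ∑ n ∈ Finset.Icc 1 m, f (s n) / n ≤
        L * (T σ - T (s m)) + f σ := by
      intro m hm
      induction m, hm using Nat.le_induction with
      | base => simp [hs1]
      | succ k hk ih =>
        rw [Finset.sum_Icc_succ_top (by omega)]
        have h1 := h.le _ _ (hmono k hk)
        have h2 := hlow k hk
        rw [← hstep k hk] at h2
        have := mul_le_mul_of_nonneg_left h1 hL.le
        have := mul_le_mul_of_nonneg_left h2 (h.nonneg (s (k + 1)))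
        rw [div_eq_mul_one_div (f (s (k + 1)))]
        linarith
    have h3 := this M hM
    have := mul_nonneg hL.le (h.tail_nonneg (s M))
    change ∑ n ∈ Finset.Icc 1 M, f (s n) / n ≤ _
    linarith

lemma IsTail.abs_sum_coprime_sub_le {f T : ℝ → ℝ} (h : IsTail f T) {L σ : ℝ} (hL : 0 < L)
    (W M : ℕ) (hW : 0 < W) (hM : 1 ≤ M) (hσ : 1 ≤ σ + Real.log (M + 1) / L) :
    |∑ n ∈ Finset.Icc 1 M with n.Coprime W, f (σ + Real.log n / L) / n -
      (W.totient / W : ℝ) * L * T σ| ≤ (W + 1) * f σ := by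
  have hW' : (0 : ℝ) < W := by exact_mod_cast hW
  have h1 : (0 : ℝ) ≤ W.totient / W := by positivity
  have h2 : (W.totient : ℝ) / W ≤ 1 := by
    rw [div_le_one hW']
    exact_mod_cast Nat.totient_le W
  have h3 := abs_sum_mul_le_of_antitone _ (fun n : ℕ => f (σ + Real.log n / L) / n) W
    (fun m => abs_card_coprime_sub_le W m hW) (fun n => div_nonneg (h.nonneg _) (by positivity))
    (fun n hn => by
      have hn' : (0 : ℝ) < n := by exact_mod_cast hn
      have : (n : ℝ) ≤ ((n + 1 : ℕ) : ℝ) := by push_cast; linarith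
      refine div_le_div₀ (h.nonneg _) (h.antitone ?_) hn' this
      gcongr) M hM
  obtain ⟨h4, h5⟩ := h.sum_div_bounds hL M hM hσ
  simp only [sub_mul, Finset.sum_sub_distrib, ← Finset.mul_sum, ite_mul, one_mul, zero_mul,
    ← Finset.sum_filter, Nat.cast_one, Real.log_one, zero_div, add_zero, div_one] at h3
  rw [abs_le] at h3 ⊢
  have h6 := mul_le_mul_of_nonneg_left h4 h1
  have h7 := mul_le_mul_of_nonneg_left h5 h1
  have h8 := mul_le_mul_of_nonneg_right h2 (h.nonneg σ)
  have h9 := h.nonneg σ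
  constructor <;> nlinarith

noncomputable def tailLin : ℝ → ℝ := fun s => ((3 / 2 - s) ^ 2 - 1 / 4) / 2
noncomputable def tailSq : ℝ → ℝ := fun s => ((3 / 2 - s) ^ 3 - 1 / 8) / 3

lemma isTail_lin : IsTail (clip fun s => 3 / 2 - s) (clip tailLin) := by
  refine IsTail.of_hasDerivAt (fun s => ?_) (by norm_num [tailLin]) (fun s s' h _ => by linarith)
    (by norm_num)
  have := ((((hasDerivAt_id' s).const_sub (3 / 2)).pow 2).sub_const (1 / 4)).div_const 2
  refine this.congr_deriv ?_
  norm_num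
  ring

lemma isTail_sq : IsTail (clip fun s => (3 / 2 - s) ^ 2) (clip tailSq) := by
  refine IsTail.of_hasDerivAt (fun s => ?_) (by norm_num [tailSq])
    (fun s s' h h' => by gcongr; linarith) (by norm_num)
  have := ((((hasDerivAt_id' s).const_sub (3 / 2)).pow 3).sub_const (1 / 8)).div_const 3
  refine this.congr_deriv ?_
  norm_num
  ring

lemma isTail_tailSq : IsTail (clip tailSq)
    (clip fun s => ((3 / 2 - s) ^ 4 - 1 / 16) / 12 - (1 - s) / 24) := by
  refine IsTail.of_hasDerivAt (fun s => ?_) (by norm_num)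
    (fun s s' h h' => by unfold tailSq; gcongr; linarith) (by norm_num [tailSq])
  have := (((((hasDerivAt_id' s).const_sub (3 / 2)).pow 4).sub_const (1 / 16)).div_const 12).sub
    (((hasDerivAt_id' s).const_sub 1).div_const 24)
  refine this.congr_deriv ?_
  norm_num [tailSq]
  ring

lemma isTail_tailLin : IsTail (clip tailLin)
    (clip fun s => ((3 / 2 - s) ^ 3 - 1 / 8) / 6 - (1 - s) / 8) := by
  refine IsTail.of_hasDerivAt (fun s => ?_) (by norm_num)
    (fun s s' h h' => by unfold tailLin; gcongr; linarith) (by norm_num [tailLin])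
  have := (((((hasDerivAt_id' s).const_sub (3 / 2)).pow 3).sub_const (1 / 8)).div_const 6).sub
    (((hasDerivAt_id' s).const_sub 1).div_const 8)
  refine this.congr_deriv ?_
  norm_num [tailLin]
  ring

lemma isTail_tailLin_sq : IsTail (clip fun s => tailLin s ^ 2)
    (clip fun s => ((3 / 2 - s) ^ 5 / 5 - (3 / 2 - s) ^ 3 / 6 + (3 / 2 - s) / 16 - 1 / 60) / 4) := by
  refine IsTail.of_hasDerivAt (fun s => ?_) (by norm_num)
    (fun s s' h h' => ?_) (by norm_num [tailLin])
  · have hu := (hasDerivAt_id' s).const_sub (3 / 2)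
    have := (((((hu.pow 5).div_const 5).sub ((hu.pow 3).div_const 6)).add
      (hu.div_const 16)).sub_const (1 / 60)).div_const 4
    refine this.congr_deriv ?_
    norm_num [tailLin]
    ring
  · have h1 : 0 ≤ tailLin s' := by unfold tailLin; nlinarith
    have h2 : tailLin s' ≤ tailLin s := by unfold tailLin; gcongr; linarith
    gcongr

/-- The sequence `y` from which the sieve weights are built. -/
noncomputable def ySeq (L : ℝ) (n : ℕ) : ℝ := clip (fun s => 3 / 2 - s) (Real.log n / L)

lemma clip_sq (f : ℝ → ℝ) (s : ℝ) : clip f s ^ 2 = clip (fun s => f s ^ 2) s := by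
  unfold clip
  split_ifs <;> simp

lemma ySeq_nonneg (L : ℝ) (n : ℕ) : 0 ≤ ySeq L n := isTail_lin.nonneg _

lemma ySeq_antitone {L : ℝ} (hL : 0 < L) (m n : ℕ) (hm : 1 ≤ m) (h : m ≤ n) :
    ySeq L n ≤ ySeq L m := by
  have hm' : (0 : ℝ) < m := by exact_mod_cast hm
  refine isTail_lin.antitone ?_
  gcongr

lemma ySeq_le_two_mul_sq (L : ℝ) (n : ℕ) : ySeq L n ≤ 2 * ySeq L n ^ 2 := by
  unfold ySeq clip
  split_ifs <;> nlinarith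

lemma ySeq_mul {L : ℝ} {r n : ℕ} (hr : 1 ≤ r) (hn : 1 ≤ n) :
    ySeq L (r * n) = clip (fun s => 3 / 2 - s) (Real.log r / L + Real.log n / L) := by
  have hr' : (r : ℝ) ≠ 0 := by positivity
  have hn' : (n : ℝ) ≠ 0 := by positivity
  rw [ySeq, Nat.cast_mul, Real.log_mul hr' hn', add_div]

lemma totient_div_mem {W : ℕ} (hW : 0 < W) : 0 ≤ (W.totient / W : ℝ) ∧ (W.totient / W : ℝ) ≤ 1 := by
  refine ⟨by positivity, ?_⟩
  rw [div_le_one (by exact_mod_cast hW)]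
  exact_mod_cast Nat.totient_le W

lemma sum_ySeq_sq_le (W M D : ℕ) (L : ℝ) (hL : 1 ≤ L) (hM : 1 ≤ M) (hLM : L < Real.log (M + 1))
    (hW0 : 0 < W) (hD : 2 ≤ D) (hW : ∀ p : ℕ, p.Prime → p ≤ D → p ∣ W) :
    ∑ s ∈ sqfreeCoprime W M, primeProd (fun p => 2 / ((p : ℝ) - 2)) s * ySeq L s ^ 2 ≤
      Real.exp (4 / ((D : ℝ) - 1)) *
        ((W.totient / W : ℝ) ^ 2 * L ^ 2 * (3 / 8) + 10 * (W + 1) ^ 2 * L) := by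
  have hL0 : 0 < L := by linarith
  have hσ : ∀ σ : ℝ, 0 ≤ σ → 1 ≤ σ + Real.log (M + 1) / L := fun σ hσ => by
    have : 1 ≤ Real.log (M + 1) / L := by rw [le_div_iff₀ hL0]; linarith
    linarith
  refine (sum_primeProd_two_div_sub_two_le W M D hD hW (fun n => ySeq L n ^ 2)
    (fun n => sq_nonneg _) (fun m n hm h => by
      have := ySeq_antitone hL0 m n hm h
      have := ySeq_nonneg L n
      gcongr)).trans ?_
  refine mul_le_mul_of_nonneg_left ?_ (Real.exp_pos _).le
  obtain ⟨hκ0, hκ1⟩ := totient_div_mem hW0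
  set κ : ℝ := W.totient / W with hκ
  have h1 : ∀ u ∈ (Finset.Icc 1 M).filter (fun u => u.Coprime W),
      ∑ v ∈ Finset.Icc 1 M with v.Coprime W, ySeq L (u * v) ^ 2 / ((u : ℝ) * v) ≤
      κ * L * (clip tailSq (0 + Real.log u / L) / u) +
        (W + 1) * (clip (fun s => (3 / 2 - s) ^ 2) (0 + Real.log u / L) / u) := by
    intro u hu
    simp only [Finset.mem_filter, Finset.mem_Icc] at hu
    have hu' : (0 : ℝ) < u := by exact_mod_cast hu.1.1
    have h2 := (abs_le.1 (isTail_sq.abs_sum_coprime_sub_le (σ := Real.log u / L) hL0 W M hW0 hM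
      (hσ _ (div_nonneg (Real.log_natCast_nonneg _) hL0.le)))).2
    have h3 : ∑ v ∈ Finset.Icc 1 M with v.Coprime W, ySeq L (u * v) ^ 2 / ((u : ℝ) * v) =
        (∑ v ∈ Finset.Icc 1 M with v.Coprime W,
          clip (fun s => (3 / 2 - s) ^ 2) (Real.log u / L + Real.log v / L) / v) / u := by
      rw [Finset.sum_div]
      refine Finset.sum_congr rfl fun v hv => ?_
      simp only [Finset.mem_filter, Finset.mem_Icc] at hv
      rw [ySeq_mul hu.1.1 hv.1.1, clip_sq, div_div, mul_comm (u : ℝ)]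
    rw [h3, zero_add, mul_div_assoc', mul_div_assoc', ← add_div]
    gcongr
    linarith
  refine (Finset.sum_le_sum h1).trans ?_
  rw [Finset.sum_add_distrib, ← Finset.mul_sum, ← Finset.mul_sum]
  have h4 := (abs_le.1 (isTail_tailSq.abs_sum_coprime_sub_le (σ := 0) hL0 W M hW0 hM
      (hσ _ le_rfl))).2
  have h5 := (abs_le.1 (isTail_sq.abs_sum_coprime_sub_le (σ := 0) hL0 W M hW0 hM
      (hσ _ le_rfl))).2
  rw [← hκ] at h4 h5
  have e1 : clip tailSq 0 = 13 / 12 := by norm_num [clip, tailSq]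
  have e2 : clip (fun s : ℝ => (3 / 2 - s) ^ 2) 0 = 9 / 4 := by norm_num [clip]
  have e3 : clip (fun s : ℝ => ((3 / 2 - s) ^ 4 - 1 / 16) / 12 - (1 - s) / 24) 0 = 3 / 8 := by
    norm_num [clip]
  rw [e1, e3] at h4
  rw [e1, e2] at h5
  have hW1 : (1 : ℝ) ≤ W := by exact_mod_cast hW0
  have h6 := mul_le_mul_of_nonneg_left (tsub_le_iff_right.1 h4) (mul_nonneg hκ0 hL0.le)
  have h7 := mul_le_mul_of_nonneg_left (tsub_le_iff_right.1 h5) (by linarith : 0 ≤ (W : ℝ) + 1)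
  refine (add_le_add h6 h7).trans ?_
  have h8 : κ * L ≤ L := by nlinarith
  have h9 : ((W : ℝ) + 1) * (κ * L) ≤ (W + 1) ^ 2 * L := by
    refine mul_le_mul ?_ h8 (mul_nonneg hκ0 hL0.le) (by positivity)
    nlinarith
  have h10 : ((W : ℝ) + 1) ^ 2 ≤ (W + 1) ^ 2 * L := le_mul_of_one_le_right (by positivity) hL
  nlinarith

lemma sum_dvd_ySeq_ge (W M r : ℕ) (L : ℝ) (hL : 0 < L) (hM : 1 ≤ M) (hLM : L < Real.log (M + 1))
    (hW0 : 0 < W) (h2W : 2 ∣ W) (hr : r ∈ sqfreeCoprime W M) :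
    (W.totient / W : ℝ) * L * clip tailLin (Real.log r / L) - 3 / 2 * (W + 1) ≤
      primeProd (fun p => (p : ℝ) / (p - 1)) r * ∑ s ∈ sqfreeCoprime W M with r ∣ s,
        primeProd (fun p => 1 / ((p : ℝ) - 1)) (s / r) * ySeq L s := by
  have hr' := mem_sqfreeCoprime.1 hr
  have hσ : 1 ≤ Real.log r / L + Real.log (M + 1) / L := by
    have : 1 ≤ Real.log (M + 1) / L := by rw [le_div_iff₀ hL]; linarith
    have := div_nonneg (Real.log_natCast_nonneg r) hL.le
    linarith
  have hnn : ∀ a ∈ sqfreeCoprime W M, 0 ≤ primeProd (fun p => 1 / ((p : ℝ) - 1)) a := fun a ha =>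
    primeProd_nonneg fun p hp => by
      have := two_lt_of_mem_primeFactors h2W ha hp
      exact div_nonneg zero_le_one (by linarith)
  have h1 := (abs_le.1 (isTail_lin.abs_sum_coprime_sub_le hL W M hW0 hM hσ)).1
  have h2 := sum_coprime_div_le W M r (by omega) (fun n => ySeq L (r * n))
    (fun n => ySeq_nonneg _ _) (fun m n hm h => ySeq_antitone hL _ _ (Nat.mul_pos hr'.1.1 hm)
      (Nat.mul_le_mul_left r h))
  have h3 : ∑ n ∈ Finset.Icc 1 M with n.Coprime W, ySeq L (r * n) / n =
      ∑ n ∈ Finset.Icc 1 M with n.Coprime W,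
        clip (fun s => 3 / 2 - s) (Real.log r / L + Real.log n / L) / n := by
    refine Finset.sum_congr rfl fun n hn => ?_
    simp only [Finset.mem_filter, Finset.mem_Icc] at hn
    rw [ySeq_mul hr'.1.1 hn.1.1]
  have h4 : ∑ a ∈ sqfreeCoprime W M with a.Coprime r,
      primeProd (fun p => 1 / ((p : ℝ) - 1)) a * ySeq L (r * a) ≤
      ∑ s ∈ sqfreeCoprime W M with r ∣ s,
        primeProd (fun p => 1 / ((p : ℝ) - 1)) (s / r) * ySeq L s := by
    rw [← Finset.sum_filter_add_sum_filter_not _ (fun a => r * a ≤ M)]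
    have h5 : ∑ a ∈ ((sqfreeCoprime W M).filter (fun a => a.Coprime r)).filter
        (fun a => ¬ r * a ≤ M), primeProd (fun p => 1 / ((p : ℝ) - 1)) a * ySeq L (r * a) = 0 := by
      refine Finset.sum_eq_zero fun a ha => ?_
      have ha' := (Finset.mem_filter.1 ha).2
      have h6 : (M : ℝ) + 1 ≤ ((r * a : ℕ) : ℝ) := by exact_mod_cast (by omega)
      have h7 : Real.log (M + 1) ≤ Real.log ((r * a : ℕ) : ℝ) :=
        Real.log_le_log (by positivity) h6
      have h8 : ¬ Real.log ((r * a : ℕ) : ℝ) / L ≤ 1 := by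
        rw [div_le_iff₀ hL]
        linarith
      rw [ySeq, clip, if_neg h8, mul_zero]
    rw [h5, add_zero]
    have h9 : ∀ a ∈ ((sqfreeCoprime W M).filter (fun a => a.Coprime r)).filter
        (fun a => r * a ≤ M), primeProd (fun p => 1 / ((p : ℝ) - 1)) a * ySeq L (r * a) =
        primeProd (fun p => 1 / ((p : ℝ) - 1)) (r * a / r) * ySeq L (r * a) := fun a _ => by
      rw [Nat.mul_div_cancel_left _ hr'.1.1]
    rw [Finset.sum_congr rfl h9, ← Finset.sum_image (g := fun a => r * a)
      (f := fun s => primeProd (fun p => 1 / ((p : ℝ) - 1)) (s / r) * ySeq L s)]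
    · refine Finset.sum_le_sum_of_subset_of_nonneg (fun s hs => ?_) fun s hs _ => ?_
      · obtain ⟨a, ha, rfl⟩ := Finset.mem_image.1 hs
        simp only [Finset.mem_filter, mem_sqfreeCoprime] at ha ⊢
        exact ⟨⟨⟨Nat.mul_pos hr'.1.1 ha.1.1.1.1, ha.2⟩,
          (Nat.squarefree_mul_iff.2 ⟨ha.1.2.symm, hr'.2.1, ha.1.1.2.1⟩),
          Nat.Coprime.mul_left hr'.2.2 ha.1.1.2.2⟩, dvd_mul_right _ _⟩
      · obtain ⟨hs, h⟩ := Finset.mem_filter.1 hs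
        exact mul_nonneg (hnn _ (mem_sqfreeCoprime_of_dvd hs (Nat.div_dvd_of_dvd h)))
          (ySeq_nonneg _ _)
    · intro a _ b _ h
      exact Nat.eq_of_mul_eq_mul_left hr'.1.1 h
  have h10 : 0 ≤ primeProd (fun p => (p : ℝ) / (p - 1)) r := primeProd_nonneg fun p hp => by
    have := two_lt_of_mem_primeFactors h2W hr hp
    exact div_nonneg (by linarith) (by linarith)
  have h11 := mul_le_mul_of_nonneg_left h4 h10
  have h12 : clip (fun s => 3 / 2 - s) (Real.log r / L) ≤ 3 / 2 := by
    have := div_nonneg (Real.log_natCast_nonneg r) hL.le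
    unfold clip
    split_ifs <;> linarith
  rw [h3] at h2
  have h13 := mul_le_mul_of_nonneg_left h12 (by positivity : (0 : ℝ) ≤ W + 1)
  linarith

lemma mainTerm_totient_ySeq_ge (W M : ℕ) (L : ℝ) (hL : 1 ≤ L) (hM : 1 ≤ M)
    (hLM : L < Real.log (M + 1)) (hW0 : 0 < W) (h2W : 2 ∣ W) :
    (W.totient / W : ℝ) ^ 3 * L ^ 3 * (31 / 120) - 10 * (W + 1) ^ 2 * L ^ 2 ≤
    ∑ d ∈ sqfreeCoprime W M, ∑ e ∈ sqfreeCoprime W M,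
      sieveWeight W M (ySeq L) d * sieveWeight W M (ySeq L) e *
      primeProd (fun p => 1 / ((p : ℝ) - 1)) (d.lcm e) := by
  have hL0 : 0 < L := by linarith
  have hσ : 1 ≤ 0 + Real.log (M + 1) / L := by
    have : 1 ≤ Real.log (M + 1) / L := by rw [le_div_iff₀ hL0]; linarith
    linarith
  refine le_trans ?_ (mainTerm_totient_ge W M (ySeq L) h2W)
  obtain ⟨hκ0, hκ1⟩ := totient_div_mem hW0
  set κ : ℝ := W.totient / W with hκ
  set C : ℝ := 3 / 2 * (W + 1) with hC
  have hC0 : 0 ≤ C := by positivity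
  set f : ℕ → ℝ := fun n => (max (κ * L * clip tailLin (Real.log n / L) - C) 0) ^ 2 with hf
  have hnn : ∀ a ∈ sqfreeCoprime W M, 0 ≤ primeProd (fun p => 1 / ((p : ℝ) - 1)) a := fun a ha =>
    primeProd_nonneg fun p hp => by
      have := two_lt_of_mem_primeFactors h2W ha hp
      exact div_nonneg zero_le_one (by linarith)
  have h1 : ∑ r ∈ sqfreeCoprime W M, primeProd (fun p => 1 / ((p : ℝ) - 1)) r * f r ≤
      ∑ r ∈ sqfreeCoprime W M, primeProd (fun p => 1 / ((p : ℝ) - 1)) r *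
      (primeProd (fun p => (p : ℝ) / (p - 1)) r * ∑ s ∈ sqfreeCoprime W M with r ∣ s,
        primeProd (fun p => 1 / ((p : ℝ) - 1)) (s / r) * ySeq L s) ^ 2 := by
    refine Finset.sum_le_sum fun r hr => mul_le_mul_of_nonneg_left ?_ (hnn r hr)
    refine pow_le_pow_left₀ (le_max_right _ _) (max_le ?_ ?_) 2
    · exact sum_dvd_ySeq_ge W M r L hL0 hM hLM hW0 h2W hr
    · refine mul_nonneg (primeProd_nonneg fun p hp => ?_) (Finset.sum_nonneg fun s hs => ?_)
      · have := two_lt_of_mem_primeFactors h2W hr hp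
        exact div_nonneg (by linarith) (by linarith)
      · obtain ⟨hs, h⟩ := Finset.mem_filter.1 hs
        exact mul_nonneg (hnn _ (mem_sqfreeCoprime_of_dvd hs (Nat.div_dvd_of_dvd h)))
          (ySeq_nonneg _ _)
  refine le_trans ?_ h1
  have h2 := sum_coprime_div_le W M 1 one_ne_zero f (fun n => sq_nonneg _) (fun m n hm h => by
    have hm' : (0 : ℝ) < m := by exact_mod_cast hm
    refine pow_le_pow_left₀ (le_max_right _ _) (max_le_max (sub_le_sub_right ?_ _) le_rfl) 2
    refine mul_le_mul_of_nonneg_left (isTail_tailLin.antitone ?_) (mul_nonneg hκ0 hL0.le)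
    gcongr)
  rw [primeProd_one, one_mul, Finset.filter_true_of_mem (fun a _ => Nat.coprime_one_right a)] at h2
  refine le_trans ?_ h2
  have h3 : ∀ n ∈ (Finset.Icc 1 M).filter (fun n => n.Coprime W),
      κ ^ 2 * L ^ 2 * (clip (fun s => tailLin s ^ 2) (0 + Real.log n / L) / n) -
        2 * C * (κ * L) * (clip tailLin (0 + Real.log n / L) / n) ≤ f n / n := by
    intro n _
    rw [mul_div_assoc', mul_div_assoc', ← sub_div]
    refine div_le_div_of_nonneg_right ?_ (Nat.cast_nonneg n)
    rw [zero_add, ← clip_sq]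
    have h0 := isTail_tailLin.nonneg (Real.log n / L)
    set q := clip tailLin (Real.log n / L)
    have hq : 0 ≤ κ * L * q := by positivity
    simp only [hf]
    rcases le_total (κ * L * q - C) 0 with h | h
    · rw [max_eq_right h]
      nlinarith
    · rw [max_eq_left h]
      nlinarith
  refine le_trans ?_ (Finset.sum_le_sum h3)
  rw [Finset.sum_sub_distrib, ← Finset.mul_sum, ← Finset.mul_sum]
  have h4 := (abs_le.1 (isTail_tailLin_sq.abs_sum_coprime_sub_le (σ := 0) hL0 W M hW0 hM hσ)).1
  have h5 := (abs_le.1 (isTail_tailLin.abs_sum_coprime_sub_le (σ := 0) hL0 W M hW0 hM hσ)).2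
  rw [← hκ] at h4 h5
  have e1 : clip tailLin 0 = 1 := by norm_num [clip, tailLin]
  have e2 : clip (fun s : ℝ => tailLin s ^ 2) 0 = 1 := by norm_num [clip, tailLin]
  have e3 : clip (fun s : ℝ => ((3 / 2 - s) ^ 5 / 5 - (3 / 2 - s) ^ 3 / 6 + (3 / 2 - s) / 16 -
      1 / 60) / 4) 0 = 31 / 120 := by norm_num [clip]
  have e4 : clip (fun s : ℝ => ((3 / 2 - s) ^ 3 - 1 / 8) / 6 - (1 - s) / 8) 0 = 5 / 12 := by
    norm_num [clip]
  rw [e2, e3] at h4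
  rw [e1, e4] at h5
  have hW1 : (1 : ℝ) ≤ W := by exact_mod_cast hW0
  set A := ∑ i ∈ Finset.Icc 1 M with i.Coprime W,
    clip (fun s => tailLin s ^ 2) (0 + Real.log i / L) / (i : ℝ)
  set B := ∑ i ∈ Finset.Icc 1 M with i.Coprime W, clip tailLin (0 + Real.log i / L) / (i : ℝ)
  have hκL : 0 ≤ κ * L := mul_nonneg hκ0 hL0.le
  have hκL1 : κ * L ≤ L := by nlinarith
  have h6 : κ ^ 2 * L ^ 2 * (κ * L * (31 / 120) - (W + 1)) ≤ κ ^ 2 * L ^ 2 * A :=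
    mul_le_mul_of_nonneg_left (by linarith) (by positivity)
  have h7 : 2 * C * (κ * L) * B ≤ 2 * C * (κ * L) * (κ * L * (5 / 12) + (W + 1)) :=
    mul_le_mul_of_nonneg_left (by linarith) (by positivity)
  have h8 : κ ^ 2 * L ^ 2 ≤ L ^ 2 := by nlinarith
  have h9 : κ ^ 2 * L ^ 2 * ((W : ℝ) + 1) ≤ L ^ 2 * (W + 1) :=
    mul_le_mul_of_nonneg_right h8 (by linarith)
  have h10 : 2 * C * (κ * L) * (κ * L * (5 / 12) + (W + 1)) ≤
      2 * C * L * (L * (5 / 12) + L * (W + 1)) := by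
    have : (W : ℝ) + 1 ≤ L * (W + 1) := le_mul_of_one_le_left (by linarith) hL
    gcongr
  have h11 : L ^ 2 * ((W : ℝ) + 1) ≤ L ^ 2 * (W + 1) ^ 2 := by
    gcongr
    nlinarith
  rw [hC] at h10 h7 ⊢
  nlinarith

lemma card_divisors_mul_le (u v : ℕ) :
    (u * v).divisors.card ≤ u.divisors.card * v.divisors.card := by
  rw [Nat.divisors_mul]
  exact Finset.card_mul_le

lemma one_le_card_divisors {n : ℕ} (hn : 1 ≤ n) : 1 ≤ n.divisors.card :=
  Finset.card_pos.2 ⟨1, Nat.mem_divisors.2 ⟨one_dvd n, by omega⟩⟩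

lemma sum_card_divisors_pow_div_le (k x : ℕ) :
    ∑ q ∈ Finset.Icc 1 x, (q.divisors.card : ℝ) ^ k / q ≤ (1 + Real.log x) ^ 2 ^ k := by
  induction k with
  | zero =>
    have := harmonic_le_one_add_log x
    rw [harmonic_eq_sum_Icc] at this
    push_cast at this
    simpa using this
  | succ k ih =>
    have h1 : ∑ q ∈ Finset.Icc 1 x, (q.divisors.card : ℝ) ^ (k + 1) / q ≤
        (∑ u ∈ Finset.Icc 1 x, (u.divisors.card : ℝ) ^ k / u) *
          ∑ v ∈ Finset.Icc 1 x, (v.divisors.card : ℝ) ^ k / v := by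
      rw [Finset.sum_mul_sum, ← Finset.sum_product']
      have h2 : ∀ q ∈ Finset.Icc 1 x, (q.divisors.card : ℝ) ^ (k + 1) / q ≤
          ∑ p ∈ (Finset.Icc 1 x ×ˢ Finset.Icc 1 x) with p.1 * p.2 = q,
            (p.1.divisors.card : ℝ) ^ k / p.1 * ((p.2.divisors.card : ℝ) ^ k / p.2) := by
        intro q hq
        rw [Finset.mem_Icc] at hq
        have h3 : (Finset.Icc 1 x ×ˢ Finset.Icc 1 x).filter (fun p => p.1 * p.2 = q) =
            q.divisorsAntidiagonal := by
          ext ⟨a, b⟩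
          simp only [Finset.mem_filter, Finset.mem_product, Finset.mem_Icc,
            Nat.mem_divisorsAntidiagonal]
          constructor
          · rintro ⟨_, h⟩
            exact ⟨h, by omega⟩
          · rintro ⟨rfl, h⟩
            have ha : 0 < a := Nat.pos_of_ne_zero fun h0 => by simp [h0] at h
            have hb : 0 < b := Nat.pos_of_ne_zero fun h0 => by simp [h0] at h
            exact ⟨⟨⟨ha, (Nat.le_mul_of_pos_right a hb).trans hq.2⟩, hb,
              (Nat.le_mul_of_pos_left b ha).trans hq.2⟩, rfl⟩
        rw [h3]
        have h4 : ∀ p ∈ q.divisorsAntidiagonal, (q.divisors.card : ℝ) ^ k / q ≤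
            (p.1.divisors.card : ℝ) ^ k / p.1 * ((p.2.divisors.card : ℝ) ^ k / p.2) := by
          rintro ⟨a, b⟩ hp
          obtain ⟨rfl, h⟩ := Nat.mem_divisorsAntidiagonal.1 hp
          rw [div_mul_div_comm, ← mul_pow]
          push_cast
          gcongr
          exact_mod_cast card_divisors_mul_le a b
        refine le_trans (le_of_eq ?_) (Finset.sum_le_sum h4)
        rw [Finset.sum_const, nsmul_eq_mul, ← Nat.map_div_right_divisors, Finset.card_map]
        ring
      refine (Finset.sum_le_sum h2).trans ?_
      rw [Finset.sum_fiberwise_eq_sum_filter]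
      exact Finset.sum_le_sum_of_subset_of_nonneg (Finset.filter_subset _ _)
        fun p _ _ => by positivity
    refine h1.trans ?_
    rw [pow_succ 2 k, pow_mul, sq]
    have h0 : 0 ≤ ∑ v ∈ Finset.Icc 1 x, (v.divisors.card : ℝ) ^ k / v :=
      Finset.sum_nonneg fun v _ => by positivity
    exact mul_le_mul ih ih h0 (h0.trans ih)

lemma le_totient_mul_card_divisors (q : ℕ) : q ≤ q.totient * q.divisors.card := by
  rcases Nat.eq_zero_or_pos q with rfl | hq
  · simp
  calc q = ∑ d ∈ q.divisors, d.totient := (Nat.sum_totient q).symm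
    _ ≤ ∑ d ∈ q.divisors, q.totient := Finset.sum_le_sum fun d hd =>
        Nat.le_of_dvd (Nat.totient_pos.2 hq) (Nat.totient_dvd_of_dvd (Nat.dvd_of_mem_divisors hd))
    _ = _ := by simp [mul_comm]

/-- `E q N` is negligible on average over `q ≤ N ^ η`, even when weighted by divisor functions. -/
structure SmallErr (η : ℝ) (E : ℕ → ℕ → ℝ) : Prop where
  nonneg : ∀ q N, 0 ≤ E q N
  bound : ∀ k A : ℕ, ∃ C > (0 : ℝ), ∀ N : ℕ, 2 ≤ N →
    ∑ q ∈ Finset.Icc 1 ⌊(N : ℝ) ^ η⌋₊, (q.divisors.card : ℝ) ^ k * E q N ≤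
      C * N / Real.log N ^ A

lemma half_le_log {N : ℕ} (hN : 2 ≤ N) : 1 / 2 ≤ Real.log N := by
  have h1 : Real.log 2 ≤ Real.log N := Real.log_le_log (by norm_num) (by exact_mod_cast hN)
  have := Real.log_two_gt_d9
  linarith

lemma SmallErr.of_level {η : ℝ} (hη : η ≤ 1) {E : ℕ → ℕ → ℝ} (h0 : ∀ q N, 0 ≤ E q N) {B : ℝ}
    (hB : 0 < B) (hE : ∀ q N : ℕ, 2 ≤ N → 1 ≤ q → q ≤ N →
      E q N ≤ B * N * Real.log N * (q.divisors.card / q))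
    (hlev : ∀ A > (0 : ℝ), ∃ C > (0 : ℝ), ∀ N : ℕ, 2 ≤ N →
      ∑ q ∈ Finset.Icc 1 ⌊(N : ℝ) ^ η⌋₊, E q N ≤ C * N / Real.log N ^ A) : SmallErr η E := by
  refine ⟨h0, fun k A => ?_⟩
  set K : ℕ := 2 ^ (2 * k + 1) with hK
  obtain ⟨C, hC, hCN⟩ := hlev ((2 * A + 1 + K : ℕ) : ℝ) (by positivity)
  refine ⟨Real.sqrt (B * 3 ^ K * C), Real.sqrt_pos.2 (by positivity), fun N hN => ?_⟩
  have hlog := half_le_log hN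
  have hlog0 : 0 < Real.log N := by linarith
  have hN0 : (0 : ℝ) < N := by exact_mod_cast (by omega : 0 < N)
  set x := ⌊(N : ℝ) ^ η⌋₊ with hx
  have hxN : x ≤ N := by
    have : (N : ℝ) ^ η ≤ N := by
      calc (N : ℝ) ^ η ≤ (N : ℝ) ^ (1 : ℝ) :=
            Real.rpow_le_rpow_of_exponent_le (by exact_mod_cast (by omega : 1 ≤ N)) hη
        _ = N := Real.rpow_one _
    exact Nat.floor_le_of_le this
  have h1 := Finset.sum_sq_le_sum_mul_sum_of_sq_le_mul (Finset.Icc 1 x)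
    (r := fun q => (q.divisors.card : ℝ) ^ k * E q N)
    (f := fun q => (q.divisors.card : ℝ) ^ (2 * k) * E q N) (g := fun q => E q N)
    (fun q _ => mul_nonneg (by positivity) (h0 q N)) (fun q _ => h0 q N)
    (fun q _ => le_of_eq (by ring))
  have h2 : ∑ q ∈ Finset.Icc 1 x, (q.divisors.card : ℝ) ^ (2 * k) * E q N ≤
      B * N * Real.log N * (3 * Real.log N) ^ K := by
    have h3 : ∀ q ∈ Finset.Icc 1 x, (q.divisors.card : ℝ) ^ (2 * k) * E q N ≤
        B * N * Real.log N * ((q.divisors.card : ℝ) ^ (2 * k + 1) / q) := by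
      intro q hq
      rw [Finset.mem_Icc] at hq
      refine (mul_le_mul_of_nonneg_left (hE q N hN hq.1 (hq.2.trans hxN))
        (by positivity)).trans (le_of_eq ?_)
      ring
    refine (Finset.sum_le_sum h3).trans ?_
    rw [← Finset.mul_sum]
    refine mul_le_mul_of_nonneg_left ?_ (by positivity)
    refine (Finset.sum_le_sum_of_subset_of_nonneg (Finset.Icc_subset_Icc_right hxN)
      fun q _ _ => by positivity).trans ?_
    refine (sum_card_divisors_pow_div_le (2 * k + 1) N).trans ?_
    exact pow_le_pow_left₀ (by linarith) (by linarith) K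
  have h4 := hCN N hN
  rw [Real.rpow_natCast] at h4
  have h5 : (∑ q ∈ Finset.Icc 1 x, (q.divisors.card : ℝ) ^ k * E q N) ^ 2 ≤
      (B * 3 ^ K * C) * (N / Real.log N ^ A) ^ 2 := by
    refine h1.trans ((mul_le_mul h2 h4 (Finset.sum_nonneg fun q _ => h0 q N)
      (by positivity)).trans (le_of_eq ?_))
    rw [mul_pow, pow_add, pow_add, pow_mul' (Real.log N) 2 A]
    field_simp
  rw [mul_div_assoc]
  refine abs_le_of_sq_le_sq' ?_ (by positivity) |>.2
  rw [mul_pow, Real.sq_sqrt (by positivity)]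
  exact h5

lemma SmallErr.mono {η : ℝ} {E E' : ℕ → ℕ → ℝ} (h : SmallErr η E) (h0 : ∀ q N, 0 ≤ E' q N)
    (B : ℝ) (hB : 0 < B) (hE : ∀ q N, 2 ≤ N → E' q N ≤ B * E q N) : SmallErr η E' := by
  refine ⟨h0, fun k A => ?_⟩
  obtain ⟨C, hC, h1⟩ := h.bound k A
  refine ⟨B * C, by positivity, fun N hN => ?_⟩
  have : ∀ q ∈ Finset.Icc 1 ⌊(N : ℝ) ^ η⌋₊, (q.divisors.card : ℝ) ^ k * E' q N ≤
      B * ((q.divisors.card : ℝ) ^ k * E q N) := fun q _ => by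
    have := mul_le_mul_of_nonneg_left (hE q N hN) (by positivity : 0 ≤ (q.divisors.card : ℝ) ^ k)
    linarith
  refine (Finset.sum_le_sum this).trans ?_
  rw [← Finset.mul_sum, mul_assoc, mul_div_assoc]
  exact mul_le_mul_of_nonneg_left (h1 N hN) hB.le

lemma SmallErr.add {η : ℝ} {E E' : ℕ → ℕ → ℝ} (h : SmallErr η E) (h' : SmallErr η E') :
    SmallErr η (fun q N => E q N + E' q N) := by
  refine ⟨fun q N => add_nonneg (h.nonneg q N) (h'.nonneg q N), fun k A => ?_⟩
  obtain ⟨C, hC, h1⟩ := h.bound k A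
  obtain ⟨C', hC', h1'⟩ := h'.bound k A
  refine ⟨C + C', by positivity, fun N hN => ?_⟩
  simp only [mul_add, Finset.sum_add_distrib, add_mul, add_div]
  exact add_le_add (h1 N hN) (h1' N hN)

lemma SmallErr.log {η : ℝ} (hη : η < 1) : SmallErr η (fun _ N => Real.log N) := by
  refine SmallErr.of_level hη.le (fun _ N => Real.log_natCast_nonneg N) one_pos
    (fun q N hN hq hqN => ?_) fun A hA => ?_
  · have hq' : (0 : ℝ) < q := by exact_mod_cast hq
    have hqN' : (q : ℝ) ≤ N := by exact_mod_cast hqN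
    have h1 : (1 : ℝ) ≤ q.divisors.card := by exact_mod_cast one_le_card_divisors hq
    have h2 : 1 ≤ N * ((q.divisors.card : ℝ) / q) := by
      rw [mul_div_assoc', one_le_div hq']
      nlinarith
    have := mul_le_mul_of_nonneg_left h2 (Real.log_natCast_nonneg N)
    linarith
  · have h1 := isLittleO_log_rpow_rpow_atTop (A + 1) (sub_pos.2 hη)
    have h2 : ∀ᶠ x : ℝ in atTop, Real.log x ^ (A + 1) ≤ x ^ (1 - η) := by
      filter_upwards [h1.bound one_pos, eventually_ge_atTop 1] with x hx hx1
      rw [one_mul, Real.norm_of_nonneg (Real.rpow_nonneg (Real.log_nonneg hx1) _),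
        Real.norm_of_nonneg (by positivity)] at hx
      exact hx
    obtain ⟨N₀, hN₀⟩ := eventually_atTop.1 (tendsto_natCast_atTop_atTop.eventually h2)
    have key : ∀ N : ℕ, 2 ≤ N → ∑ q ∈ Finset.Icc 1 ⌊(N : ℝ) ^ η⌋₊, Real.log N ≤
        ((N : ℝ) ^ η * Real.log N) := fun N hN => by
      rw [Finset.sum_const, nsmul_eq_mul, Nat.card_Icc, Nat.add_sub_cancel]
      exact mul_le_mul_of_nonneg_right (Nat.floor_le (by positivity)) (Real.log_natCast_nonneg N)
    refine ⟨1 + (Real.log N₀ + 1) ^ (A + 1), by have := Real.log_natCast_nonneg N₀; positivity,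
      fun N hN => (key N hN).trans ?_⟩
    have hlog := half_le_log hN
    have hlog0 : 0 < Real.log N := by linarith
    have hN0 : (0 : ℝ) < N := by exact_mod_cast (by omega : 0 < N)
    have h3 : Real.log N ^ (A + 1) ≤ (1 + (Real.log N₀ + 1) ^ (A + 1)) * (N : ℝ) ^ (1 - η) := by
      have h4 : (1 : ℝ) ≤ (N : ℝ) ^ (1 - η) :=
        Real.one_le_rpow (by exact_mod_cast (by omega : 1 ≤ N)) (by linarith)
      have h6 : 0 ≤ (Real.log N₀ + 1) ^ (A + 1) := by
        have := Real.log_natCast_nonneg N₀; positivity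
      rcases le_total N₀ N with h | h
      · have := hN₀ N h
        nlinarith
      · have h5 : Real.log N ^ (A + 1) ≤ (Real.log N₀ + 1) ^ (A + 1) := by
          refine Real.rpow_le_rpow hlog0.le ?_ (by linarith)
          have := Real.log_le_log hN0 (by exact_mod_cast h : (N : ℝ) ≤ N₀)
          linarith
        nlinarith
    rw [le_div_iff₀ (by positivity), mul_assoc]
    have h7 : Real.log N * Real.log N ^ A = Real.log N ^ (A + 1) := by
      rw [Real.rpow_add hlog0, Real.rpow_one, mul_comm]
    rw [h7]
    refine (mul_le_mul_of_nonneg_left h3 (by positivity)).trans (le_of_eq ?_)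
    rw [mul_left_comm, ← Real.rpow_add hN0]
    norm_num

lemma sum_mul_modulus_le {η : ℝ} {E : ℕ → ℕ → ℝ} (h0 : ∀ q N, 0 ≤ E q N) (k W Y N : ℕ)
    (hW : 0 < W) (hY : ((W * Y : ℕ) : ℝ) ≤ (N : ℝ) ^ η) :
    ∑ q ∈ Finset.Icc 1 Y, (q.divisors.card : ℝ) ^ k * E (W * q) N ≤
      ∑ q ∈ Finset.Icc 1 ⌊(N : ℝ) ^ η⌋₊, (q.divisors.card : ℝ) ^ k * E q N := by
  have h1 : ∀ q ∈ Finset.Icc 1 Y, (q.divisors.card : ℝ) ^ k * E (W * q) N ≤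
      ((W * q).divisors.card : ℝ) ^ k * E (W * q) N := fun q hq => by
    have hq' := (Finset.mem_Icc.1 hq).1
    refine mul_le_mul_of_nonneg_right ?_ (h0 _ _)
    have : q.divisors.card ≤ (W * q).divisors.card :=
      Finset.card_le_card (Nat.divisors_subset_of_dvd (Nat.mul_pos hW hq').ne' (dvd_mul_left _ _))
    gcongr
  refine (Finset.sum_le_sum h1).trans ?_
  rw [← Finset.sum_image (g := fun q => W * q)
    (f := fun q => (q.divisors.card : ℝ) ^ k * E q N)
    (fun a _ b _ h => Nat.eq_of_mul_eq_mul_left hW h)]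
  refine Finset.sum_le_sum_of_subset_of_nonneg (fun m hm => ?_)
    fun q _ _ => mul_nonneg (by positivity) (h0 _ _)
  obtain ⟨q, hq, rfl⟩ := Finset.mem_image.1 hm
  rw [Finset.mem_Icc] at hq ⊢
  refine ⟨Nat.mul_pos hW hq.1, Nat.le_floor (le_trans ?_ hY)⟩
  exact_mod_cast Nat.mul_le_mul_left W hq.2

/-- The sum of `f` over the `n ≤ N` with `n ≡ a (mod q)`. -/
noncomputable def apSum (f : ℕ → ℝ) (q a N : ℕ) : ℝ :=
  ∑ n ∈ Finset.Icc 1 N, if n % q = a % q then f n else 0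

lemma abs_card_modEq_sub_le (q a N : ℕ) (hq : 0 < q) :
    |(((Finset.Icc 1 N).filter fun n => n % q = a % q).card : ℝ) - N / q| ≤ 1 := by
  have h1 := Nat.Ioc_filter_modEq_card 0 N hq a
  have h2 : (Finset.Icc 1 N).filter (fun n => n % q = a % q) =
      (Finset.Ioc 0 N).filter (fun n => n ≡ a [MOD q]) := by
    ext n
    rw [Finset.mem_filter, Finset.mem_filter, Finset.mem_Icc, Finset.mem_Ioc]
    exact Iff.rfl
  rw [h2]
  set k := ((Finset.Ioc 0 N).filter (fun n => n ≡ a [MOD q])).card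
  have hq' : (0 : ℚ) < q := by exact_mod_cast hq
  set x : ℚ := ((N : ℚ) - a) / q with hx
  set y : ℚ := (((0 : ℕ) : ℚ) - a) / q with hy
  have hxy : x - y = N / q := by rw [hx, hy]; push_cast; ring
  have hle : y ≤ x := by
    have : (0 : ℚ) ≤ N / q := by positivity
    linarith
  rw [max_eq_left (sub_nonneg.2 (Int.floor_le_floor hle))] at h1
  have h3 : (k : ℚ) = ⌊x⌋ - ⌊y⌋ := by exact_mod_cast h1
  have h4 := Int.floor_le x
  have h5 := Int.lt_floor_add_one x
  have h6 := Int.floor_le y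
  have h7 := Int.lt_floor_add_one y
  have h8 : |(k : ℚ) - N / q| ≤ 1 := by
    rw [abs_le]
    constructor <;> linarith
  have h9 : ((|(k : ℚ) - N / q| : ℚ) : ℝ) ≤ ((1 : ℚ) : ℝ) := by exact_mod_cast h8
  push_cast at h9
  exact h9

lemma abs_apSum_le (f : ℕ → ℝ) (q a N : ℕ) (hq : 0 < q) (B : ℝ)
    (hf : ∀ n, 1 ≤ n → n ≤ N → |f n| ≤ B) (hB : 0 ≤ B) : |apSum f q a N| ≤ B * (N / q + 1) := by
  rw [apSum, ← Finset.sum_filter]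
  refine (Finset.abs_sum_le_sum_abs _ _).trans ?_
  refine (Finset.sum_le_card_nsmul _ _ B fun n hn => ?_).trans ?_
  · simp only [Finset.mem_filter, Finset.mem_Icc] at hn
    exact hf n hn.1.1 hn.1.2
  · rw [nsmul_eq_mul, mul_comm]
    have := (abs_le.1 (abs_card_modEq_sub_le q a N hq)).2
    exact mul_le_mul_of_nonneg_left (by linarith) hB

lemma abs_apSum_le_sum (f : ℕ → ℝ) (q a N : ℕ) :
    |apSum f q a N| ≤ ∑ n ∈ Finset.Icc 1 N, |f n| := by
  refine (Finset.abs_sum_le_sum_abs _ _).trans (Finset.sum_le_sum fun n _ => ?_)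
  split_ifs <;> simp

lemma abs_apSum_le_maxAbs (f : ℕ → ℝ) (q a N : ℕ) : |apSum f q a N| ≤ maxAbs f q N :=
  le_ciSup (f := fun a => |apSum f q a N|)
    ⟨∑ n ∈ Finset.Icc 1 N, |f n|, by rintro _ ⟨b, rfl⟩; exact abs_apSum_le_sum f q b N⟩ a

lemma maxAbs_nonneg (f : ℕ → ℝ) (q N : ℕ) : 0 ≤ maxAbs f q N :=
  (abs_nonneg _).trans (abs_apSum_le_maxAbs f q 0 N)

lemma log_le_log_of_le {n N : ℕ} (hn : 1 ≤ n) (h : n ≤ N) : Real.log n ≤ Real.log N :=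
  Real.log_le_log (by exact_mod_cast hn) (by exact_mod_cast h)

lemma smallErr_maxAbs {f : ℕ → ℝ} {ϑ η : ℝ} (h : HasLevel f ϑ) (hη : η < ϑ) (hη1 : η ≤ 1)
    (hf : ∀ n, 1 ≤ n → |f n| ≤ 1 + Real.log n) : SmallErr η (maxAbs f) := by
  refine SmallErr.of_level hη1 (maxAbs_nonneg f) (B := 6) (by norm_num) (fun q N hN hq hqN => ?_) ?_
  · refine ciSup_le fun a => ?_
    have hlog := half_le_log hN
    have h1 := abs_apSum_le f q a N hq (3 * Real.log N) (fun n hn hnN => (hf n hn).trans (by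
      have := log_le_log_of_le hn hnN
      linarith)) (by linarith)
    refine h1.trans ?_
    have hq' : (0 : ℝ) < q := by exact_mod_cast hq
    have hqN' : (q : ℝ) ≤ N := by exact_mod_cast hqN
    have h2 : (1 : ℝ) ≤ q.divisors.card := by exact_mod_cast one_le_card_divisors hq
    have h3 : (N : ℝ) / q + 1 ≤ 2 * (N / q) := by
      have : 1 ≤ (N : ℝ) / q := (one_le_div hq').2 hqN'
      linarith
    have h4 : (N : ℝ) / q ≤ N * (q.divisors.card / q) := by
      rw [mul_div_assoc']
      gcongr
      exact le_mul_of_one_le_right (by positivity) h2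
    have h5 : (N : ℝ) / q + 1 ≤ 2 * (N * (q.divisors.card / q)) := by linarith
    have := mul_le_mul_of_nonneg_left h5 (by linarith : 0 ≤ 3 * Real.log N)
    linarith
  · intro A hA
    have := h (ϑ - η) (by linarith) A hA
    simpa using this

lemma primesum_eq (q a N : ℕ) :
    (∑ p ∈ Finset.Icc 1 N, if p.Prime ∧ p % q = a % q then Real.log p else 0) =
      apSum theta q a N := by
  refine Finset.sum_congr rfl fun p _ => ?_
  unfold theta
  split_ifs <;> simp_all

lemma bddAbove_primeMaxAbs (q N : ℕ) : BddAbove (Set.range fun a : ℕ => if Nat.Coprime a q then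
    |(∑ p ∈ Finset.Icc 1 N, if p.Prime ∧ p % q = a % q then Real.log p else 0)
      - N / q.totient| else 0) := by
  refine ⟨∑ n ∈ Finset.Icc 1 N, |theta n| + |(N : ℝ) / q.totient|, ?_⟩
  rintro _ ⟨a, rfl⟩
  beta_reduce
  split_ifs
  · rw [primesum_eq]
    exact (abs_sub _ _).trans (add_le_add (abs_apSum_le_sum _ _ _ _) le_rfl)
  · exact add_nonneg (Finset.sum_nonneg fun _ _ => abs_nonneg _) (abs_nonneg _)

lemma abs_apSum_theta_sub_le (q a N : ℕ) (h : a.Coprime q) :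
    |apSum theta q a N - N / q.totient| ≤ primeMaxAbs q N := by
  have := le_ciSup (bddAbove_primeMaxAbs q N) a
  rwa [if_pos h, primesum_eq] at this

lemma primeMaxAbs_nonneg (q N : ℕ) : 0 ≤ primeMaxAbs q N :=
  Real.iSup_nonneg fun a => by split_ifs <;> positivity

lemma theta_nonneg (n : ℕ) : 0 ≤ theta n := by
  unfold theta
  split_ifs
  exacts [Real.log_natCast_nonneg n, le_rfl]

lemma theta_le_log (n : ℕ) : theta n ≤ Real.log n := by
  unfold theta
  split_ifs
  exacts [le_rfl, Real.log_natCast_nonneg n]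

lemma abs_lio (n : ℕ) : |lio n| = 1 := by simp [lio]

lemma smallErr_primeMaxAbs {ϑ η : ℝ} (h : PrimesLevel ϑ) (hη : η < ϑ) (hη1 : η ≤ 1) :
    SmallErr η primeMaxAbs := by
  refine SmallErr.of_level hη1 primeMaxAbs_nonneg (B := 4) (by norm_num)
    (fun q N hN hq hqN => ?_) ?_
  · refine ciSup_le fun a => ?_
    have hlog := half_le_log hN
    have hq' : (0 : ℝ) < q := by exact_mod_cast hq
    have hqN' : (q : ℝ) ≤ N := by exact_mod_cast hqN
    have h2 : (1 : ℝ) ≤ q.divisors.card := by exact_mod_cast one_le_card_divisors hq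
    have h0 : 0 ≤ (N : ℝ) * (q.divisors.card / q) := by positivity
    split_ifs
    · rw [primesum_eq]
      have h1 := abs_apSum_le theta q a N hq (Real.log N) (fun n hn hnN => by
        rw [abs_of_nonneg (theta_nonneg n)]
        exact (theta_le_log n).trans (log_le_log_of_le hn hnN)) (by linarith)
      refine (abs_sub _ _).trans ?_
      have h3 : (N : ℝ) / q + 1 ≤ 2 * (N / q) := by
        have : 1 ≤ (N : ℝ) / q := (one_le_div hq').2 hqN'
        linarith
      have h4 : (N : ℝ) / q ≤ N * (q.divisors.card / q) := by
        rw [mul_div_assoc']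
        gcongr
        exact le_mul_of_one_le_right (by positivity) h2
      have h6 : |(N : ℝ) / q.totient| ≤ N * (q.divisors.card / q) := by
        rw [abs_of_nonneg (by positivity), mul_div_assoc', div_le_div_iff₀
          (by exact_mod_cast Nat.totient_pos.2 hq) hq', mul_assoc]
        gcongr
        rw [mul_comm]
        exact_mod_cast le_totient_mul_card_divisors q
      have h5 : (N : ℝ) / q + 1 ≤ 2 * (N * (q.divisors.card / q)) := by linarith
      have h7 := mul_le_mul_of_nonneg_left h5 (by linarith : 0 ≤ Real.log N)
      have h8 := mul_le_mul_of_nonneg_right hlog h0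
      linarith
    · nlinarith
  · intro A hA
    have := h (ϑ - η) (by linarith) A hA
    simpa using this

lemma sum_Icc_one_add (H : ℕ → ℝ) (a b : ℕ) :
    ∑ n ∈ Finset.Icc 1 (a + b), H n =
      ∑ n ∈ Finset.Icc 1 a, H n + ∑ i ∈ Finset.Icc 1 b, H (a + i) := by
  induction b with
  | zero => simp
  | succ b ih =>
    rw [← add_assoc, Finset.sum_Icc_succ_top (by omega), Finset.sum_Icc_succ_top (by omega), ih]
    exact add_assoc _ _ _

lemma apSum_shift (F G : ℕ → ℝ) (q a h N : ℕ) (B : ℝ) (hB0 : 0 ≤ B)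
    (hFG : ∀ n, 1 ≤ n → G n = F (n + h)) (hB : ∀ n, 1 ≤ n → n ≤ N + h → |F n| ≤ B) :
    |apSum G q a N - apSum F q (a + h) N| ≤ 2 * h * B := by
  set H : ℕ → ℝ := fun n => if n % q = (a + h) % q then F n else 0 with hH
  have h1 : apSum G q a N = ∑ n ∈ Finset.Icc 1 N, H (h + n) := by
    refine Finset.sum_congr rfl fun n hn => ?_
    have h2 : n % q = a % q ↔ (h + n) % q = (a + h) % q := by
      rw [add_comm h n]
      exact ⟨fun e => Nat.ModEq.add_right h e, fun e => Nat.ModEq.add_right_cancel' h e⟩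
    simp only [hH, h2, hFG n (Finset.mem_Icc.1 hn).1, add_comm h n]
  have h2 : ∀ s : Finset ℕ, ∀ g : ℕ → ℕ, s.card ≤ h → (∀ i ∈ s, 1 ≤ g i ∧ g i ≤ N + h) →
      |∑ i ∈ s, H (g i)| ≤ h * B := by
    intro s g hs hg
    refine (Finset.abs_sum_le_sum_abs _ _).trans ((Finset.sum_le_card_nsmul _ _ B
      fun i hi => ?_).trans ?_)
    · simp only [hH]
      split_ifs
      · exact hB _ (hg i hi).1 (hg i hi).2
      · simpa using hB0
    · rw [nsmul_eq_mul]
      gcongr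
  have h3 := sum_Icc_one_add H h N
  rw [add_comm h N, sum_Icc_one_add H N h] at h3
  have h4 := h2 (Finset.Icc 1 h) (fun i => i) (by simp) (fun i hi => by
    rw [Finset.mem_Icc] at hi; omega)
  have h5 := h2 (Finset.Icc 1 h) (fun i => N + i) (by simp) (fun i hi => by
    rw [Finset.mem_Icc] at hi; omega)
  have h6 : apSum F q (a + h) N = ∑ n ∈ Finset.Icc 1 N, H n := rfl
  rw [h1, h6]
  rw [abs_le] at *
  constructor <;> linarith

/-- `∑ f(n)` over the `n ≤ N` in the class of `v` modulo `W` with `q ∣ n (n + h)`. -/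
noncomputable def classSum (f : ℕ → ℝ) (W v h q N : ℕ) : ℝ :=
  ∑ n ∈ Finset.Icc 1 N, if n % W = v % W ∧ q ∣ n * (n + h) then f n else 0

lemma dvd_add_iff_modEq {m n h : ℕ} (hm : 0 < m) : m ∣ n + h ↔ n ≡ m * h - h [MOD m] := by
  have h1 : m * h - h + h = m * h := Nat.sub_add_cancel (Nat.le_mul_of_pos_left h hm)
  constructor
  · intro h2
    refine Nat.ModEq.add_right_cancel' h ?_
    rw [h1]
    exact ((Nat.modEq_zero_iff_dvd.2 h2)).trans (Nat.modEq_zero_iff_dvd.2 (dvd_mul_right m h)).symm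
  · intro h2
    have h3 := Nat.ModEq.add_right h h2
    rw [h1] at h3
    exact Nat.modEq_zero_iff_dvd.1 (h3.trans (Nat.modEq_zero_iff_dvd.2 (dvd_mul_right m h)))

lemma exists_class {W v h q a b : ℕ} (hW : W.Coprime q) (hab : a * b = q) (hq : Squarefree q) :
    ∃ c, ∀ n, n % (W * q) = c % (W * q) ↔ n % W = v % W ∧ a ∣ n ∧ b ∣ n + h := by
  have hcop : a.Coprime b := by
    rw [← hab] at hq
    exact Nat.coprime_of_squarefree_mul hq
  have hb : 0 < b := by
    rcases Nat.eq_zero_or_pos b with rfl | hb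
    · simp only [mul_zero] at hab
      exact absurd hq (by simp [← hab])
    · exact hb
  obtain ⟨k₁, h1, h2⟩ := Nat.chineseRemainder hcop 0 (b * h - h)
  obtain ⟨k, h3, h4⟩ := Nat.chineseRemainder hW v k₁
  refine ⟨k, fun n => ?_⟩
  change n ≡ k [MOD W * q] ↔ n ≡ v [MOD W] ∧ _
  rw [← Nat.modEq_and_modEq_iff_modEq_mul hW, dvd_add_iff_modEq hb, ← Nat.modEq_zero_iff_dvd]
  have h5 : n ≡ k [MOD q] ↔ n ≡ k₁ [MOD a] ∧ n ≡ k₁ [MOD b] := by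
    rw [Nat.modEq_and_modEq_iff_modEq_mul hcop, hab]
    exact ⟨fun h => h.trans h4, fun h => h.trans h4.symm⟩
  rw [h5]
  exact ⟨fun ⟨x, y, z⟩ => ⟨x.trans h3, y.trans h1, z.trans h2⟩,
    fun ⟨x, y, z⟩ => ⟨x.trans h3.symm, y.trans h1.symm, z.trans h2.symm⟩⟩

lemma classSum_eq {W v h q : ℕ} (hW : W.Coprime q) (hh : h.Coprime q) (hq : Squarefree q) :
    ∃ c : ℕ × ℕ → ℕ, (∀ x ∈ q.divisorsAntidiagonal,
      c x % W = v % W ∧ x.1 ∣ c x ∧ x.2 ∣ c x + h) ∧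
      ∀ f N, classSum f W v h q N = ∑ x ∈ q.divisorsAntidiagonal, apSum f (W * q) (c x) N := by
  have hex : ∀ x : ℕ × ℕ, ∃ c, x ∈ q.divisorsAntidiagonal →
      ∀ n, n % (W * q) = c % (W * q) ↔ n % W = v % W ∧ x.1 ∣ n ∧ x.2 ∣ n + h := fun x => by
    by_cases hx : x ∈ q.divisorsAntidiagonal
    · obtain ⟨c, hc⟩ := exists_class (v := v) (h := h) hW (Nat.mem_divisorsAntidiagonal.1 hx).1 hq
      exact ⟨c, fun _ => hc⟩
    · exact ⟨0, fun h => absurd h hx⟩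
  choose c hc using hex
  refine ⟨c, fun x hx => (hc x hx (c x)).1 rfl, fun f N => ?_⟩
  unfold classSum apSum
  rw [Finset.sum_comm]
  refine Finset.sum_congr rfl fun n _ => ?_
  have huniq : ∀ x ∈ q.divisorsAntidiagonal, x.1 ∣ n → x.2 ∣ n + h → x.1 = q.gcd n := by
    intro x hx h1 h2
    have hx1 := (Nat.mem_divisorsAntidiagonal.1 hx).1
    have hcop : x.2.Coprime n := by
      have h3 : x.2.gcd n ∣ h := (Nat.dvd_add_right (Nat.gcd_dvd_right _ _)).1
        ((Nat.gcd_dvd_left _ _).trans h2)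
      have h4 : x.2.gcd n ∣ q := (Nat.gcd_dvd_left _ _).trans (hx1 ▸ dvd_mul_left _ _)
      exact Nat.dvd_one.1 (hh ▸ Nat.dvd_gcd h3 h4)
    rw [← hx1, hcop.gcd_mul_right_cancel]
    exact (Nat.gcd_eq_left h1).symm
  by_cases hP : n % W = v % W ∧ q ∣ n * (n + h)
  · rw [if_pos hP]
    have hg : 0 < q.gcd n := Nat.gcd_pos_of_pos_left n (Nat.pos_of_ne_zero hq.ne_zero)
    have hmem : (q.gcd n, q / q.gcd n) ∈ q.divisorsAntidiagonal := by
      rw [Nat.mem_divisorsAntidiagonal]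
      exact ⟨Nat.mul_div_cancel' (Nat.gcd_dvd_left q n), hq.ne_zero⟩
    have hdv : q / q.gcd n ∣ n + h := by
      refine (Nat.coprime_div_gcd_div_gcd hg).dvd_of_dvd_mul_left ?_
      rw [← Nat.mul_dvd_mul_iff_left hg, ← mul_assoc,
        Nat.mul_div_cancel' (Nat.gcd_dvd_left q n), Nat.mul_div_cancel' (Nat.gcd_dvd_right q n)]
      exact hP.2
    rw [Finset.sum_eq_single (q.gcd n, q / q.gcd n), if_pos]
    · exact (hc _ hmem n).2 ⟨hP.1, Nat.gcd_dvd_right q n, hdv⟩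
    · intro x hx hne
      refine if_neg fun h1 => hne ?_
      obtain ⟨-, h2, h3⟩ := (hc x hx n).1 h1
      have h4 := huniq x hx h2 h3
      refine Prod.ext h4 ?_
      have hx1 := (Nat.mem_divisorsAntidiagonal.1 hx).1
      rw [← h4]
      refine (Nat.div_eq_of_eq_mul_right (h4 ▸ hg) hx1.symm).symm
    · exact fun h => absurd hmem h
  · rw [if_neg hP]
    refine (Finset.sum_eq_zero fun x hx => if_neg fun h1 => hP ?_).symm
    obtain ⟨h2, h3, h4⟩ := (hc x hx n).1 h1
    exact ⟨h2, (Nat.mem_divisorsAntidiagonal.1 hx).1 ▸ mul_dvd_mul h3 h4⟩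

lemma squarefree_lcm {m n : ℕ} (hm : Squarefree m) (hn : Squarefree n) :
    Squarefree (m.lcm n) := by
  have hm0 := hm.ne_zero
  have hn0 := hn.ne_zero
  rw [Nat.squarefree_iff_factorization_le_one (Nat.lcm_ne_zero hm0 hn0)]
  intro p
  rw [Nat.factorization_lcm hm0 hn0, Finsupp.sup_apply]
  exact sup_le (hm.natFactorization_le_one p) (hn.natFactorization_le_one p)

/-- The sieve sum `∑ λ(d)` over the `d ∣ n (n + h)` in `sqfreeCoprime W M`. -/
noncomputable def sieveSum (lam : ℕ → ℝ) (W M h n : ℕ) : ℝ :=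
  ∑ d ∈ sqfreeCoprime W M, if d ∣ n * (n + h) then lam d else 0

lemma sum_mul_sieveSum_sq (lam f : ℕ → ℝ) (W M v h N : ℕ) :
    (∑ n ∈ Finset.Icc 1 N, if n % W = v % W then f n * sieveSum lam W M h n ^ 2 else 0) =
      ∑ d ∈ sqfreeCoprime W M, ∑ e ∈ sqfreeCoprime W M,
        lam d * lam e * classSum f W v h (d.lcm e) N := by
  have h1 : ∀ n, (if n % W = v % W then f n * sieveSum lam W M h n ^ 2 else 0) =
      ∑ d ∈ sqfreeCoprime W M, ∑ e ∈ sqfreeCoprime W M, lam d * lam e *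
        (if n % W = v % W ∧ d.lcm e ∣ n * (n + h) then f n else 0) := by
    intro n
    by_cases hn : n % W = v % W
    · simp only [hn, if_true, true_and, Nat.lcm_dvd_iff]
      rw [sq, sieveSum, Finset.sum_mul_sum, Finset.mul_sum]
      refine Finset.sum_congr rfl fun d _ => ?_
      rw [Finset.mul_sum]
      refine Finset.sum_congr rfl fun e _ => ?_
      by_cases hd : d ∣ n * (n + h) <;> by_cases he : e ∣ n * (n + h) <;> simp [hd, he]
      ring
    · simp [hn]
  simp only [h1, classSum, Finset.mul_sum]
  rw [Finset.sum_comm]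
  refine Finset.sum_congr rfl fun d _ => ?_
  rw [Finset.sum_comm]

lemma lcm_mem_sqfreeCoprime {W M d e : ℕ} (hd : d ∈ sqfreeCoprime W M)
    (he : e ∈ sqfreeCoprime W M) : d.lcm e ∈ sqfreeCoprime W (M * M) := by
  rw [mem_sqfreeCoprime] at *
  have h1 : d.lcm e ∣ d * e := Nat.lcm_dvd (dvd_mul_right d e) (dvd_mul_left e d)
  refine ⟨⟨Nat.lcm_pos hd.1.1 he.1.1, ?_⟩, squarefree_lcm hd.2.1 he.2.1, ?_⟩
  · exact (Nat.le_of_dvd (Nat.mul_pos hd.1.1 he.1.1) h1).trans (Nat.mul_le_mul hd.1.2 he.1.2)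
  · exact Nat.Coprime.coprime_dvd_left h1 (hd.2.2.mul_left he.2.2)

lemma sum_lcm_le (W M : ℕ) (Err : ℕ → ℝ) (h0 : ∀ q, 0 ≤ Err q) :
    ∑ d ∈ sqfreeCoprime W M, ∑ e ∈ sqfreeCoprime W M,
      (d.divisors.card : ℝ) ^ 2 * (e.divisors.card : ℝ) ^ 2 * Err (d.lcm e) ≤
    ∑ q ∈ sqfreeCoprime W (M * M), (q.divisors.card : ℝ) ^ 6 * Err q := by
  rw [← Finset.sum_product', ← Finset.sum_fiberwise_of_maps_to
    (t := sqfreeCoprime W (M * M)) (g := fun x : ℕ × ℕ => x.1.lcm x.2)]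
  · refine Finset.sum_le_sum fun q hq => ?_
    have hq0 : q ≠ 0 := by
      have := (mem_sqfreeCoprime.1 hq).1.1
      omega
    set F := ((sqfreeCoprime W M ×ˢ sqfreeCoprime W M).filter fun x => x.1.lcm x.2 = q) with hF
    have hsub : F ⊆ q.divisors ×ˢ q.divisors := fun x hx => by
      have h1 := (Finset.mem_filter.1 hx).2
      rw [Finset.mem_product, Nat.mem_divisors, Nat.mem_divisors]
      exact ⟨⟨h1 ▸ Nat.dvd_lcm_left _ _, hq0⟩, h1 ▸ Nat.dvd_lcm_right _ _, hq0⟩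
    have hcard : (F.card : ℝ) ≤ (q.divisors.card : ℝ) ^ 2 := by
      have := Finset.card_le_card hsub
      rw [Finset.card_product] at this
      rw [sq]
      exact_mod_cast this
    refine (Finset.sum_le_card_nsmul F _ ((q.divisors.card : ℝ) ^ 4 * Err q)
      fun x hx => ?_).trans ?_
    · have h1 := (Finset.mem_filter.1 hx).2
      have h2 := Finset.mem_product.1 (hsub hx)
      have h3 := Finset.card_le_card (Nat.divisors_subset_of_dvd hq0 (Nat.dvd_of_mem_divisors h2.1))
      have h4 := Finset.card_le_card (Nat.divisors_subset_of_dvd hq0 (Nat.dvd_of_mem_divisors h2.2))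
      rw [h1]
      refine mul_le_mul_of_nonneg_right ?_ (h0 q)
      calc (x.1.divisors.card : ℝ) ^ 2 * (x.2.divisors.card : ℝ) ^ 2
          ≤ (q.divisors.card : ℝ) ^ 2 * (q.divisors.card : ℝ) ^ 2 := by gcongr
        _ = _ := by ring
    · rw [nsmul_eq_mul]
      have h5 : 0 ≤ (q.divisors.card : ℝ) ^ 4 * Err q := mul_nonneg (by positivity) (h0 q)
      refine (mul_le_mul_of_nonneg_right hcard h5).trans (le_of_eq ?_)
      ring
  · intro x hx
    rw [Finset.mem_product] at hx
    exact lcm_mem_sqfreeCoprime hx.1 hx.2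

lemma abs_sum_mul_sieveSum_sq_sub_le (lam f g : ℕ → ℝ) (W M v h N : ℕ) (Λ X : ℝ)
    (hlam : ∀ d ∈ sqfreeCoprime W M, |lam d| ≤ (d.divisors.card : ℝ) ^ 2 * Λ)
    (Err : ℕ → ℝ) (h0 : ∀ q, 0 ≤ Err q)
    (hErr : ∀ q ∈ sqfreeCoprime W (M * M),
      |classSum f W v h q N - X * g q| ≤ q.divisors.card * Err q) :
    |(∑ n ∈ Finset.Icc 1 N, if n % W = v % W then f n * sieveSum lam W M h n ^ 2 else 0) -
      X * ∑ d ∈ sqfreeCoprime W M, ∑ e ∈ sqfreeCoprime W M, lam d * lam e * g (d.lcm e)| ≤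
    Λ ^ 2 * ∑ q ∈ Finset.Icc 1 (M * M), (q.divisors.card : ℝ) ^ 7 * Err q := by
  rw [sum_mul_sieveSum_sq, Finset.mul_sum, ← Finset.sum_sub_distrib]
  have h1 : ∀ d ∈ sqfreeCoprime W M,
      |∑ e ∈ sqfreeCoprime W M, lam d * lam e * classSum f W v h (d.lcm e) N -
        X * ∑ e ∈ sqfreeCoprime W M, lam d * lam e * g (d.lcm e)| ≤
      ∑ e ∈ sqfreeCoprime W M, Λ ^ 2 * ((d.divisors.card : ℝ) ^ 2 * (e.divisors.card : ℝ) ^ 2 *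
        ((d.lcm e).divisors.card * Err (d.lcm e))) := by
    intro d hd
    rw [Finset.mul_sum, ← Finset.sum_sub_distrib]
    refine (Finset.abs_sum_le_sum_abs _ _).trans (Finset.sum_le_sum fun e he => ?_)
    have h2 := hErr _ (lcm_mem_sqfreeCoprime hd he)
    have h3 := mul_le_mul (hlam d hd) (hlam e he) (abs_nonneg _)
      ((abs_nonneg _).trans (hlam d hd))
    have h4 := mul_le_mul h3 h2 (abs_nonneg _)
      ((mul_nonneg (abs_nonneg _) (abs_nonneg _)).trans h3)
    rw [← abs_mul, ← abs_mul] at h4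
    calc _ = |lam d * lam e * (classSum f W v h (d.lcm e) N - X * g (d.lcm e))| := by
          congr 1; ring
      _ ≤ _ := h4
      _ = _ := by ring
  refine (Finset.abs_sum_le_sum_abs _ _).trans ((Finset.sum_le_sum h1).trans ?_)
  simp only [← Finset.mul_sum]
  refine mul_le_mul_of_nonneg_left ?_ (sq_nonneg Λ)
  refine (sum_lcm_le W M (fun q => q.divisors.card * Err q)
    fun q => mul_nonneg (by positivity) (h0 q)).trans ?_
  refine (Finset.sum_le_sum_of_subset_of_nonneg (Finset.filter_subset _ _)
    fun q _ _ => mul_nonneg (by positivity) (mul_nonneg (by positivity) (h0 q))).trans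
    (le_of_eq (Finset.sum_congr rfl fun q _ => by ring))

/-- `f` has main term `X(N) g(q)` in the sums `classSum f W v h q N`, with an error that is
negligible on average over `q`. -/
def HasMain (η : ℝ) (W v h : ℕ) (f : ℕ → ℝ) (X : ℕ → ℝ) (g : ℕ → ℝ) : Prop :=
  ∃ E, SmallErr η E ∧ ∀ q N : ℕ, 2 ≤ N → Squarefree q → q.Coprime W →
    |classSum f W v h q N - X N * g q| ≤ q.divisors.card * E (W * q) N

lemma HasMain.sieve {η : ℝ} {W v h : ℕ} {f X g : ℕ → ℝ} (hW : 0 < W)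
    (H : HasMain η W v h f X g) (A : ℕ) :
    ∃ C > (0 : ℝ), ∀ (N M : ℕ) (lam : ℕ → ℝ) (Λ : ℝ), 2 ≤ N →
      ((W * (M * M) : ℕ) : ℝ) ≤ (N : ℝ) ^ η →
      (∀ d ∈ sqfreeCoprime W M, |lam d| ≤ (d.divisors.card : ℝ) ^ 2 * Λ) →
      |(∑ n ∈ Finset.Icc 1 N, if n % W = v % W then f n * sieveSum lam W M h n ^ 2 else 0) -
        X N * ∑ d ∈ sqfreeCoprime W M, ∑ e ∈ sqfreeCoprime W M, lam d * lam e * g (d.lcm e)| ≤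
      Λ ^ 2 * (C * N / Real.log N ^ A) := by
  obtain ⟨E, hE, hb⟩ := H
  obtain ⟨C, hC, hCb⟩ := hE.bound 7 A
  refine ⟨C, hC, fun N M lam Λ hN hM hlam => ?_⟩
  refine (abs_sum_mul_sieveSum_sq_sub_le lam f g W M v h N Λ (X N) hlam (fun q => E (W * q) N)
    (fun q => hE.nonneg _ _) fun q hq => ?_).trans ?_
  · rw [mem_sqfreeCoprime] at hq
    exact hb q N hN hq.2.1 hq.2.2
  · exact mul_le_mul_of_nonneg_left
      ((sum_mul_modulus_le hE.nonneg 7 W (M * M) N hW hM).trans (hCb N hN)) (sq_nonneg Λ)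

lemma card_divisorsAntidiagonal_eq (q : ℕ) : q.divisorsAntidiagonal.card = q.divisors.card := by
  rw [← Nat.map_div_right_divisors, Finset.card_map]

lemma coprime_of_primes_dvd {W h q : ℕ} (hh : ∀ p : ℕ, p.Prime → p ∣ h → p ∣ W)
    (hq : q.Coprime W) : h.Coprime q :=
  Nat.Coprime.symm <| Nat.Coprime.symm <| Nat.coprime_of_dvd fun p hp h1 h2 =>
    hp.one_lt.ne' (Nat.dvd_one.1 (hq ▸ Nat.dvd_gcd h2 (hh p hp h1)))

lemma hasMain_zero {η : ℝ} {W v h : ℕ} (hW : 0 < W) (hh : ∀ p : ℕ, p.Prime → p ∣ h → p ∣ W)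
    {f : ℕ → ℝ} {E : ℕ → ℕ → ℝ} (hE : SmallErr η E)
    (hf : ∀ q a N, 2 ≤ N → 0 < q → |apSum f q a N| ≤ E q N) :
    HasMain η W v h f (fun _ => 0) (fun _ => 0) := by
  refine ⟨E, hE, fun q N hN hq hqW => ?_⟩
  obtain ⟨c, -, hc⟩ := classSum_eq (v := v) hqW.symm (coprime_of_primes_dvd hh hqW) hq
  rw [hc, mul_zero, sub_zero]
  refine (Finset.abs_sum_le_sum_abs _ _).trans ((Finset.sum_le_card_nsmul _ _ (E (W * q) N)
    fun x _ => hf _ _ _ hN (Nat.mul_pos hW (Nat.pos_of_ne_zero hq.ne_zero))).trans ?_)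
  rw [nsmul_eq_mul, card_divisorsAntidiagonal_eq]

lemma hasMain_one {η : ℝ} (hη : η < 1) {W v h : ℕ} (hW : 0 < W)
    (hh : ∀ p : ℕ, p.Prime → p ∣ h → p ∣ W) :
    HasMain η W v h (fun _ => 1) (fun N => N / W) (primeProd fun p => 2 / (p : ℝ)) := by
  refine ⟨fun _ N => 2 * Real.log N, (SmallErr.log hη).mono
    (fun _ N => mul_nonneg zero_le_two (Real.log_natCast_nonneg N)) 2 two_pos
    (fun _ _ _ => le_rfl), fun q N hN hq hqW => ?_⟩
  obtain ⟨c, -, hc⟩ := classSum_eq (v := v) hqW.symm (coprime_of_primes_dvd hh hqW) hq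
  have h1 : (N : ℝ) / W * primeProd (fun p => 2 / (p : ℝ)) q =
      ∑ x ∈ q.divisorsAntidiagonal, (N : ℝ) / (W * q : ℕ) := by
    rw [Finset.sum_const, card_divisorsAntidiagonal_eq, nsmul_eq_mul, primeProd_two_div q hq]
    push_cast
    field_simp
  rw [hc, h1, ← Finset.sum_sub_distrib]
  refine (Finset.abs_sum_le_sum_abs _ _).trans ((Finset.sum_le_card_nsmul _ _ 1
    fun x _ => ?_).trans ?_)
  · have := abs_card_modEq_sub_le (W * q) (c x) N (Nat.mul_pos hW (Nat.pos_of_ne_zero hq.ne_zero))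
    simpa [apSum, Finset.sum_ite] using this
  · rw [nsmul_eq_mul, card_divisorsAntidiagonal_eq]
    have := half_le_log hN
    gcongr
    linarith

lemma abs_apSum_theta_le_log {q a N t : ℕ} (htq : t ∣ q) (hta : t ∣ a) (ht : t ≠ 1) :
    |apSum theta q a N| ≤ Real.log N := by
  have h1 : ∀ n ∈ Finset.Icc 1 N, (if n % q = a % q then theta n else 0) ≤
      if n = t then Real.log N else 0 := by
    intro n hn
    rw [Finset.mem_Icc] at hn
    have h0 : 0 ≤ if n = t then Real.log N else 0 := by
      split_ifs
      · exact Real.log_natCast_nonneg N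
      · exact le_rfl
    split_ifs with h2 h3 h3
    · exact (theta_le_log n).trans (log_le_log_of_le hn.1 hn.2)
    · have h4 : t ∣ n := (Nat.ModEq.dvd_iff (show n ≡ a [MOD q] from h2) htq).2 hta
      rw [theta, if_neg]
      intro hp
      rcases (Nat.dvd_prime hp).1 h4 with h5 | h5
      · exact ht h5
      · exact h3 h5.symm
    · exact Real.log_natCast_nonneg N
    · exact le_rfl
  rw [abs_of_nonneg]
  · refine (Finset.sum_le_sum h1).trans ?_
    rw [Finset.sum_ite_eq']
    split_ifs
    · exact le_rfl
    · exact Real.log_natCast_nonneg N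
  · exact Finset.sum_nonneg fun n _ => by
      split_ifs
      · exact theta_nonneg n
      · exact le_rfl

lemma abs_sum_sub_le_of_single {ι : Type*} (s : Finset ι) (F : ι → ℝ) (i : ι) (hi : i ∈ s)
    (X P L : ℝ) (hP : 0 ≤ P) (h1 : |F i - X| ≤ P + L)
    (h2 : ∀ j ∈ s, j ≠ i → |F j| ≤ L) : |∑ j ∈ s, F j - X| ≤ s.card * (P + L) := by
  classical
  have h3 : ∑ j ∈ s, F j - X = ∑ j ∈ s, (F j - if j = i then X else 0) := by
    rw [Finset.sum_sub_distrib, Finset.sum_ite_eq' s i, if_pos hi]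
  rw [h3]
  refine (Finset.abs_sum_le_sum_abs _ _).trans ((Finset.sum_le_card_nsmul _ _ (P + L)
    fun j hj => ?_).trans (le_of_eq (nsmul_eq_mul _ _)))
  split_ifs with h
  · rw [h]; exact h1
  · rw [sub_zero]
    linarith [h2 j hj h]

lemma primeProd_totient {q : ℕ} (hq : Squarefree q) :
    primeProd (fun p => 1 / ((p : ℝ) - 1)) q = 1 / q.totient := by
  have h1 : ∀ p ∈ q.primeFactors, ((p : ℝ) - 1) = ((p - 1 : ℕ) : ℝ) := fun p hp => by
    rw [Nat.cast_sub (Nat.prime_of_mem_primeFactors hp).one_le, Nat.cast_one]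
  have h2 : q.totient = ∏ p ∈ q.primeFactors, (p - 1) := by
    have h3 := Nat.totient_mul_prod_primeFactors q
    rw [Nat.prod_primeFactors_of_squarefree hq, mul_comm] at h3
    exact Nat.eq_of_mul_eq_mul_left (Nat.pos_of_ne_zero hq.ne_zero) h3
  rw [h2, Nat.cast_prod, primeProd, Finset.prod_div_distrib, Finset.prod_const_one,
    Finset.prod_congr rfl h1]

lemma coprime_class {W v q a n : ℕ} (hv : v.Coprime W) (hn : n % W = v % W)
    (hq : n.Coprime q) (ha : a = W * q) : n.Coprime a := by
  rw [ha]
  refine Nat.Coprime.mul_right ?_ hq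
  have : n.gcd W = v.gcd W := Nat.ModEq.gcd_eq (show n ≡ v [MOD W] from hn)
  exact this.trans hv

lemma hasMain_theta {η ϑ : ℝ} (hη : η < 1) (hϑ : η < ϑ) (hP : PrimesLevel ϑ) {W v h : ℕ}
    (hh : ∀ p : ℕ, p.Prime → p ∣ h → p ∣ W) (hv : v.Coprime W) :
    HasMain η W v h theta (fun N => N / W.totient) (primeProd fun p => 1 / ((p : ℝ) - 1)) := by
  refine ⟨fun q N => primeMaxAbs q N + Real.log N,
    (smallErr_primeMaxAbs hP hϑ hη.le).add (SmallErr.log hη), fun q N hN hq hqW => ?_⟩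
  have hcop := coprime_of_primes_dvd hh hqW
  obtain ⟨c, hc1, hc⟩ := classSum_eq (v := v) hqW.symm hcop hq
  have hmem : (1, q) ∈ q.divisorsAntidiagonal := by
    simp [hq.ne_zero]
  have hX : (N : ℝ) / W.totient * primeProd (fun p => 1 / ((p : ℝ) - 1)) q =
      N / (W * q).totient := by
    rw [primeProd_totient hq, Nat.totient_mul hqW.symm]
    push_cast
    field_simp
  rw [hc, hX, ← card_divisorsAntidiagonal_eq]
  refine abs_sum_sub_le_of_single _ _ (1, q) hmem _ _ _ (primeMaxAbs_nonneg _ _) ?_ ?_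
  · obtain ⟨h1, -, h2⟩ := hc1 _ hmem
    have h3 : (c (1, q)).Coprime q := by
      have h4 : (c (1, q)).gcd q ∣ h :=
        (Nat.dvd_add_right (Nat.gcd_dvd_left _ _)).1 ((Nat.gcd_dvd_right _ _).trans h2)
      exact Nat.dvd_one.1 ((Nat.dvd_gcd h4 (Nat.gcd_dvd_right _ _)).trans (dvd_of_eq hcop))
    have := abs_apSum_theta_sub_le (W * q) _ N (coprime_class hv h1 h3 rfl)
    linarith [Real.log_natCast_nonneg N]
  · intro x hx hne
    have hx1 := (Nat.mem_divisorsAntidiagonal.1 hx).1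
    refine abs_apSum_theta_le_log (t := x.1) ?_ (hc1 x hx).2.1 fun h1 => hne ?_
    · exact (hx1 ▸ dvd_mul_right x.1 x.2).trans (dvd_mul_left q W)
    · rw [h1, one_mul] at hx1
      exact Prod.ext h1 hx1

lemma log_add_le {N : ℕ} (hN : 2 ≤ N) (h : ℕ) :
    Real.log ((N + h : ℕ) : ℝ) ≤ (1 + 2 * h) * Real.log N := by
  have h1 := half_le_log hN
  have hN0 : (0 : ℝ) < N := by exact_mod_cast (by omega : 0 < N)
  have hN1 : (1 : ℝ) ≤ N := by exact_mod_cast (by omega : 1 ≤ N)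
  have h2 : Real.log ((N + h : ℕ) : ℝ) ≤ Real.log (N * (1 + h)) := by
    refine Real.log_le_log (by positivity) ?_
    push_cast
    nlinarith [(Nat.cast_nonneg h : (0 : ℝ) ≤ h)]
  rw [Real.log_mul hN0.ne' (by positivity)] at h2
  have h3 : Real.log (1 + h) ≤ h := by
    have := Real.log_le_sub_one_of_pos (by positivity : (0 : ℝ) < 1 + h)
    linarith
  nlinarith [(Nat.cast_nonneg h : (0 : ℝ) ≤ h)]

lemma abs_theta_le {n N : ℕ} (hn : 1 ≤ n) (h : n ≤ N) : |theta n| ≤ Real.log N := by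
  rw [abs_of_nonneg (theta_nonneg n)]
  exact (theta_le_log n).trans (log_le_log_of_le hn h)

lemma hasMain_theta_shift {η ϑ : ℝ} (hη : η < 1) (hϑ : η < ϑ) (hP : PrimesLevel ϑ) {W v h : ℕ}
    (hh : ∀ p : ℕ, p.Prime → p ∣ h → p ∣ W) (hv : (v + h).Coprime W) :
    HasMain η W v h (fun n => theta (n + h)) (fun N => N / W.totient)
      (primeProd fun p => 1 / ((p : ℝ) - 1)) := by
  have hlogE := (SmallErr.log hη).mono (E' := fun _ N => Real.log N +
    2 * h * Real.log ((N + h : ℕ) : ℝ)) (fun _ N => by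
      have := Real.log_natCast_nonneg N
      have := Real.log_natCast_nonneg (N + h)
      positivity) (1 + 2 * h * (1 + 2 * h)) (by positivity) fun _ N hN => by
      have := mul_le_mul_of_nonneg_left (log_add_le hN h) (by positivity : (0 : ℝ) ≤ 2 * h)
      linarith
  refine ⟨_, (smallErr_primeMaxAbs hP hϑ hη.le).add hlogE, fun q N hN hq hqW => ?_⟩
  have hcop := coprime_of_primes_dvd hh hqW
  obtain ⟨c, hc1, hc⟩ := classSum_eq (v := v) hqW.symm hcop hq
  have hmem : (q, 1) ∈ q.divisorsAntidiagonal := by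
    simp [hq.ne_zero]
  have hX : (N : ℝ) / W.totient * primeProd (fun p => 1 / ((p : ℝ) - 1)) q =
      N / (W * q).totient := by
    rw [primeProd_totient hq, Nat.totient_mul hqW.symm]
    push_cast
    field_simp
  have hshift : ∀ a, |apSum (fun n => theta (n + h)) (W * q) a N -
      apSum theta (W * q) (a + h) N| ≤ 2 * h * Real.log ((N + h : ℕ) : ℝ) := fun a =>
    apSum_shift theta _ (W * q) a h N _ (Real.log_natCast_nonneg _) (fun _ _ => rfl)
      fun n hn hnN => abs_theta_le hn hnN
  rw [hc, hX, ← card_divisorsAntidiagonal_eq]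
  refine abs_sum_sub_le_of_single _ _ (q, 1) hmem _ _ _ (primeMaxAbs_nonneg _ _) ?_ ?_
  · obtain ⟨h1, h2, -⟩ := hc1 _ hmem
    have h3 : (c (q, 1) + h).Coprime q := by
      have h4 : (c (q, 1) + h).gcd q ∣ h :=
        (Nat.dvd_add_right ((Nat.gcd_dvd_right _ _).trans h2)).1 (Nat.gcd_dvd_left _ _)
      exact Nat.dvd_one.1 ((Nat.dvd_gcd h4 (Nat.gcd_dvd_right _ _)).trans (dvd_of_eq hcop))
    have h5 := abs_apSum_theta_sub_le (W * q) _ N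
      (coprime_class hv (Nat.ModEq.add_right h (show c (q, 1) ≡ v [MOD W] from h1)) h3 rfl)
    have h6 := hshift (c (q, 1))
    have h7 := Real.log_natCast_nonneg N
    rw [abs_le] at *
    constructor <;> linarith
  · intro x hx hne
    have hx1 := (Nat.mem_divisorsAntidiagonal.1 hx).1
    have h5 : |apSum theta (W * q) (c x + h) N| ≤ Real.log N := by
      refine abs_apSum_theta_le_log (t := x.2) ?_ (hc1 x hx).2.2 fun h1 => hne ?_
      · exact (hx1 ▸ dvd_mul_left x.2 x.1).trans (dvd_mul_left q W)
      · rw [h1, mul_one] at hx1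
        exact Prod.ext hx1 h1
    have h6 := hshift (c x)
    rw [abs_le] at *
    constructor <;> linarith

lemma one_le_two_mul_log {N : ℕ} (hN : 2 ≤ N) : 1 ≤ 2 * Real.log N := by
  linarith [half_le_log hN]

lemma hasMain_of_level {η ϑ : ℝ} (hη : η < 1) (hϑ : η < ϑ) {W v h : ℕ} (hW : 0 < W)
    (hh : ∀ p : ℕ, p.Prime → p ∣ h → p ∣ W) {f : ℕ → ℝ} (hf : HasLevel f ϑ)
    (hb : ∀ n, 1 ≤ n → |f n| ≤ 1 + Real.log n) :
    HasMain η W v h f (fun _ => 0) (fun _ => 0) :=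
  hasMain_zero hW hh (smallErr_maxAbs hf hϑ hη.le hb) fun q a N _ _ => abs_apSum_le_maxAbs f q a N

lemma hasMain_of_level_shift {η ϑ : ℝ} (hη : η < 1) (hϑ : η < ϑ) {W v h : ℕ} (hW : 0 < W)
    (hh : ∀ p : ℕ, p.Prime → p ∣ h → p ∣ W) {F G : ℕ → ℝ} (hF : HasLevel F ϑ)
    (hb : ∀ n, 1 ≤ n → |F n| ≤ 1 + Real.log n) (hFG : ∀ n, 1 ≤ n → G n = F (n + h)) :
    HasMain η W v h G (fun _ => 0) (fun _ => 0) := by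
  have hlogE := (SmallErr.log hη).mono (E' := fun _ N =>
    2 * h * (1 + Real.log ((N + h : ℕ) : ℝ))) (fun _ N => by
      have := Real.log_natCast_nonneg (N + h)
      positivity) (1 + 2 * h * (3 + 2 * h)) (by positivity) fun _ N hN => by
      have h1 := one_le_two_mul_log hN
      have := mul_le_mul_of_nonneg_left (add_le_add h1 (log_add_le hN h))
        (by positivity : (0 : ℝ) ≤ 2 * h)
      linarith
  refine hasMain_zero hW hh ((smallErr_maxAbs hF hϑ hη.le hb).add hlogE) fun q a N _ _ => ?_
  have h1 := apSum_shift F G q a h N (1 + Real.log ((N + h : ℕ) : ℝ))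
    (by have := Real.log_natCast_nonneg (N + h); positivity) hFG fun n hn hnN =>
      (hb n hn).trans (by linarith [log_le_log_of_le hn hnN])
  have h2 := abs_apSum_le_maxAbs F q (a + h) N
  rw [abs_le] at *
  constructor <;> linarith

lemma card_divisors_prime_mul {p q : ℕ} (hp : p.Prime) (hq : q.Prime) :
    (p * q).divisors.card ≤ 4 := by
  refine (card_divisors_mul_le p q).trans ?_
  rw [hp.divisors, hq.divisors]
  exact Nat.mul_le_mul (Finset.card_le_two) (Finset.card_le_two)

lemma sieveSum_sq_le_of_prime {lam : ℕ → ℝ} {W M h n : ℕ} {Λ : ℝ} (hΛ : 0 ≤ Λ)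
    (hlam : ∀ d ∈ sqfreeCoprime W M, |lam d| ≤ (d.divisors.card : ℝ) ^ 2 * Λ)
    (hn : n.Prime) (hn' : (n + h).Prime) : sieveSum lam W M h n ^ 2 ≤ 4096 * Λ ^ 2 := by
  have h0 : n * (n + h) ≠ 0 := Nat.mul_ne_zero hn.ne_zero hn'.ne_zero
  have h1 : |sieveSum lam W M h n| ≤ 64 * Λ := by
    rw [sieveSum, ← Finset.sum_filter]
    refine (Finset.abs_sum_le_sum_abs _ _).trans ((Finset.sum_le_card_nsmul _ _ (16 * Λ)
      fun d hd => ?_).trans ?_)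
    · rw [Finset.mem_filter] at hd
      refine (hlam d hd.1).trans ?_
      have h2 : d.divisors.card ≤ 4 := (Finset.card_le_card
        (Nat.divisors_subset_of_dvd h0 hd.2)).trans (card_divisors_prime_mul hn hn')
      have h3 : (d.divisors.card : ℝ) ≤ 4 := by exact_mod_cast h2
      have h4 : (d.divisors.card : ℝ) ^ 2 ≤ 16 := by nlinarith [Nat.cast_nonneg (α := ℝ) d.divisors.card]
      exact mul_le_mul_of_nonneg_right h4 hΛ
    · have h5 : ((sqfreeCoprime W M).filter fun d => d ∣ n * (n + h)).card ≤ 4 := by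
        refine (Finset.card_le_card fun d hd => ?_).trans (card_divisors_prime_mul hn hn')
        exact Nat.mem_divisors.2 ⟨(Finset.mem_filter.1 hd).2, h0⟩
      have h6 : (((sqfreeCoprime W M).filter fun d => d ∣ n * (n + h)).card : ℝ) ≤ 4 := by
        exact_mod_cast h5
      rw [nsmul_eq_mul]
      nlinarith
  have h2 := sq_le_sq' (by linarith [neg_abs_le (sieveSum lam W M h n)])
    ((le_abs_self _).trans h1)
  linarith

lemma lio_mul_theta (n : ℕ) : lio n * theta n = -theta n := by
  unfold theta
  split_ifs with hp
  · simp [lio, Nat.primeFactorsList_prime hp]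
  · simp

lemma lio_le_one (n : ℕ) : lio n ≤ 1 := (le_abs_self _).trans (abs_lio n).le

lemma neg_one_le_lio (n : ℕ) : -1 ≤ lio n := (abs_le.1 (abs_lio n).le).1

lemma detector_le {lam : ℕ → ℝ} {W M h n N : ℕ} {Λ : ℝ} (hΛ : 0 ≤ Λ)
    (hlam : ∀ d ∈ sqfreeCoprime W M, |lam d| ≤ (d.divisors.card : ℝ) ^ 2 * Λ)
    (h1 : 1 ≤ n) (hN : n ≤ N) :
    (1 - lio n) * (1 - lio (n + h)) * (theta n + theta (n + h) - Real.log ((N + h : ℕ) : ℝ)) *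
      sieveSum lam W M h n ^ 2 ≤
    if n.Prime ∧ (n + h).Prime then 16384 * Real.log ((N + h : ℕ) : ℝ) * Λ ^ 2 else 0 := by
  have ha : 0 ≤ (1 - lio n) * (1 - lio (n + h)) :=
    mul_nonneg (by linarith [lio_le_one n]) (by linarith [lio_le_one (n + h)])
  have ha4 : (1 - lio n) * (1 - lio (n + h)) ≤ 4 := by
    nlinarith [lio_le_one n, lio_le_one (n + h), neg_one_le_lio n, neg_one_le_lio (n + h)]
  have hθ1 : theta n ≤ Real.log ((N + h : ℕ) : ℝ) :=
    (theta_le_log n).trans (log_le_log_of_le h1 (by omega))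
  have hθ2 : theta (n + h) ≤ Real.log ((N + h : ℕ) : ℝ) :=
    (theta_le_log (n + h)).trans (log_le_log_of_le (by omega) (by omega))
  split_ifs with hp
  · have h2 := sieveSum_sq_le_of_prime hΛ hlam hp.1 hp.2
    have h3 := Real.log_natCast_nonneg (N + h)
    calc _ ≤ (1 - lio n) * (1 - lio (n + h)) * Real.log ((N + h : ℕ) : ℝ) *
          sieveSum lam W M h n ^ 2 := by
            gcongr
            linarith
      _ ≤ 4 * Real.log ((N + h : ℕ) : ℝ) * (4096 * Λ ^ 2) := by gcongr
      _ = _ := by ring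
  · refine mul_nonpos_of_nonpos_of_nonneg (mul_nonpos_of_nonneg_of_nonpos ha ?_) (sq_nonneg _)
    rcases not_and_or.1 hp with h2 | h2
    · have : theta n = 0 := if_neg h2
      linarith
    · have : theta (n + h) = 0 := if_neg h2
      linarith

/-- The sum of `f` over the `n ≤ N` in the class of `v`, weighted by the squared sieve sum. -/
noncomputable def weightedSum (lam : ℕ → ℝ) (W M v h N : ℕ) (f : ℕ → ℝ) : ℝ :=
  ∑ n ∈ Finset.Icc 1 N, if n % W = v % W then f n * sieveSum lam W M h n ^ 2 else 0

lemma weightedSum_le_pairs {lam : ℕ → ℝ} {W M v h N : ℕ} {Λ : ℝ} (hΛ : 0 ≤ Λ)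
    (hlam : ∀ d ∈ sqfreeCoprime W M, |lam d| ≤ (d.divisors.card : ℝ) ^ 2 * Λ) :
    2 * weightedSum lam W M v h N theta - 2 * weightedSum lam W M v h N
        (fun n => theta n * lio (n + h)) +
      2 * weightedSum lam W M v h N (fun n => theta (n + h)) -
      2 * weightedSum lam W M v h N (fun n => theta (n + h) * lio n) -
      Real.log ((N + h : ℕ) : ℝ) * (weightedSum lam W M v h N (fun _ => 1) -
        weightedSum lam W M v h N lio - weightedSum lam W M v h N (fun n => lio (n + h)) +
        weightedSum lam W M v h N (fun n => lio n * lio (n + h))) ≤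
    16384 * Real.log ((N + h : ℕ) : ℝ) * Λ ^ 2 *
      (((Finset.Icc 1 N).filter fun n => n % W = v % W ∧ n.Prime ∧ (n + h).Prime).card : ℝ) := by
  have h1 : (((Finset.Icc 1 N).filter fun n =>
      n % W = v % W ∧ n.Prime ∧ (n + h).Prime).card : ℝ) =
      ∑ n ∈ Finset.Icc 1 N, if n % W = v % W ∧ n.Prime ∧ (n + h).Prime then (1 : ℝ) else 0 := by
    rw [Finset.sum_boole]
  rw [h1]
  unfold weightedSum
  simp only [Finset.mul_sum, ← Finset.sum_sub_distrib, ← Finset.sum_add_distrib]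
  refine Finset.sum_le_sum fun n hn => ?_
  rw [Finset.mem_Icc] at hn
  by_cases hv : n % W = v % W
  · have h2 := detector_le (h := h) hΛ hlam hn.1 hn.2
    have h3 := lio_mul_theta n
    have h4 := lio_mul_theta (n + h)
    simp only [hv, true_and, if_true]
    refine le_trans (le_of_eq ?_) (h2.trans (le_of_eq ?_))
    · linear_combination ((1 - lio (n + h)) * sieveSum lam W M h n ^ 2) * h3 +
        ((1 - lio n) * sieveSum lam W M h n ^ 2) * h4
    · split_ifs <;> simp
  · simp [hv]

lemma log_add_le_add {N : ℕ} (hN : 1 ≤ N) (h : ℕ) :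
    Real.log ((N + h : ℕ) : ℝ) ≤ Real.log N + h := by
  have hN0 : (0 : ℝ) < N := by exact_mod_cast hN
  have hN1 : (1 : ℝ) ≤ N := by exact_mod_cast hN
  have h2 : Real.log ((N + h : ℕ) : ℝ) ≤ Real.log (N * (1 + h)) := by
    refine Real.log_le_log (by positivity) ?_
    push_cast
    nlinarith [(Nat.cast_nonneg h : (0 : ℝ) ≤ h)]
  rw [Real.log_mul hN0.ne' (by positivity)] at h2
  have h3 := Real.log_le_sub_one_of_pos (by positivity : (0 : ℝ) < 1 + h)
  linarith

lemma sieve_constants {κ W L ℓ N LN h S₁ S₂ Λ C P K e : ℝ} (hκ : 0 < κ) (hκ1 : κ ≤ 1)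
    (hW : 0 < W) (hLℓ : L = 0.3641 * ℓ) (hℓ : 1 ≤ ℓ) (hN : 0 < N) (hLN0 : 0 ≤ LN)
    (hLN : LN ≤ ℓ + h) (he0 : 0 < e) (he : e ≤ 1.00041)
    (h1 : κ ^ 3 * L ^ 3 * (31 / 120) - K * L ^ 2 ≤ S₂)
    (h2 : S₁ ≤ e * (κ ^ 2 * L ^ 2 * (3 / 8) + K * L)) (hΛ0 : 0 ≤ Λ)
    (h3 : Λ ≤ 2 * S₁) (h4 : K ≤ 1e-5 * κ ^ 3 * L) (h5 : h ≤ 1e-5 * ℓ) (hC : 0 < C)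
    (h7 : 13 * C * W ≤ 5e-4 * κ ^ 2 * L ^ 3)
    (hlow : 4 * (N / (W * κ)) * S₂ - LN * (N / W) * S₁ -
      (8 + 4 * LN) * (Λ ^ 2 * (C * N / ℓ ^ 5)) ≤ 16384 * LN * Λ ^ 2 * P) (hP : 0 ≤ P) :
    4e-8 * N / (W * κ ^ 2 * ℓ ^ 2) ≤ P := by
  have hℓ0 : 0 < ℓ := by linarith
  have hL : 0 < L := by rw [hLℓ]; positivity
  have hLle : L ≤ ℓ := by rw [hLℓ]; linarith
  have hκ3 : κ ^ 3 ≤ κ ^ 2 := pow_le_pow_of_le_one hκ.le hκ1 (by norm_num)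
  have hS1 : S₁ ≤ 0.3752 * (κ ^ 2 * L ^ 2) := by
    have a1 : K * L ≤ 1e-5 * (κ ^ 2 * L ^ 2) := by
      calc K * L ≤ 1e-5 * κ ^ 3 * L * L := mul_le_mul_of_nonneg_right h4 hL.le
        _ = 1e-5 * (κ ^ 3 * L ^ 2) := by ring
        _ ≤ _ := by gcongr
    have a2 : κ ^ 2 * L ^ 2 * (3 / 8) + K * L ≤ 0.37501 * (κ ^ 2 * L ^ 2) := by linarith
    calc S₁ ≤ e * (0.37501 * (κ ^ 2 * L ^ 2)) := h2.trans (mul_le_mul_of_nonneg_left a2 he0.le)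
      _ ≤ 1.00041 * (0.37501 * (κ ^ 2 * L ^ 2)) := by gcongr
      _ ≤ _ := by
        have : 0 ≤ κ ^ 2 * L ^ 2 := by positivity
        linarith
  have hΛ : Λ ≤ κ ^ 2 * L ^ 2 := by
    have : 0 ≤ κ ^ 2 * L ^ 2 := by positivity
    linarith
  have hΛ2 : Λ ^ 2 ≤ κ ^ 4 * L ^ 4 := by
    calc Λ ^ 2 ≤ (κ ^ 2 * L ^ 2) ^ 2 := by gcongr
      _ = _ := by ring
  have hLN' : LN ≤ 2.7466 * L := by rw [hLℓ]; linarith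
  set Q : ℝ := N / W * (κ ^ 2 * L ^ 3) with hQ
  have hQ0 : 0 < Q := by positivity
  have b1 : 1.0332 * Q ≤ 4 * (N / (W * κ)) * S₂ := by
    have a1 : κ ^ 3 * L ^ 3 * 0.2583 ≤ S₂ := by
      have : K * L ^ 2 ≤ 1e-5 * (κ ^ 3 * L ^ 3) := by
        calc K * L ^ 2 ≤ 1e-5 * κ ^ 3 * L * L ^ 2 := mul_le_mul_of_nonneg_right h4 (by positivity)
          _ = _ := by ring
      have a0 : 0 ≤ κ ^ 3 * L ^ 3 := by positivity
      linarith
    calc 1.0332 * Q = 4 * (N / (W * κ)) * (κ ^ 3 * L ^ 3 * 0.2583) := by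
          rw [hQ]; field_simp; ring
      _ ≤ _ := by gcongr
  have b2 : LN * (N / W) * S₁ ≤ 1.0306 * Q := by
    calc LN * (N / W) * S₁ ≤ LN * (N / W) * (0.3752 * (κ ^ 2 * L ^ 2)) := by gcongr
      _ ≤ 2.7466 * L * (N / W) * (0.3752 * (κ ^ 2 * L ^ 2)) := by gcongr
      _ = (2.7466 * 0.3752) * Q := by rw [hQ]; ring
      _ ≤ _ := by gcongr; norm_num
  have b3 : (8 + 4 * LN) * (Λ ^ 2 * (C * N / ℓ ^ 5)) ≤ 5e-4 * Q := by
    have a1 : 8 + 4 * LN ≤ 13 * ℓ := by linarith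
    have a2 : Λ ^ 2 ≤ ℓ ^ 4 := by
      calc Λ ^ 2 ≤ κ ^ 4 * L ^ 4 := hΛ2
        _ ≤ 1 * ℓ ^ 4 := by
          gcongr
          exact pow_le_one₀ hκ.le hκ1
        _ = _ := one_mul _
    calc _ ≤ 13 * ℓ * (ℓ ^ 4 * (C * N / ℓ ^ 5)) := by gcongr
      _ = N / W * (13 * C * W) := by field_simp
      _ ≤ N / W * (5e-4 * κ ^ 2 * L ^ 3) := by gcongr
      _ = _ := by rw [hQ]; ring
  have b4 : 16384 * LN * Λ ^ 2 * P ≤ 45001 * L * (κ ^ 4 * L ^ 4) * P := by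
    calc _ ≤ 16384 * (2.7466 * L) * (κ ^ 4 * L ^ 4) * P := by gcongr
      _ = (16384 * 2.7466) * L * (κ ^ 4 * L ^ 4) * P := by ring
      _ ≤ _ := by gcongr; norm_num
  have b5 : 2e-3 * Q ≤ 45001 * L * (κ ^ 4 * L ^ 4) * P := by linarith
  have b6 : 2e-3 * Q = (2e-3 * (N / W)) * (κ ^ 2 * L ^ 3) := by rw [hQ]; ring
  have b7 : 45001 * L * (κ ^ 4 * L ^ 4) * P = 45001 * (κ ^ 2 * L ^ 2 * P) * (κ ^ 2 * L ^ 3) := by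
    ring
  rw [b6, b7] at b5
  have b8 := le_of_mul_le_mul_right b5 (by positivity)
  rw [div_le_iff₀ (by positivity)]
  have b9 : N = N / W * W := by field_simp
  have b10 : κ ^ 2 * L ^ 2 * P ≤ κ ^ 2 * ℓ ^ 2 * P := by gcongr
  have b11 : 2e-3 * (N / W) ≤ 45001 * (κ ^ 2 * ℓ ^ 2 * P) := by linarith
  have b12 := mul_le_mul_of_nonneg_right b11 hW.le
  have b13 : 2e-3 * (N / W) * W = 2e-3 * N := by field_simp
  rw [b13] at b12
  linarith

lemma exp_four_div_le {D : ℕ} (hD : 10000 ≤ D) : Real.exp (4 / ((D : ℝ) - 1)) ≤ 1.00041 := by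
  have h1 : (10000 : ℝ) ≤ D := by exact_mod_cast hD
  have h2 : 4 / ((D : ℝ) - 1) ≤ 4.001e-4 := by
    rw [div_le_iff₀ (by linarith)]
    linarith
  have h3 : |(4.001e-4 : ℝ)| ≤ 1 := by norm_num [abs_of_pos]
  have h4 := (abs_le.1 (Real.abs_exp_sub_one_sub_id_le h3)).2
  refine (Real.exp_le_exp.2 h2).trans ?_
  norm_num at h4 ⊢
  linarith

lemma sieveWeight_one_le (W M : ℕ) (h2W : 2 ∣ W) (L : ℝ) :
    0 ≤ sieveWeight W M (ySeq L) 1 ∧ sieveWeight W M (ySeq L) 1 ≤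
      2 * ∑ s ∈ sqfreeCoprime W M, primeProd (fun p => 2 / ((p : ℝ) - 2)) s * ySeq L s ^ 2 := by
  have h1 : sieveWeight W M (ySeq L) 1 =
      ∑ s ∈ sqfreeCoprime W M, primeProd (fun p => 2 / ((p : ℝ) - 2)) s * ySeq L s := by
    simp [sieveWeight, primeProd_one]
  have h2 : ∀ s ∈ sqfreeCoprime W M, 0 ≤ primeProd (fun p => 2 / ((p : ℝ) - 2)) s :=
    fun s hs => primeProd_nonneg fun p hp => by
      have : (2 : ℝ) < p := by exact_mod_cast two_lt_of_mem_primeFactors h2W hs hp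
      exact div_nonneg zero_le_two (by linarith)
  rw [h1]
  refine ⟨Finset.sum_nonneg fun s hs => mul_nonneg (h2 s hs) (ySeq_nonneg L s), ?_⟩
  rw [Finset.mul_sum]
  refine Finset.sum_le_sum fun s hs => ?_
  have := mul_le_mul_of_nonneg_left (ySeq_le_two_mul_sq L s) (h2 s hs)
  linarith

lemma abs_lio_le (n : ℕ) (x : ℝ) (hx : 0 ≤ x) : |lio n| ≤ 1 + x := by
  rw [abs_lio]; linarith

lemma abs_theta_mul_lio_le (n m : ℕ) : |theta n * lio m| ≤ 1 + Real.log n := by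
  rw [abs_mul, abs_lio, mul_one, abs_of_nonneg (theta_nonneg n)]
  linarith [theta_le_log n]

lemma eventually_pairs_class {ϑ : ℝ} (hϑ : 0.7284 ≤ ϑ) {h : ℕ} (H : HypD ϑ h) {W v D : ℕ}
    (hW : 0 < W) (hD : 10000 ≤ D) (hDW : ∀ p : ℕ, p.Prime → p ≤ D → p ∣ W)
    (hh : ∀ p : ℕ, p.Prime → p ∣ h → p ∣ W) (hv : v.Coprime W) (hv' : (v + h).Coprime W) :
    ∀ᶠ N : ℕ in atTop, 4e-8 * N / (W * (W.totient / W : ℝ) ^ 2 * Real.log N ^ 2) ≤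
      (((Finset.Icc 1 N).filter fun n => n % W = v % W ∧ n.Prime ∧ (n + h).Prime).card : ℝ) := by
  obtain ⟨hP, H1, H2, H3, H4⟩ := H
  have h2W : 2 ∣ W := hDW 2 Nat.prime_two (by omega)
  have hη : (0.7283 : ℝ) < 1 := by norm_num
  have hηϑ : 0.7283 < ϑ := by linarith
  obtain ⟨C₁, hC₁, e₁⟩ := (hasMain_one (v := v) hη hW hh).sieve hW 5
  obtain ⟨C₂, hC₂, e₂⟩ := (hasMain_theta hη hηϑ hP hh hv).sieve hW 5
  obtain ⟨C₃, hC₃, e₃⟩ := (hasMain_theta_shift hη hηϑ hP hh hv').sieve hW 5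
  obtain ⟨C₄, hC₄, e₄⟩ := (hasMain_of_level (v := v) hη hηϑ hW hh H1
    fun n _ => abs_lio_le n _ (Real.log_natCast_nonneg n)).sieve hW 5
  obtain ⟨C₅, hC₅, e₅⟩ := (hasMain_of_level_shift (v := v) (G := fun n => lio (n + h))
    hη hηϑ hW hh H1 (fun n _ => abs_lio_le n _ (Real.log_natCast_nonneg n))
    fun _ _ => rfl).sieve hW 5
  obtain ⟨C₆, hC₆, e₆⟩ := (hasMain_of_level (v := v) hη hηϑ hW hh H2 fun n _ => by
    rw [abs_mul, abs_lio, abs_lio, mul_one]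
    linarith [Real.log_natCast_nonneg n]).sieve hW 5
  obtain ⟨C₇, hC₇, e₇⟩ := (hasMain_of_level (v := v) hη hηϑ hW hh H3
    fun n _ => abs_theta_mul_lio_le n _).sieve hW 5
  obtain ⟨C₈, hC₈, e₈⟩ := (hasMain_of_level_shift (v := v)
    (G := fun n => theta (n + h) * lio n) hη hηϑ hW hh H4 (fun n _ => by
      split_ifs
      · exact abs_theta_mul_lio_le n _
      · rw [abs_zero]
        linarith [Real.log_natCast_nonneg n]) fun n hn => by
      rw [if_pos (by omega), Nat.add_sub_cancel]).sieve hW 5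
  set C := C₁ + C₂ + C₃ + C₄ + C₅ + C₆ + C₇ + C₈ with hCdef
  have hC : 0 < C := by positivity
  set κ : ℝ := W.totient / W with hκdef
  have hW' : (0 : ℝ) < W := by exact_mod_cast hW
  have hφ : (0 : ℝ) < W.totient := by exact_mod_cast Nat.totient_pos.2 hW
  have hκ : 0 < κ := by positivity
  have hκ1 : κ ≤ 1 := (totient_div_mem hW).2
  set K : ℝ := 10 * (W + 1) ^ 2 with hK
  have hlog : Tendsto (fun N : ℕ => Real.log N) atTop atTop :=
    Real.tendsto_log_atTop.comp tendsto_natCast_atTop_atTop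
  have hpow : Tendsto (fun N : ℕ => (N : ℝ) ^ (1e-4 : ℝ)) atTop atTop :=
    (tendsto_rpow_atTop (by norm_num)).comp tendsto_natCast_atTop_atTop
  filter_upwards [eventually_ge_atTop 2, hlog.eventually_ge_atTop 10,
    hlog.eventually_ge_atTop (1e5 * h), hlog.eventually_ge_atTop (K * 1e5 / κ ^ 3 / 0.3641),
    hlog.eventually_ge_atTop (13 * C * W / (5e-4 * κ ^ 2) / 0.3641),
    hpow.eventually_ge_atTop W] with N hN g1 g2 g3 g4 g5
  have hN0 : (0 : ℝ) < N := by exact_mod_cast (by omega : 0 < N)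
  have hN1 : (1 : ℝ) ≤ N := by exact_mod_cast (by omega : 1 ≤ N)
  set ℓ := Real.log N with hℓ
  set L := 0.3641 * ℓ with hL
  set R : ℝ := (N : ℝ) ^ (0.3641 : ℝ) with hR
  set M := ⌊R⌋₊ with hM
  have hR0 : 0 < R := Real.rpow_pos_of_pos hN0 _
  have hRM : R < M + 1 := Nat.lt_floor_add_one R
  have hMR : (M : ℝ) ≤ R := Nat.floor_le hR0.le
  have hM1 : 1 ≤ M := Nat.le_floor (by
    rw [Nat.cast_one]
    exact Real.one_le_rpow hN1 (by norm_num))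
  have hLM : L < Real.log (M + 1) := by
    have := Real.log_lt_log hR0 hRM
    rwa [hR, Real.log_rpow hN0] at this
  have hL1 : 1 ≤ L := by rw [hL]; linarith
  have hWM : ((W * (M * M) : ℕ) : ℝ) ≤ (N : ℝ) ^ (0.7283 : ℝ) := by
    push_cast
    calc (W : ℝ) * (M * M) ≤ (N : ℝ) ^ (1e-4 : ℝ) * (R * R) := by gcongr
      _ = _ := by
        rw [hR, ← Real.rpow_add hN0, ← Real.rpow_add hN0]
        norm_num
  set lam := sieveWeight W M (ySeq L) with hlamdef
  set Λ := lam 1 with hΛ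
  have hlam : ∀ d ∈ sqfreeCoprime W M, |lam d| ≤ (d.divisors.card : ℝ) ^ 2 * Λ :=
    fun d hd => abs_sieveWeight_le W M h2W _ (ySeq_nonneg L)
      (fun m n hm hmn => ySeq_antitone (by linarith) m n hm hmn) d hd
  obtain ⟨hΛ0, hΛS⟩ := sieveWeight_one_le W M h2W L
  have p₁ := e₁ N M lam Λ hN hWM hlam
  have p₂ := e₂ N M lam Λ hN hWM hlam
  have p₃ := e₃ N M lam Λ hN hWM hlam
  have p₄ := e₄ N M lam Λ hN hWM hlam
  have p₅ := e₅ N M lam Λ hN hWM hlam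
  have p₆ := e₆ N M lam Λ hN hWM hlam
  have p₇ := e₇ N M lam Λ hN hWM hlam
  have p₈ := e₈ N M lam Λ hN hWM hlam
  have hS₁ := mainTerm_two_div W M (ySeq L) h2W
  have hS₂ := mainTerm_totient_ySeq_ge W M L hL1 hM1 hLM hW h2W
  have hS₁' := sum_ySeq_sq_le W M D L hL1 hM1 hLM hW (by omega) hDW
  rw [← hlamdef] at hS₁ hS₂
  rw [hS₁] at p₁
  set S₁ := ∑ s ∈ sqfreeCoprime W M, primeProd (fun p => 2 / ((p : ℝ) - 2)) s * ySeq L s ^ 2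
  set S₂ := ∑ d ∈ sqfreeCoprime W M, ∑ e ∈ sqfreeCoprime W M, lam d * lam e *
    primeProd (fun p => 1 / ((p : ℝ) - 1)) (d.lcm e)
  have hup := weightedSum_le_pairs (v := v) (N := N) (h := h) hΛ0 hlam
  rw [zero_mul, sub_zero] at p₄ p₅ p₆ p₇ p₈
  have hQ : ∀ c, 0 < c → c ≤ C → ∀ x : ℝ, |x| ≤ Λ ^ 2 * (c * N / ℓ ^ 5) →
      |x| ≤ Λ ^ 2 * (C * N / ℓ ^ 5) := fun c hc hcC x hx => by
    have : 0 < ℓ := by linarith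
    exact hx.trans (by gcongr)
  replace p₁ := hQ _ hC₁ (by linarith) _ p₁
  replace p₂ := hQ _ hC₂ (by linarith) _ p₂
  replace p₃ := hQ _ hC₃ (by linarith) _ p₃
  replace p₄ := hQ _ hC₄ (by linarith) _ p₄
  replace p₅ := hQ _ hC₅ (by linarith) _ p₅
  replace p₆ := hQ _ hC₆ (by linarith) _ p₆
  replace p₇ := hQ _ hC₇ (by linarith) _ p₇
  replace p₈ := hQ _ hC₈ (by linarith) _ p₈
  change |weightedSum lam W M v h N _ - _| ≤ _ at p₁ p₂ p₃
  change |weightedSum lam W M v h N _| ≤ _ at p₄ p₅ p₆ p₇ p₈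
  have hLN0 := Real.log_natCast_nonneg (N + h)
  set LN := Real.log ((N + h : ℕ) : ℝ) with hLN
  set P : ℝ := (((Finset.Icc 1 N).filter fun n =>
    n % W = v % W ∧ n.Prime ∧ (n + h).Prime).card : ℝ) with hPdef
  set Z := Λ ^ 2 * (C * N / ℓ ^ 5) with hZ
  have hφW : (N : ℝ) / W.totient = N / (W * κ) := by
    rw [hκdef]; field_simp
  rw [hφW] at p₂ p₃
  have hlow : 4 * (N / (W * κ)) * S₂ - LN * (N / W) * S₁ - (8 + 4 * LN) * Z ≤
      16384 * LN * Λ ^ 2 * P := by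
    refine le_trans ?_ hup
    rw [abs_le] at p₁ p₂ p₃ p₄ p₅ p₆ p₇ p₈
    have hA := mul_le_mul_of_nonneg_left (by linarith [p₁.2, p₄.1, p₅.1, p₆.2] :
      weightedSum lam W M v h N (fun _ => 1) - weightedSum lam W M v h N lio -
        weightedSum lam W M v h N (fun n => lio (n + h)) +
        weightedSum lam W M v h N (fun n => lio n * lio (n + h)) ≤ N / W * S₁ + 4 * Z) hLN0
    linarith [p₂.1, p₃.1, p₇.2, p₈.2]
  have hκ3 : 0 < κ ^ 3 := by positivity
  rw [div_div, div_le_iff₀ (by positivity)] at g3 g4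
  have g3' : K ≤ 1e-5 * κ ^ 3 * L := by rw [hL]; linarith
  have g4' : 13 * C * W ≤ 5e-4 * κ ^ 2 * L ^ 3 := by
    have h3 : L ≤ L ^ 3 := le_self_pow₀ hL1 (by norm_num)
    have h4 : 5e-4 * κ ^ 2 * L ≤ 5e-4 * κ ^ 2 * L ^ 3 := by gcongr
    refine le_trans ?_ h4
    rw [hL]
    linarith
  exact sieve_constants hκ hκ1 hW' hL (by linarith) hN0 hLN0 (log_add_le_add (by omega) h)
    (Real.exp_pos _) (exp_four_div_le hD) hS₂ hS₁' hΛ0 hΛS g3' (by linarith) hC g4' hlow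
    (Nat.cast_nonneg _)

/-- The number of residue classes `x` modulo `m` for which `x (x + h)` is a unit. -/
noncomputable def unitClasses (h m : ℕ) : ℕ := Nat.card {x : ZMod m // IsUnit (x * (x + h))}

lemma unitClasses_mul (h : ℕ) {m n : ℕ} (hmn : m.Coprime n) :
    unitClasses h (m * n) = unitClasses h m * unitClasses h n := by
  unfold unitClasses
  rw [← Nat.card_prod]
  refine Nat.card_congr (Equiv.trans ?_ Equiv.subtypeProdEquivProd)
  refine (ZMod.chineseRemainder hmn).toEquiv.subtypeEquiv fun x => ?_
  have h1 := MulEquiv.isUnit_map (ZMod.chineseRemainder hmn) (x := x * (x + h))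
  rw [map_mul, map_add, map_natCast, Prod.isUnit_iff] at h1
  exact h1.symm

lemma unitClasses_one (h : ℕ) : unitClasses h 1 = 1 := by
  unfold unitClasses
  rw [Nat.card_eq_one_iff_unique]
  exact ⟨⟨fun a b => Subtype.ext (Subsingleton.elim _ _)⟩, ⟨0, isUnit_of_subsingleton _⟩⟩

/-- The Euler factor of `singSeries0`. -/
noncomputable def localFactor (h p : ℕ) : ℝ :=
  if p ∣ h then (1 - 1 / (p : ℝ))⁻¹ else 1 - 1 / ((p : ℝ) - 1) ^ 2

lemma unitClasses_prime (h : ℕ) {p : ℕ} (hp : p.Prime) :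
    (unitClasses h p : ℝ) = localFactor h p * (p * (1 - 1 / (p : ℝ)) ^ 2) := by
  have : Fact p.Prime := ⟨hp⟩
  have hp1 : (1 : ℝ) < p := by exact_mod_cast hp.one_lt
  have hp0 : (p : ℝ) ≠ 0 := by linarith
  have hp2 : (p : ℝ) - 1 ≠ 0 := by linarith
  have h1 : unitClasses h p = (({0, -(h : ZMod p)} : Finset (ZMod p))ᶜ).card := by
    unfold unitClasses
    rw [Nat.card_eq_fintype_card, Fintype.card_subtype]
    congr 1
    ext x
    simp [add_eq_zero_iff_eq_neg]
  rw [h1, Finset.card_compl, ZMod.card, localFactor]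
  split_ifs with hd
  · have : (h : ZMod p) = 0 := (ZMod.natCast_eq_zero_iff h p).2 hd
    rw [this, neg_zero, Finset.pair_eq_singleton, Finset.card_singleton, Nat.cast_sub hp.one_le]
    field_simp
    simp
  · have : (0 : ZMod p) ≠ -(h : ZMod p) := fun h2 => hd <| by
      rwa [eq_comm, neg_eq_zero, ZMod.natCast_eq_zero_iff] at h2
    rw [Finset.card_pair this, Nat.cast_sub hp.two_le]
    field_simp
    push_cast
    ring

lemma unitClasses_prod (h : ℕ) (s : Finset ℕ) (hs : ∀ p ∈ s, p.Prime) :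
    (unitClasses h (∏ p ∈ s, p) : ℝ) = (∏ p ∈ s, localFactor h p) *
      ((∏ p ∈ s, p : ℕ) * (((∏ p ∈ s, p).totient : ℝ) / (∏ p ∈ s, p : ℕ)) ^ 2) := by
  induction s using Finset.induction_on with
  | empty => simp [unitClasses_one]
  | insert p s hps ih =>
    have hp := hs p (Finset.mem_insert_self p s)
    have hp1 : (1 : ℝ) < p := by exact_mod_cast hp.one_lt
    have hp0 : (p : ℝ) ≠ 0 := by linarith
    have hs' : ∀ q ∈ s, q.Prime := fun q hq => hs q (Finset.mem_insert_of_mem hq)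
    have hcop : p.Coprime (∏ q ∈ s, q) := Nat.Coprime.prod_right fun q hq =>
      (Nat.coprime_primes hp (hs' q hq)).2 fun e => hps (e ▸ hq)
    have hprod : ((∏ q ∈ s, q : ℕ) : ℝ) ≠ 0 := by
      exact_mod_cast Finset.prod_ne_zero_iff.2 fun q hq => (hs' q hq).ne_zero
    rw [Finset.prod_insert hps, Finset.prod_insert hps, unitClasses_mul h hcop,
      Nat.totient_mul hcop, Nat.totient_prime hp, Nat.cast_mul, ih hs', unitClasses_prime h hp,
      Nat.cast_mul, Nat.cast_mul, Nat.cast_sub hp.one_le]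
    set P := ((∏ q ∈ s, q : ℕ) : ℝ)
    field_simp
    push_cast
    ring

lemma localFactor_nonneg {h p : ℕ} (hp : p.Prime) (h2 : Even h) : 0 ≤ localFactor h p := by
  have hp1 : (1 : ℝ) < p := by exact_mod_cast hp.one_lt
  unfold localFactor
  split_ifs with hd
  · refine inv_nonneg.2 (sub_nonneg.2 ?_)
    rw [div_le_one (by linarith)]
    exact hp1.le
  · have hp3 : 3 ≤ p := by
      rcases hp.two_le.eq_or_lt with e | e
      · exact absurd (e ▸ even_iff_two_dvd.1 h2) hd
      · exact e
    have hp3' : (3 : ℝ) ≤ p := by exact_mod_cast hp3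
    rw [sub_nonneg, div_le_one (by nlinarith)]
    nlinarith

lemma localFactor_le_one {h p : ℕ} (hd : ¬ p ∣ h) : localFactor h p ≤ 1 := by
  rw [localFactor, if_neg hd]
  have : 0 ≤ 1 / ((p : ℝ) - 1) ^ 2 := by positivity
  linarith

lemma multipliable_localFactor {h : ℕ} (h0 : 0 < h) :
    Multipliable fun p : Nat.Primes => localFactor h p := by
  have hs : Summable fun n : ℕ => (4 : ℝ) * (1 / (n : ℝ) ^ 2) :=
    (Real.summable_one_div_nat_pow.2 one_lt_two).mul_left 4
  have hs' : Summable fun p : Nat.Primes => (4 : ℝ) * (1 / ((p : ℕ) : ℝ) ^ 2) :=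
    hs.comp_injective (i := fun p : Nat.Primes => (p : ℕ)) Subtype.coe_injective
  have hfin : {p : Nat.Primes | (p : ℕ) ∣ h}.Finite :=
    Set.Finite.of_injOn (f := fun p : Nat.Primes => (p : ℕ)) (t := (h.divisors : Set ℕ))
      (fun p hp => by simpa [h0.ne'] using hp) (Subtype.coe_injective.injOn)
      (Finset.finite_toSet _)
  have h1 : Summable fun p : Nat.Primes => localFactor h p - 1 := by
    refine Summable.of_norm_bounded_eventually hs' ?_
    rw [Filter.eventually_cofinite]
    refine hfin.subset fun p hp => ?_
    by_contra hd
    refine hp ?_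
    have hd' : ¬ (p : ℕ) ∣ h := hd
    have hp2 : (2 : ℝ) ≤ (p : ℕ) := by exact_mod_cast p.2.two_le
    rw [localFactor, if_neg hd', sub_sub_cancel_left, norm_neg, Real.norm_of_nonneg (by positivity),
      ← mul_one_div_cancel (two_ne_zero' ℝ), mul_one_div_cancel (two_ne_zero' ℝ), mul_one_div,
      div_le_div_iff₀ (by nlinarith) (by positivity)]
    nlinarith
  have h2 := Real.multipliable_one_add_of_summable h1
  simpa using h2

lemma singSeries0_le_prod {h D : ℕ} (h0 : 0 < h) (h2 : Even h) (hD : h ≤ D) :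
    singSeries0 h ≤ ∏ p ∈ (Finset.range (D + 1)).filter Nat.Prime, localFactor h p := by
  set s := (Finset.range (D + 1)).filter Nat.Prime with hs
  have hmem : ∀ p ∈ s, p.Prime := fun p hp => (Finset.mem_filter.1 hp).2
  set t : Finset Nat.Primes := s.subtype Nat.Prime with ht
  have hst : ∏ p ∈ s, localFactor h p = ∏ p ∈ t, localFactor h (p : ℕ) :=
    (Finset.prod_subtype_of_mem _ hmem).symm
  rw [hst]
  have hprod := (multipliable_localFactor h0).hasProd
  refine le_of_tendsto (f := fun u : Finset Nat.Primes => ∏ p ∈ u, localFactor h (p : ℕ)) hprod ?_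
  filter_upwards [eventually_ge_atTop t] with u hu
  rw [← Finset.prod_sdiff (hu : t ⊆ u)]
  refine mul_le_of_le_one_left (Finset.prod_nonneg fun p _ => localFactor_nonneg p.2 h2) ?_
  refine Finset.prod_le_one (fun p _ => localFactor_nonneg p.2 h2) fun p hp => ?_
  refine localFactor_le_one fun hd => (Finset.mem_sdiff.1 hp).2 ?_
  have := Nat.le_of_dvd h0 hd
  refine Finset.mem_subtype.2 ?_
  rw [hs, Finset.mem_filter, Finset.mem_range]
  exact ⟨by omega, p.2⟩

/-- **Theorem 2.** There is an absolute constant `c > 0` such that, for every positive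
even `h` and every `ϑ ≥ 0.7284` for which Hypothesis D(ϑ, h) holds, the number of primes
`p ≤ N` with `p + h` prime is at least `c 𝔖₀(h) N / (log N)²` for large `N`. -/
theorem prime_pairs_lower_bound :
    ∃ c : ℝ, 0 < c ∧ ∀ h : ℕ, 0 < h → Even h → ∀ ϑ : ℝ, 0.7284 ≤ ϑ → HypD ϑ h →
      ∃ N₁ : ℕ, ∀ N : ℕ, N₁ ≤ N →
        c * singSeries0 h * N / Real.log N ^ 2 ≤
          (((Finset.Icc 1 N).filter fun p => p.Prime ∧ (p + h).Prime).card : ℝ) := by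
  refine ⟨4e-8, by norm_num, fun h h0 h2 ϑ hϑ H => ?_⟩
  set D := max h 10000 with hDdef
  set s := (Finset.range (D + 1)).filter Nat.Prime with hs
  have hmem : ∀ p ∈ s, p.Prime := fun p hp => (Finset.mem_filter.1 hp).2
  set W := ∏ p ∈ s, p with hWdef
  have hW : 0 < W := Finset.prod_pos fun p hp => (hmem p hp).pos
  have : NeZero W := ⟨hW.ne'⟩
  have hDW : ∀ p : ℕ, p.Prime → p ≤ D → p ∣ W := fun p hp hpD =>
    Finset.dvd_prod_of_mem _ (Finset.mem_filter.2 ⟨Finset.mem_range.2 (by omega), hp⟩)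
  have hh : ∀ p : ℕ, p.Prime → p ∣ h → p ∣ W := fun p hp hph =>
    hDW p hp ((Nat.le_of_dvd h0 hph).trans (le_max_left _ _))
  classical
  set V : Finset (ZMod W) := Finset.univ.filter fun x => IsUnit (x * (x + h)) with hV
  have hcard : (V.card : ℝ) = (∏ p ∈ s, localFactor h p) * (W * ((W.totient : ℝ) / W) ^ 2) := by
    rw [← unitClasses_prod h s hmem, unitClasses, Nat.card_eq_fintype_card, Fintype.card_subtype]
  have hev := (Filter.eventually_all_finset V (l := atTop)
    (p := fun x (N : ℕ) => 4e-8 * (N : ℝ) / (W * (W.totient / W : ℝ) ^ 2 * Real.log N ^ 2) ≤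
      (((Finset.Icc 1 N).filter fun n => n % W = x.val % W ∧ n.Prime ∧ (n + h).Prime).card : ℝ))).2
    fun x hx => by
      have hu := (Finset.mem_filter.1 hx).2
      rw [IsUnit.mul_iff] at hu
      have hx' : ((x.val : ℕ) : ZMod W) = x := ZMod.natCast_zmod_val x
      refine eventually_pairs_class hϑ H hW (le_max_right _ _) hDW hh ?_ ?_
      · rw [← ZMod.isUnit_iff_coprime, hx']
        exact hu.1
      · rw [← ZMod.isUnit_iff_coprime, Nat.cast_add, hx']
        exact hu.2
  obtain ⟨N₁, hN₁⟩ := eventually_atTop.1 hev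
  refine ⟨N₁, fun N hN => ?_⟩
  have h3 := Finset.sum_le_sum (hN₁ N hN)
  rw [Finset.sum_const, nsmul_eq_mul, hcard] at h3
  have h4 : ∑ x ∈ V, (((Finset.Icc 1 N).filter fun n =>
      n % W = x.val % W ∧ n.Prime ∧ (n + h).Prime).card : ℝ) ≤
      (((Finset.Icc 1 N).filter fun p => p.Prime ∧ (p + h).Prime).card : ℝ) := by
    rw [← Nat.cast_sum, Nat.cast_le, ← Finset.card_biUnion]
    · refine Finset.card_le_card fun n hn => ?_
      obtain ⟨x, -, hx⟩ := Finset.mem_biUnion.1 hn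
      rw [Finset.mem_filter] at hx ⊢
      exact ⟨hx.1, hx.2.2⟩
    · intro x _ y _ hxy
      rw [Function.onFun, Finset.disjoint_left]
      intro n hn hn'
      have e := (Finset.mem_filter.1 hn).2.1.symm.trans (Finset.mem_filter.1 hn').2.1
      rw [Nat.mod_eq_of_lt x.val_lt, Nat.mod_eq_of_lt y.val_lt] at e
      exact hxy (ZMod.val_injective W e)
  refine le_trans ?_ (h3.trans h4)
  have hS := singSeries0_le_prod h0 h2 (le_max_left h 10000)
  have hW' : (0 : ℝ) < W := by exact_mod_cast hW
  have hφ : (0 : ℝ) < W.totient := by exact_mod_cast Nat.totient_pos.2 hW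
  have h5 : 4e-8 * (N : ℝ) / (W * (W.totient / W : ℝ) ^ 2 * Real.log N ^ 2) =
      (W * (W.totient / W : ℝ) ^ 2)⁻¹ * (4e-8 * N / Real.log N ^ 2) := by
    rw [mul_comm (W * (W.totient / W : ℝ) ^ 2), ← div_div, div_eq_inv_mul]
  rw [h5, mul_assoc (∏ p ∈ s, localFactor h p), mul_inv_cancel_left₀ (by positivity)]
  calc 4e-8 * singSeries0 h * N / Real.log N ^ 2
      = singSeries0 h * (4e-8 * N / Real.log N ^ 2) := by ring
    _ ≤ _ := mul_le_mul_of_nonneg_right hS (by positivity)
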